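/- Let n ≥ 0 be an integer, let p, q ∈ ℂ with 0 < |p| < 1 and 0 < |q| < 1, and let t_0,...,t_{n+1}, u_0,...,u_{n+1} ∈ ℂ be nonzero with |t_r| < 1 and |u_r| < 1 for all r and ∏_{r=0}^{n+1} t_r u_r = pq. Set T = ∏_r t_r and U = ∏_r u_r. Then ((p;p)_∞ (q;q)_∞)^n/(n+1)! · (1/(2π)^n) ∫_{[0,2π]^n} ∏_{i=0}^{n} ∏_{r=0}^{n+1} Γ(t_r z_i;p,q) Γ(u_r/z_i;p,q) / ∏_{0≤i<j≤n} Γ(z_i/z_j;p,q) Γ(z_j/z_i;p,q) dθ_1⋯dθ_n = ∏_{r=0}^{n+1} ∏_{s=0}^{n+1} Γ(t_r u_s;p,q) · ∏_{r=0}^{n+1} Γ(U/u_r;p,q) Γ(T/t_r;p,q), where z_i = e^{iθ_i} for 1 ≤ i ≤ n and z_0 = 1/(z_1⋯z_n). -/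

import Mathlib

open scoped BigOperators Real
open MeasureTheory

/-- The elliptic Gamma function `Γ(x;p,q)`. -/
noncomputable def ellGamma (x p q : ℂ) : ℂ :=
  ∏' jk : ℕ × ℕ, ((1 - p ^ (jk.1 + 1) * q ^ (jk.2 + 1) / x) / (1 - p ^ jk.1 * q ^ jk.2 * x))

/-- `(p;p)_∞`. -/
noncomputable def qPoch (p : ℂ) : ℂ := ∏' k : ℕ, (1 - p ^ (k + 1))

/-- The double `q`-Pochhammer symbol `(x;p,q)_∞`. -/
noncomputable def dblPoch (x p q : ℂ) : ℂ := ∏' jk : ℕ × ℕ, (1 - p ^ jk.1 * q ^ jk.2 * x)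

/-- The `q`-Pochhammer symbol `(x;p)_∞`. -/
noncomputable def infPoch (x p : ℂ) : ℂ := ∏' j : ℕ, (1 - p ^ j * x)

/-- The modified theta function `θ(x;p) = (x;p)_∞ (p/x;p)_∞`. -/
noncomputable def ellTheta (x p : ℂ) : ℂ := infPoch x p * infPoch (p / x) p

section Products

open Filter Topology

variable {p q x : ℂ}

lemma summable_pow_mul_pow {r s : ℝ} (hr0 : 0 ≤ r) (hr : r < 1) (hs0 : 0 ≤ s) (hs : s < 1)
    (R : ℝ) : Summable fun jk : ℕ × ℕ => r ^ jk.1 * s ^ jk.2 * R :=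
  ((summable_geometric_of_lt_one hr0 hr).mul_of_nonneg (summable_geometric_of_lt_one hs0 hs)
    (fun _ => by positivity) (fun _ => by positivity)).mul_right R

lemma summable_dblPoch (hp : ‖p‖ < 1) (hq : ‖q‖ < 1) (x : ℂ) :
    Summable fun jk : ℕ × ℕ => ‖-(p ^ jk.1 * q ^ jk.2 * x)‖ := by
  simpa using summable_pow_mul_pow (norm_nonneg p) hp (norm_nonneg q) hq ‖x‖

lemma multipliable_dblPoch (hp : ‖p‖ < 1) (hq : ‖q‖ < 1) (x : ℂ) :
    Multipliable fun jk : ℕ × ℕ => 1 - p ^ jk.1 * q ^ jk.2 * x := by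
  simpa [sub_eq_add_neg] using multipliable_one_add_of_summable (summable_dblPoch hp hq x)

lemma multipliable_infPoch (hp : ‖p‖ < 1) (x : ℂ) :
    Multipliable fun j : ℕ => 1 - p ^ j * x := by
  have : Summable fun j : ℕ => ‖-(p ^ j * x)‖ := by
    simpa using (summable_geometric_of_lt_one (norm_nonneg p) hp).mul_right ‖x‖
  simpa [sub_eq_add_neg] using multipliable_one_add_of_summable this

lemma dblPoch_ne_zero (hp : ‖p‖ < 1) (hq : ‖q‖ < 1)
    (h : ∀ j k : ℕ, p ^ j * q ^ k * x ≠ 1) : dblPoch x p q ≠ 0 := by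
  have := tprod_one_add_ne_zero_of_summable (f := fun jk : ℕ × ℕ => -(p ^ jk.1 * q ^ jk.2 * x))
    (fun jk => by simpa [← sub_eq_add_neg, sub_eq_zero] using (h jk.1 jk.2).symm)
    (summable_dblPoch hp hq x)
  simpa [dblPoch, sub_eq_add_neg] using this

lemma norm_pow_mul_pow_mul_le (hp : ‖p‖ < 1) (hq : ‖q‖ < 1) (j k : ℕ) :
    ‖p ^ j * q ^ k * x‖ ≤ ‖x‖ := by
  rw [norm_mul, norm_mul, norm_pow, norm_pow]
  have h1 : ‖p‖ ^ j ≤ 1 := pow_le_one₀ (norm_nonneg _) hp.le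
  have h2 : ‖q‖ ^ k ≤ 1 := pow_le_one₀ (norm_nonneg _) hq.le
  have h3 := mul_le_one₀ h1 (by positivity) h2
  exact mul_le_of_le_one_left (norm_nonneg _) h3

lemma dblPoch_ne_zero_of_norm_lt_one (hp : ‖p‖ < 1) (hq : ‖q‖ < 1) (hx : ‖x‖ < 1) :
    dblPoch x p q ≠ 0 := by
  refine dblPoch_ne_zero hp hq fun j k h => ?_
  have := norm_pow_mul_pow_mul_le (x := x) hp hq j k
  rw [h, norm_one] at this
  linarith

lemma multipliable_dblPoch_fiber (hq : ‖q‖ < 1) (x p : ℂ) (j : ℕ) :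
    Multipliable fun k : ℕ => 1 - p ^ j * q ^ k * x := by
  convert multipliable_infPoch hq (p ^ j * x) using 3
  ring

lemma hasProd_dblPoch (hp : ‖p‖ < 1) (hq : ‖q‖ < 1) (x : ℂ) :
    HasProd (fun j : ℕ => infPoch (p ^ j * x) q) (dblPoch x p q) := by
  refine (multipliable_dblPoch hp hq x).hasProd.prod_fiberwise fun j => ?_
  convert (multipliable_dblPoch_fiber hq x p j).hasProd using 1
  unfold infPoch
  refine tprod_congr fun k => ?_
  ring

lemma infPoch_eq_mul (hp : ‖p‖ < 1) (x : ℂ) : infPoch x p = (1 - x) * infPoch (p * x) p := by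
  have e : ∀ k : ℕ, 1 - p ^ k * (p * x) = 1 - p ^ (k + 1) * x := fun k => by ring
  have h : Multipliable fun k : ℕ => 1 - p ^ (k + 1) * x := by
    simpa only [e] using multipliable_infPoch hp (p * x)
  have := tprod_eq_zero_mul' (f := fun k : ℕ => 1 - p ^ k * x) h
  simpa only [infPoch, e, pow_zero, one_mul] using this

/-- `(x;p)_∞` is the special case `q = 0` of `(x;p,q)_∞`. -/
lemma dblPoch_zero_right (x p : ℂ) (hp : ‖p‖ < 1) : dblPoch x p 0 = infPoch x p := by
  rw [← (hasProd_dblPoch hp (by simp : ‖(0 : ℂ)‖ < 1) x).tprod_eq]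
  refine tprod_congr fun j => ?_
  rw [infPoch_eq_mul (by simp)]
  simp [infPoch]

lemma dblPoch_eq_mul (hp : ‖p‖ < 1) (hq : ‖q‖ < 1) (x : ℂ) :
    dblPoch x p q = infPoch x p * dblPoch (q * x) p q := by
  refine (hasProd_dblPoch hp hq x).unique ?_
  have h : HasProd (fun j : ℕ => 1 - p ^ j * x) (infPoch x p) := (multipliable_infPoch hp x).hasProd
  convert h.mul (hasProd_dblPoch hp hq (q * x)) using 2 with j
  rw [infPoch_eq_mul hq]
  ring_nf

lemma dblPoch_comm (x p q : ℂ) : dblPoch x p q = dblPoch x q p := by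
  unfold dblPoch
  rw [← (Equiv.prodComm ℕ ℕ).tprod_eq]
  refine tprod_congr fun jk => ?_
  simp [mul_comm]

lemma infPoch_ne_zero (hp : ‖p‖ < 1) (h : ∀ j : ℕ, p ^ j * x ≠ 1) : infPoch x p ≠ 0 := by
  rw [← dblPoch_zero_right x p hp]
  refine dblPoch_ne_zero hp (by simp) fun j k => ?_
  rcases k with _ | k
  · simpa using h j
  · simp

lemma infPoch_ne_zero_of_norm_lt_one (hp : ‖p‖ < 1) (hx : ‖x‖ < 1) : infPoch x p ≠ 0 := by
  rw [← dblPoch_zero_right x p hp]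
  exact dblPoch_ne_zero_of_norm_lt_one hp (by simp) hx

lemma infPoch_eq_zero {j : ℕ} (h : p ^ j * x = 1) : infPoch x p = 0 :=
  tprod_of_exists_eq_zero ⟨j, by simp [h]⟩

lemma qPoch_eq (p : ℂ) : qPoch p = infPoch p p := by
  simp [qPoch, infPoch, pow_succ]

lemma continuousOn_dblPoch :
    ContinuousOn (fun v : ℂ × ℂ × ℂ => dblPoch v.1 v.2.1 v.2.2)
      {v | ‖v.2.1‖ < 1 ∧ ‖v.2.2‖ < 1} := by
  rintro ⟨x, p, q⟩ ⟨hp, hq⟩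
  obtain ⟨r, hpr, hr⟩ := exists_between hp
  obtain ⟨s, hqs, hs⟩ := exists_between hq
  have hr0 := (norm_nonneg _).trans hpr.le
  have hs0 := (norm_nonneg _).trans hqs.le
  set U : Set (ℂ × ℂ × ℂ) := {v | ‖v.1‖ < ‖x‖ + 1 ∧ ‖v.2.1‖ < r ∧ ‖v.2.2‖ < s}
  have hU : IsOpen U := by
    have h1 : IsOpen {v : ℂ × ℂ × ℂ | ‖v.1‖ < ‖x‖ + 1} := isOpen_lt (by fun_prop) (by fun_prop)
    have h2 : IsOpen {v : ℂ × ℂ × ℂ | ‖v.2.1‖ < r} := isOpen_lt (by fun_prop) (by fun_prop)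
    have h3 : IsOpen {v : ℂ × ℂ × ℂ | ‖v.2.2‖ < s} := isOpen_lt (by fun_prop) (by fun_prop)
    exact h1.inter (h2.inter h3)
  have key := Summable.hasProdLocallyUniformlyOn_one_add
    (f := fun (jk : ℕ × ℕ) (v : ℂ × ℂ × ℂ) => -(v.2.1 ^ jk.1 * v.2.2 ^ jk.2 * v.1)) hU
    (summable_pow_mul_pow hr0 hr hs0 hs (‖x‖ + 1))
    (Eventually.of_forall fun jk v hv => by
      rw [norm_neg, norm_mul, norm_mul, norm_pow, norm_pow]
      have := hv.1.le; have := hv.2.1.le; have := hv.2.2.le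
      gcongr)
    (fun jk => by fun_prop)
  have hc := (hasProdLocallyUniformlyOn_iff_tendstoLocallyUniformlyOn.mp key).continuousOn
    (Frequently.of_forall fun s => by fun_prop)
  have := hc.continuousAt (hU.mem_nhds (x := (x, p, q)) ⟨by simp, hpr, hqs⟩)
  simpa only [dblPoch, sub_eq_add_neg] using this.continuousWithinAt

lemma differentiableAt_dblPoch {f g h : ℂ → ℂ} {w : ℂ} (hp : ‖g w‖ < 1) (hq : ‖h w‖ < 1)
    (hf' : ∀ᶠ z in 𝓝 w, DifferentiableAt ℂ f z) (hg' : ∀ᶠ z in 𝓝 w, DifferentiableAt ℂ g z)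
    (hh' : ∀ᶠ z in 𝓝 w, DifferentiableAt ℂ h z) :
    DifferentiableAt ℂ (fun z => dblPoch (f z) (g z) (h z)) w := by
  obtain ⟨r, hpr, hr⟩ := exists_between hp
  obtain ⟨s, hqs, hs⟩ := exists_between hq
  have hr0 := (norm_nonneg _).trans hpr.le
  have hs0 := (norm_nonneg _).trans hqs.le
  have hx : ‖f w‖ < ‖f w‖ + 1 := by simp
  have e1 := hf'.self_of_nhds.continuousAt.norm.eventually (gt_mem_nhds hx)
  have e2 := hg'.self_of_nhds.continuousAt.norm.eventually (gt_mem_nhds hpr)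
  have e3 := hh'.self_of_nhds.continuousAt.norm.eventually (gt_mem_nhds hqs)
  obtain ⟨U, hU, hUo, hw⟩ := eventually_nhds_iff.mp
    (hf'.and (hg'.and (hh'.and (e1.and (e2.and e3)))))
  have key := Summable.hasProdLocallyUniformlyOn_one_add
    (f := fun (jk : ℕ × ℕ) (z : ℂ) => -(g z ^ jk.1 * h z ^ jk.2 * f z)) hUo
    (summable_pow_mul_pow hr0 hr hs0 hs (‖f w‖ + 1))
    (Eventually.of_forall fun jk v hv => by
      obtain ⟨-, -, -, h1, h2, h3⟩ := hU v hv
      rw [norm_neg, norm_mul, norm_mul, norm_pow, norm_pow]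
      gcongr)
    (fun jk z hz => by
      obtain ⟨d1, d2, d3, -⟩ := hU z hz
      exact (((d2.pow _).mul (d3.pow _)).mul d1).neg.continuousAt.continuousWithinAt)
  have hc := (hasProdLocallyUniformlyOn_iff_tendstoLocallyUniformlyOn.mp key).differentiableOn
    (Eventually.of_forall fun s z hz => by
      obtain ⟨d1, d2, d3, -⟩ := hU z hz
      refine (DifferentiableAt.fun_finsetProd fun i _ => ?_).differentiableWithinAt
      exact ((((d2.pow _).mul (d3.pow _)).mul d1).neg.const_add 1)) hUo
  simpa only [dblPoch, sub_eq_add_neg] using hc.differentiableAt (hUo.mem_nhds hw)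

end Products

section EllipticFunctions

open Filter Topology

variable {p q x : ℂ}

lemma ellGamma_eq (hp : ‖p‖ < 1) (hq : ‖q‖ < 1) (x : ℂ) :
    ellGamma x p q = dblPoch (p * q / x) p q / dblPoch x p q := by
  have e : ∀ jk : ℕ × ℕ, 1 - p ^ (jk.1 + 1) * q ^ (jk.2 + 1) / x =
      1 - p ^ jk.1 * q ^ jk.2 * (p * q / x) := fun jk => by ring
  unfold ellGamma
  simp only [e]
  by_cases h : dblPoch x p q = 0
  · rw [h, div_zero]
    have : ∃ j k : ℕ, p ^ j * q ^ k * x = 1 := by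
      by_contra! h'
      exact dblPoch_ne_zero hp hq h' h
    obtain ⟨j, k, hjk⟩ := this
    exact tprod_of_exists_eq_zero ⟨(j, k), by simp [hjk]⟩
  · exact Multipliable.tprod_div₀ (multipliable_dblPoch hp hq _) (multipliable_dblPoch hp hq x) h

lemma ellGamma_reflect (hp0 : p ≠ 0) (hq0 : q ≠ 0) (hp : ‖p‖ < 1) (hq : ‖q‖ < 1) (x : ℂ)
    (hx : x ≠ 0) : ellGamma (p * q / x) p q = (ellGamma x p q)⁻¹ := by
  rw [ellGamma_eq hp hq, ellGamma_eq hp hq, inv_div]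
  congr 2
  field_simp

lemma norm_div_lt_one {a b : ℂ} (h : ‖a‖ < ‖b‖) : ‖a / b‖ < 1 := by
  rw [norm_div]
  exact (div_lt_one ((norm_nonneg _).trans_lt h)).2 h

lemma ellGamma_ne_zero (hp : ‖p‖ < 1) (hq : ‖q‖ < 1) (hx : ‖x‖ < 1) (hx' : ‖p * q‖ < ‖x‖) :
    ellGamma x p q ≠ 0 := by
  rw [ellGamma_eq hp hq]
  exact div_ne_zero (dblPoch_ne_zero_of_norm_lt_one hp hq (norm_div_lt_one hx'))
    (dblPoch_ne_zero_of_norm_lt_one hp hq hx)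

lemma ellGamma_mul_q (hq0 : q ≠ 0) (hp : ‖p‖ < 1) (hq : ‖q‖ < 1) (x : ℂ)
    (h : infPoch x p ≠ 0) : ellGamma (q * x) p q = ellTheta x p * ellGamma x p q := by
  rw [ellGamma_eq hp hq, ellGamma_eq hp hq, ellTheta, dblPoch_eq_mul hp hq x]
  have e1 : p * q / (q * x) = p / x := by
    rw [mul_comm q x, mul_div_mul_right _ _ hq0]
  have e2 : q * (p / x) = p * q / x := by ring
  rw [e1, dblPoch_eq_mul hp hq (p / x), e2]
  rw [mul_div_assoc', mul_assoc, mul_div_mul_left _ _ h]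

lemma ellTheta_p_div (hp0 : p ≠ 0) (x : ℂ) (hx : x ≠ 0) : ellTheta (p / x) p = ellTheta x p := by
  have : p / (p / x) = x := by field_simp
  rw [ellTheta, ellTheta, this, mul_comm]

lemma ellTheta_mul_p (hp0 : p ≠ 0) (hp : ‖p‖ < 1) (x : ℂ) (hx : x ≠ 0) :
    ellTheta (p * x) p = -(1 / x) * ellTheta x p := by
  have e1 : p / (p * x) = 1 / x := by field_simp
  have e2 : p * (1 / x) = p / x := by ring
  rw [ellTheta, ellTheta, e1, infPoch_eq_mul hp x, infPoch_eq_mul hp (1 / x), e2]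
  field_simp
  ring

lemma ellTheta_inv (hp0 : p ≠ 0) (hp : ‖p‖ < 1) (x : ℂ) (hx : x ≠ 0) :
    ellTheta (1 / x) p = -(1 / x) * ellTheta x p := by
  rw [← ellTheta_mul_p hp0 hp x hx, ← ellTheta_p_div hp0 _ (mul_ne_zero hp0 hx)]
  congr 1
  field_simp

@[simp] lemma ellTheta_one (p : ℂ) : ellTheta 1 p = 0 := by
  rw [ellTheta, infPoch_eq_zero (j := 0) (by simp), zero_mul]

lemma ellTheta_ne_zero (hp : ‖p‖ < 1) (hx : ‖x‖ < 1) (hx' : ‖p‖ < ‖x‖) : ellTheta x p ≠ 0 :=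
  mul_ne_zero (infPoch_ne_zero_of_norm_lt_one hp hx)
    (infPoch_ne_zero_of_norm_lt_one hp (norm_div_lt_one hx'))

lemma exists_zpow_of_ellTheta_eq_zero (hp : ‖p‖ < 1) (hx : x ≠ 0)
    (h : ellTheta x p = 0) : ∃ k : ℤ, x = p ^ k := by
  rcases mul_eq_zero.mp h with h | h
  · have : ∃ j : ℕ, p ^ j * x = 1 := by
      by_contra! h'
      exact infPoch_ne_zero hp h' h
    obtain ⟨j, hj⟩ := this
    refine ⟨-j, ?_⟩
    rw [zpow_neg, zpow_natCast]
    exact eq_inv_of_mul_eq_one_right hj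
  · have : ∃ j : ℕ, p ^ j * (p / x) = 1 := by
      by_contra! h'
      exact infPoch_ne_zero hp h' h
    obtain ⟨j, hj⟩ := this
    refine ⟨j + 1, ?_⟩
    field_simp at hj
    rw [← hj]
    norm_cast

lemma ellTheta_mul_p_eq_zero_iff (hp0 : p ≠ 0) (hp : ‖p‖ < 1) (hx : x ≠ 0) :
    ellTheta (p * x) p = 0 ↔ ellTheta x p = 0 := by
  rw [ellTheta_mul_p hp0 hp x hx]
  simp [hx]

lemma ellTheta_zpow (hp0 : p ≠ 0) (hp : ‖p‖ < 1) (k : ℤ) : ellTheta (p ^ k) p = 0 := by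
  induction k with
  | zero => simp
  | succ i ih =>
    rw [zpow_add_one₀ hp0, mul_comm, ellTheta_mul_p_eq_zero_iff hp0 hp (zpow_ne_zero _ hp0), ih]
  | pred i ih =>
    rwa [← ellTheta_mul_p_eq_zero_iff hp0 hp (zpow_ne_zero _ hp0), ← zpow_one_add₀ hp0,
      add_sub_cancel]

lemma differentiableAt_infPoch (hp : ‖p‖ < 1) (x : ℂ) :
    DifferentiableAt ℂ (fun x => infPoch x p) x := by
  simp_rw [← dblPoch_zero_right _ p hp]
  exact differentiableAt_dblPoch (f := fun x => x) (g := fun _ => p) (h := fun _ => 0) hp (by simp)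
    (.of_forall fun _ => by fun_prop) (.of_forall fun _ => by fun_prop)
    (.of_forall fun _ => by fun_prop)

lemma differentiableAt_ellTheta (hp : ‖p‖ < 1) (hx : x ≠ 0) :
    DifferentiableAt ℂ (fun x => ellTheta x p) x :=
  (differentiableAt_infPoch hp x).mul
    ((differentiableAt_infPoch hp (p / x)).comp x (f := fun x => p / x)
      (by fun_prop (disch := assumption)))

lemma deriv_ellTheta_one (hp : ‖p‖ < 1) : deriv (fun x => ellTheta x p) 1 ≠ 0 := by
  have e : (fun x => ellTheta x p) =
      fun x => (1 - x) * (infPoch (p * x) p * infPoch (p / x) p) := by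
    funext x
    rw [ellTheta, infPoch_eq_mul hp x, mul_assoc]
  rw [e]
  have hd : DifferentiableAt ℂ (fun x => infPoch (p * x) p * infPoch (p / x) p) 1 :=
    ((differentiableAt_infPoch hp _).comp (1 : ℂ) (f := fun x => p * x) (by fun_prop)).mul
      ((differentiableAt_infPoch hp _).comp (1 : ℂ) (f := fun x => p / x)
        (by fun_prop (disch := norm_num)))
  have h1 : HasDerivAt (fun x : ℂ => 1 - x) (-1) 1 := by
    simpa using (hasDerivAt_id (1 : ℂ)).const_sub 1
  rw [(h1.fun_mul hd.hasDerivAt).deriv]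
  have := infPoch_ne_zero_of_norm_lt_one (x := p) hp hp
  simpa using this

lemma deriv_ellTheta_mul_p (hp0 : p ≠ 0) (hp : ‖p‖ < 1) (hx : x ≠ 0) (h : ellTheta x p = 0) :
    deriv (fun x => ellTheta x p) (p * x) = 0 ↔ deriv (fun x => ellTheta x p) x = 0 := by
  have h1 : HasDerivAt (fun y => ellTheta (p * y) p)
      (deriv (fun x => ellTheta x p) (p * x) * p) x := by
    have := (differentiableAt_ellTheta hp (mul_ne_zero hp0 hx)).hasDerivAt
    exact this.comp x (by simpa using (hasDerivAt_id x).const_mul p)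
  have h2 : HasDerivAt (fun y => -(1 / y) * ellTheta y p)
      (-(1 / x) * deriv (fun x => ellTheta x p) x) x := by
    have h3 : DifferentiableAt ℂ (fun y : ℂ => -(1 / y)) x := by fun_prop (disch := assumption)
    have := h3.hasDerivAt.mul (differentiableAt_ellTheta hp hx).hasDerivAt
    rwa [h, mul_zero, zero_add] at this
  have h3 := h1.congr_of_eventuallyEq (f₁ := fun y => -(1 / y) * ellTheta y p) (by
    filter_upwards [eventually_ne_nhds hx] with y hy
    rw [ellTheta_mul_p hp0 hp y hy])
  have := h3.unique h2
  constructor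
  · intro h
    rw [h, zero_mul] at this
    simpa [hx] using this.symm
  · intro h
    rw [h, mul_zero] at this
    simpa [hp0] using this

lemma deriv_ellTheta_ne_zero (hp0 : p ≠ 0) (hp : ‖p‖ < 1) (hx : x ≠ 0) (h : ellTheta x p = 0) :
    deriv (fun x => ellTheta x p) x ≠ 0 := by
  obtain ⟨k, rfl⟩ := exists_zpow_of_ellTheta_eq_zero hp hx h
  clear hx h
  induction k with
  | zero => simpa using deriv_ellTheta_one hp
  | succ i ih =>
    rwa [zpow_add_one₀ hp0, mul_comm, Ne,
      deriv_ellTheta_mul_p hp0 hp (zpow_ne_zero _ hp0) (ellTheta_zpow hp0 hp _)]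
  | pred i ih =>
    rwa [Ne, ← deriv_ellTheta_mul_p hp0 hp (zpow_ne_zero _ hp0) (ellTheta_zpow hp0 hp _),
      ← zpow_one_add₀ hp0, add_sub_cancel]

end EllipticFunctions

section ThreeTerm

open Filter Topology

lemma differentiable_div_extend {h g : ℂ → ℂ} (hh : Differentiable ℂ h) (hg : Differentiable ℂ g)
    (h0 : ∀ w, g w = 0 → h w = 0 ∧ deriv g w ≠ 0) :
    ∃ Q : ℂ → ℂ, Differentiable ℂ Q ∧ ∀ w, g w ≠ 0 → Q w = h w / g w := by
  classical
  refine ⟨fun w => if g w = 0 then deriv h w / deriv g w else h w / g w, fun w => ?_,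
    fun w hw => by simp [hw]⟩
  by_cases hw : g w = 0
  · obtain ⟨hw1, hw2⟩ := h0 w hw
    have dh : Differentiable ℂ (dslope h w) := fun z =>
      ((Complex.differentiableOn_dslope univ_mem).2 hh.differentiableOn).differentiableAt univ_mem
    have dg : Differentiable ℂ (dslope g w) := fun z =>
      ((Complex.differentiableOn_dslope univ_mem).2 hg.differentiableOn).differentiableAt univ_mem
    have hne : ∀ᶠ z in 𝓝 w, dslope g w z ≠ 0 :=
      dg.continuous.continuousAt.eventually_ne (by rwa [dslope_same])
    refine ((dh w).div (dg w) (by rwa [dslope_same])).congr_of_eventuallyEq ?_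
    filter_upwards [hne] with z hz
    by_cases hzw : z = w
    · subst hzw
      simp [hw]
    · have e1 : g z = (z - w) * dslope g w z := by
        rw [dslope_of_ne _ hzw, slope_def_field, hw]
        field_simp [sub_ne_zero.2 hzw]
        simp
      have e2 : h z = (z - w) * dslope h w z := by
        rw [dslope_of_ne _ hzw, slope_def_field, hw1]
        field_simp [sub_ne_zero.2 hzw]
        simp
      have hzw' := sub_ne_zero.2 hzw
      rw [if_neg (by rw [e1]; exact mul_ne_zero hzw' hz), e1, e2, mul_div_mul_left _ _ hzw']
      rfl
  · refine ((hh w).div (hg w) hw).congr_of_eventuallyEq ?_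
    filter_upwards [hg.continuous.continuousAt.eventually_ne hw] with z hz
    simp [hz]

/-- A doubly periodic entire function is constant. -/
lemma eq_of_doubly_periodic {Q : ℂ → ℂ} (hQ : Differentiable ℂ Q) {ω : ℂ} (hω : ω.re < 0)
    (h1 : ∀ w, Q (w + 2 * π * Complex.I) = Q w) (h2 : ∀ w, Q (w + ω) = Q w) (z w : ℂ) :
    Q z = Q w := by
  refine hQ.apply_eq_apply_of_bounded ?_ z w
  have hK : IsCompact ((fun v : ℝ × ℝ => (v.1 : ℂ) * ω + v.2 * (2 * π * Complex.I)) ''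
      (Set.Icc 0 1 ×ˢ Set.Icc 0 1)) :=
    (isCompact_Icc.prod isCompact_Icc).image (by fun_prop)
  have hb := (hK.image hQ.continuous).isBounded
  refine hb.subset ?_
  rintro _ ⟨w, rfl⟩
  have p1 : ∀ (n : ℤ) w, Q (w + n * (2 * π * Complex.I)) = Q w := by
    intro n w
    have : Function.Periodic Q (2 * π * Complex.I) := h1
    simpa using (this.int_mul n) w
  have p2 : ∀ (n : ℤ) w, Q (w + n * ω) = Q w := by
    intro n w
    have : Function.Periodic Q ω := h2
    simpa using (this.int_mul n) w
  obtain ⟨a, b, hw⟩ : ∃ a b : ℝ, w = (a : ℂ) * ω + b * (2 * π * Complex.I) := by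
    refine ⟨w.re / ω.re, (w.im - w.re / ω.re * ω.im) / (2 * π), Complex.ext ?_ ?_⟩
    · simp [-Complex.ofReal_div, hω.ne]
    · simp only [Complex.add_im, Complex.mul_im,
        Complex.mul_re, Complex.I_re, Complex.I_im, Complex.ofReal_re, Complex.ofReal_im,
        Complex.re_ofNat, Complex.im_ofNat]
      field_simp
      ring
  refine ⟨((Int.fract a : ℝ) : ℂ) * ω + ((Int.fract b : ℝ) : ℂ) * (2 * π * Complex.I),
    ⟨(Int.fract a, Int.fract b), ⟨⟨Int.fract_nonneg _, (Int.fract_lt_one _).le⟩,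
      ⟨Int.fract_nonneg _, (Int.fract_lt_one _).le⟩⟩, rfl⟩, ?_⟩
  rw [← p1 ⌊b⌋, ← p2 ⌊a⌋]
  congr 1
  conv_rhs => rw [hw]
  conv_rhs => rw [← Int.fract_add_floor a, ← Int.fract_add_floor b]
  push_cast
  ring

variable {p : ℂ}

/-- `θ(xy)θ(x/y)`. -/
noncomputable def thetaPair (p x y : ℂ) : ℂ := ellTheta (x * y) p * ellTheta (x / y) p

lemma thetaPair_mul_p (hp0 : p ≠ 0) (hp : ‖p‖ < 1) {x y : ℂ} (hx : x ≠ 0) (hy : y ≠ 0) :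
    thetaPair p (p * x) y = 1 / x ^ 2 * thetaPair p x y := by
  rw [thetaPair, mul_assoc, mul_div_assoc, ellTheta_mul_p hp0 hp _ (mul_ne_zero hx hy),
    ellTheta_mul_p hp0 hp _ (div_ne_zero hx hy), thetaPair]
  field_simp

lemma thetaPair_inv (hp0 : p ≠ 0) (hp : ‖p‖ < 1) {x y : ℂ} (hx : x ≠ 0) (hy : y ≠ 0) :
    thetaPair p (1 / x) y = 1 / x ^ 2 * thetaPair p x y := by
  have e1 : 1 / x * y = 1 / (x / y) := by field_simp
  have e2 : 1 / x / y = 1 / (x * y) := by field_simp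
  rw [thetaPair, e1, e2, ellTheta_inv hp0 hp _ (mul_ne_zero hx hy),
    ellTheta_inv hp0 hp _ (div_ne_zero hx hy), thetaPair]
  field_simp

@[simp] lemma thetaPair_self {y : ℂ} (hy : y ≠ 0) : thetaPair p y y = 0 := by
  simp [thetaPair, hy]

lemma thetaPair_swap (hp0 : p ≠ 0) (hp : ‖p‖ < 1) {x y : ℂ} (hx : x ≠ 0) (hy : y ≠ 0) :
    thetaPair p x y = -(x / y) * thetaPair p y x := by
  have e1 : x / y = 1 / (y / x) := by field_simp
  rw [thetaPair, e1, ellTheta_inv hp0 hp _ (div_ne_zero hy hx), thetaPair, mul_comm x y]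
  ring

lemma differentiableAt_thetaPair (hp : ‖p‖ < 1) {x y : ℂ} (hx : x ≠ 0) (hy : y ≠ 0) :
    DifferentiableAt ℂ (fun x => thetaPair p x y) x :=
  ((differentiableAt_ellTheta hp (mul_ne_zero hx hy)).comp x (f := fun x => x * y)
    (by fun_prop)).mul
    ((differentiableAt_ellTheta hp (div_ne_zero hx hy)).comp x (f := fun x => x / y)
    (by fun_prop))

lemma deriv_thetaPair_ne_zero (hp0 : p ≠ 0) (hp : ‖p‖ < 1) {x y : ℂ} (hx : x ≠ 0) (hy : y ≠ 0)
    (hyy : ellTheta (y ^ 2) p ≠ 0) (h : thetaPair p x y = 0) :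
    deriv (fun x => thetaPair p x y) x ≠ 0 := by
  have d1 : HasDerivAt (fun x => ellTheta (x * y) p)
      (deriv (fun x => ellTheta x p) (x * y) * y) x :=
    HasDerivAt.comp x (h := fun x => x * y) (h₂ := fun x => ellTheta x p)
      (differentiableAt_ellTheta hp (mul_ne_zero hx hy)).hasDerivAt
      (by simpa using (hasDerivAt_id x).mul_const y)
  have d2 : HasDerivAt (fun x => ellTheta (x / y) p)
      (deriv (fun x => ellTheta x p) (x / y) * (1 / y)) x :=
    HasDerivAt.comp x (h := fun x => x / y) (h₂ := fun x => ellTheta x p)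
      (differentiableAt_ellTheta hp (div_ne_zero hx hy)).hasDerivAt
      (by simpa using (hasDerivAt_id x).div_const y)
  have hnot : ¬ (ellTheta (x * y) p = 0 ∧ ellTheta (x / y) p = 0) := by
    rintro ⟨h1, h2⟩
    obtain ⟨k, hk⟩ := exists_zpow_of_ellTheta_eq_zero hp (mul_ne_zero hx hy) h1
    obtain ⟨l, hl⟩ := exists_zpow_of_ellTheta_eq_zero hp (div_ne_zero hx hy) h2
    have : y ^ 2 = p ^ (k - l) := by
      rw [zpow_sub₀ hp0, ← hk, ← hl]
      field_simp
    rw [this] at hyy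
    exact hyy (ellTheta_zpow hp0 hp _)
  have e : deriv (fun x => thetaPair p x y) x = _ := (d1.fun_mul d2).deriv
  rw [e]
  rcases mul_eq_zero.mp h with h1 | h1
  · have h2 : ellTheta (x / y) p ≠ 0 := fun h2 => hnot ⟨h1, h2⟩
    rw [h1, zero_mul, add_zero]
    exact mul_ne_zero (mul_ne_zero (deriv_ellTheta_ne_zero hp0 hp (mul_ne_zero hx hy) h1) hy) h2
  · have h2 : ellTheta (x * y) p ≠ 0 := fun h2 => hnot ⟨h2, h1⟩
    rw [h1, mul_zero, zero_add]
    exact mul_ne_zero h2 (mul_ne_zero (deriv_ellTheta_ne_zero hp0 hp (div_ne_zero hx hy) h1)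
      (by simpa using hy))

/-- A function with the quasi-periodicity and symmetry of `θ(xy)θ(x/y)` that vanishes at two
generic points vanishes identically. -/
lemma eq_zero_of_quasiperiodic (hp0 : p ≠ 0) (hp : ‖p‖ < 1) {D : ℂ → ℂ}
    (hD : ∀ x, x ≠ 0 → DifferentiableAt ℂ D x)
    (hDp : ∀ x, x ≠ 0 → D (p * x) = 1 / x ^ 2 * D x)
    (hDi : ∀ x, x ≠ 0 → D (1 / x) = 1 / x ^ 2 * D x) {u v : ℂ} (hu : u ≠ 0) (hv : v ≠ 0)
    (huu : ellTheta (u ^ 2) p ≠ 0) (huv : thetaPair p v u ≠ 0) (hDu : D u = 0) (hDv : D v = 0)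
    {x : ℂ} (hx : x ≠ 0) : D x = 0 := by
  have hDz : ∀ (k : ℤ) x, x ≠ 0 → D x = 0 → D (p ^ k * x) = 0 := by
    intro k x hx h
    induction k with
    | zero => simpa using h
    | succ i ih =>
      rw [zpow_add_one₀ hp0, mul_comm (p ^ _) p, mul_assoc,
        hDp _ (mul_ne_zero (zpow_ne_zero _ hp0) hx), ih, mul_zero]
    | pred i ih =>
      have hne : p ^ (-(i : ℤ) - 1) * x ≠ 0 := mul_ne_zero (zpow_ne_zero _ hp0) hx
      have := hDp _ hne
      rw [← mul_assoc, ← zpow_one_add₀ hp0, add_sub_cancel, ih] at this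
      simpa [hne] using this.symm
  have hzero : ∀ x, x ≠ 0 → thetaPair p x u = 0 → D x = 0 := by
    intro x hx h
    rcases mul_eq_zero.mp h with h | h
    · obtain ⟨k, hk⟩ := exists_zpow_of_ellTheta_eq_zero hp (mul_ne_zero hx hu) h
      rw [← eq_div_iff hu, div_eq_mul_one_div] at hk
      rw [hk]
      exact hDz _ _ (by simpa using hu) (by rw [hDi _ hu, hDu, mul_zero])
    · obtain ⟨k, hk⟩ := exists_zpow_of_ellTheta_eq_zero hp (div_ne_zero hx hu) h
      rw [div_eq_iff hu] at hk
      rw [hk]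
      exact hDz _ _ hu hDu
  have hg : Differentiable ℂ fun w => thetaPair p (Complex.exp w) u := fun w =>
    (differentiableAt_thetaPair hp (Complex.exp_ne_zero w) hu).comp w (by fun_prop)
  have hh : Differentiable ℂ fun w => D (Complex.exp w) := fun w =>
    (hD _ (Complex.exp_ne_zero w)).comp w (by fun_prop)
  obtain ⟨Q, hQ, hQ1⟩ := differentiable_div_extend hh hg (fun w hw => by
    refine ⟨hzero _ (Complex.exp_ne_zero w) hw, ?_⟩
    have := ((differentiableAt_thetaPair hp (Complex.exp_ne_zero w) hu).hasDerivAt.comp w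
      (Complex.hasDerivAt_exp w)).deriv
    have e : deriv (fun w => thetaPair p (Complex.exp w) u) w = _ := this
    rw [e]
    exact mul_ne_zero (deriv_thetaPair_ne_zero hp0 hp (Complex.exp_ne_zero w) hu huu hw)
      (Complex.exp_ne_zero w))
  obtain ⟨w₀, rfl⟩ : ∃ w, Complex.exp w = v := ⟨_, Complex.exp_log hv⟩
  have hper : ∀ ω, (∀ᶠ w in 𝓝 w₀, Q (w + ω) = Q w) → ∀ w, Q (w + ω) = Q w := by
    intro ω h
    have h1 : AnalyticOnNhd ℂ (fun w => Q (w + ω)) Set.univ := fun w _ =>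
      (hQ.comp (differentiable_id.add_const ω)).analyticAt w
    have h2 : AnalyticOnNhd ℂ Q Set.univ := fun w _ => hQ.analyticAt w
    intro w
    exact congrFun (h1.eq_of_eventuallyEq h2 h) w
  have hne : ∀ᶠ w in 𝓝 w₀, thetaPair p (Complex.exp w) u ≠ 0 :=
    hg.continuous.continuousAt.eventually_ne huv
  have hQ0 : ∀ w, Q w = 0 := fun w => by
    rw [eq_of_doubly_periodic hQ (ω := Complex.log p) ?_ ?_ ?_ w w₀, hQ1 _ huv, hDv, zero_div]
    · rw [Complex.log_re]
      exact Real.log_neg (norm_pos_iff.2 hp0) hp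
    · refine hper _ (hne.mono fun w hw => ?_)
      have e : Complex.exp (w + 2 * π * Complex.I) = Complex.exp w := Complex.exp_periodic w
      rw [hQ1 _ hw, hQ1 _ (by rwa [e]), e]
    · refine hper _ (hne.mono fun w hw => ?_)
      have e : Complex.exp (w + Complex.log p) = p * Complex.exp w := by
        rw [Complex.exp_add, Complex.exp_log hp0, mul_comm]
      have h0 := Complex.exp_ne_zero w
      have hne' : thetaPair p (Complex.exp (w + Complex.log p)) u ≠ 0 := by
        rw [e, thetaPair_mul_p hp0 hp h0 hu]
        exact mul_ne_zero (by simp) hw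
      rw [hQ1 _ hw, hQ1 _ hne', e, thetaPair_mul_p hp0 hp h0 hu, hDp _ h0,
        mul_div_mul_left _ _ (by simp)]
  by_cases h : thetaPair p x u = 0
  · exact hzero x hx h
  · obtain ⟨w, rfl⟩ : ∃ w, Complex.exp w = x := ⟨_, Complex.exp_log hx⟩
    have := hQ1 w h
    rw [hQ0, eq_comm, div_eq_zero_iff] at this
    exact this.resolve_right h

lemma thetaPair_three_term_of_ne_zero (hp0 : p ≠ 0) (hp : ‖p‖ < 1) {x y u v : ℂ} (hx : x ≠ 0)
    (hy : y ≠ 0) (hu : u ≠ 0)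
    (hv : v ≠ 0) (huu : ellTheta (u ^ 2) p ≠ 0) (huv : thetaPair p v u ≠ 0) :
    thetaPair p x y * thetaPair p u v =
      thetaPair p x v * thetaPair p u y + u / y * thetaPair p x u * thetaPair p y v := by
  have key := eq_zero_of_quasiperiodic hp0 hp (D := fun x => thetaPair p x y * thetaPair p u v -
      (thetaPair p x v * thetaPair p u y + u / y * thetaPair p x u * thetaPair p y v))
    (fun x hx => by
      have := differentiableAt_thetaPair hp hx hy
      have := differentiableAt_thetaPair hp hx hu
      have := differentiableAt_thetaPair hp hx hv
      fun_prop)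
    (fun x hx => by
      rw [thetaPair_mul_p hp0 hp hx hy, thetaPair_mul_p hp0 hp hx hu, thetaPair_mul_p hp0 hp hx hv]
      ring)
    (fun x hx => by
      rw [thetaPair_inv hp0 hp hx hy, thetaPair_inv hp0 hp hx hu, thetaPair_inv hp0 hp hx hv]
      ring) hu hv huu huv
    (by simp only [thetaPair_self hu]; ring)
    (by
      simp only [thetaPair_self hv, thetaPair_swap hp0 hp hv hu, thetaPair_swap hp0 hp hv hy]
      field_simp
      ring) hx
  exact sub_eq_zero.1 key

lemma eventually_ellTheta_ne_zero (hp : ‖p‖ < 1) (hp0 : p ≠ 0) {f : ℂ → ℂ} {u f' : ℂ}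
    (hf : HasDerivAt f f' u)
    (hf' : f' ≠ 0) (hu : f u ≠ 0) : ∀ᶠ w in 𝓝[≠] u, ellTheta (f w) p ≠ 0 := by
  refine (hf.tendsto_nhdsNE hf').eventually (p := fun x => ellTheta x p ≠ 0) ?_
  by_cases h : ellTheta (f u) p = 0
  · have := (differentiableAt_ellTheta hp hu).hasDerivAt.eventually_ne (c := 0)
      (deriv_ellTheta_ne_zero hp0 hp hu h)
    exact this
  · exact ((differentiableAt_ellTheta hp hu).continuousAt.eventually_ne h).filter_mono
      nhdsWithin_le_nhds

/-- The three-term relation (Weierstrass addition formula) for theta functions. -/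
lemma thetaPair_three_term (hp0 : p ≠ 0) (hp : ‖p‖ < 1) {x y u v : ℂ} (hx : x ≠ 0) (hy : y ≠ 0)
    (hu : u ≠ 0) (hv : v ≠ 0) :
    thetaPair p x y * thetaPair p u v =
      thetaPair p x v * thetaPair p u y + u / y * thetaPair p x u * thetaPair p y v := by
  have e1 : ∀ᶠ w in 𝓝[≠] u, ellTheta (w ^ 2) p ≠ 0 :=
    eventually_ellTheta_ne_zero hp hp0 (hasDerivAt_pow 2 u) (by simpa using hu) (by simpa using hu)
  have e2 : ∀ᶠ w in 𝓝[≠] u, ellTheta (v * w) p ≠ 0 :=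
    eventually_ellTheta_ne_zero hp hp0 (by simpa using (hasDerivAt_id u).const_mul v) hv
      (mul_ne_zero hv hu)
  have e3 : ∀ᶠ w in 𝓝[≠] u, ellTheta (v / w) p ≠ 0 := by
    refine eventually_ellTheta_ne_zero hp hp0 (f := fun w => v / w) (f' := v * (-(u ^ 2)⁻¹)) ?_ ?_
      ?_
    · simpa only [div_eq_mul_inv] using (hasDerivAt_inv hu).const_mul v
    · simp [hv, hu]
    · exact div_ne_zero hv hu
  have e4 : ∀ᶠ w in 𝓝[≠] u, w ≠ 0 := (eventually_ne_nhds hu).filter_mono nhdsWithin_le_nhds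
  have dl : ∀ z, z ≠ 0 → ContinuousAt (fun w => thetaPair p w z) u := fun z hz =>
    (differentiableAt_thetaPair hp hu hz).continuousAt
  have dr : ContinuousAt (fun w => thetaPair p x w) u := by
    refine ContinuousAt.congr (f := fun w => -(x / w) * thetaPair p w x) ?_ ?_
    · have := dl x hx
      fun_prop (disch := assumption)
    · filter_upwards [eventually_ne_nhds hu] with w hw
      rw [thetaPair_swap hp0 hp hx hw]
  refine tendsto_nhds_unique_of_eventuallyEq (l := 𝓝[≠] u)
    (f := fun w => thetaPair p x y * thetaPair p w v)
    (g := fun w => thetaPair p x v * thetaPair p w y + w / y * thetaPair p x w * thetaPair p y v)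
    ?_ ?_ ?_
  · exact ((dl v hv).const_mul _).tendsto.mono_left nhdsWithin_le_nhds
  · have := dl y hy
    have h : ContinuousAt (fun w => thetaPair p x v * thetaPair p w y +
      w / y * thetaPair p x w * thetaPair p y v) u := by fun_prop
    exact h.tendsto.mono_left nhdsWithin_le_nhds
  · filter_upwards [e1, e2, e3, e4] with w h1 h2 h3 h4
    exact thetaPair_three_term_of_ne_zero hp0 hp hx hy h4 hv h1 (mul_ne_zero h2 h3)

end ThreeTerm

section PartialFractions

variable {p : ℂ} {ι : Type*} [DecidableEq ι]

/-- The sum appearing in the elliptic partial fraction identity. -/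
noncomputable def pfSum (p : ℂ) (s : Finset ι) (x : ι → ℂ) (Y : Multiset ℂ) : ℂ :=
  ∑ k ∈ s, (Y.map fun y => ellTheta (x k / y) p).prod / ∏ j ∈ s.erase k, ellTheta (x k / x j) p

lemma sum_mul_theta_div_erase {s : Finset ι} {x : ι → ℂ} (F : ι → ℂ)
    (hθ : ∀ i ∈ s, ∀ j ∈ s, i ≠ j → ellTheta (x i / x j) p ≠ 0) {b : ι} (hb : b ∈ s)
    (hx : x b ≠ 0) :
    ∑ k ∈ s, F k * ellTheta (x k / x b) p / ∏ j ∈ s.erase k, ellTheta (x k / x j) p =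
      ∑ k ∈ s.erase b, F k / ∏ j ∈ (s.erase b).erase k, ellTheta (x k / x j) p := by
  rw [← Finset.add_sum_erase s _ hb, div_self hx, ellTheta_one, mul_zero, zero_div, zero_add]
  refine Finset.sum_congr rfl fun k hk => ?_
  obtain ⟨hkb, hks⟩ := Finset.mem_erase.1 hk
  have hb' : b ∈ s.erase k := Finset.mem_erase.2 ⟨hkb.symm, hb⟩
  rw [← Finset.mul_prod_erase _ _ hb', Finset.erase_right_comm, mul_comm (F k),
    mul_div_mul_left _ _ (hθ k hks b hb hkb)]

lemma ellTheta_three_term (hp0 : p ≠ 0) (hp : ‖p‖ < 1) {x y y' a b : ℂ} (hx : x ≠ 0) (hy : y ≠ 0)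
    (hy' : y' ≠ 0) (ha : a ≠ 0)
    (hb : b ≠ 0) :
    ellTheta (x / y) p * ellTheta (x / y') p *
        (ellTheta (a * b / (y * y')) p * ellTheta (a / b) p) =
      ellTheta (x / (y * y' / b)) p * ellTheta (x / b) p *
          (ellTheta (a / y) p * ellTheta (a / y') p) +
        a / y * (ellTheta (x / (y * y' / a)) p * ellTheta (x / a) p) *
          (ellTheta (b / y') p * ellTheta (y / b) p) := by
  obtain ⟨r, hr⟩ := IsAlgClosed.exists_pow_nat_eq (y * y') (n := 2) (by norm_num)
  have hr0 : r ≠ 0 := by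
    rintro rfl
    simp [hy, hy', eq_comm] at hr
  have key := thetaPair_three_term hp0 hp (div_ne_zero hx hr0) (div_ne_zero hy hr0)
    (div_ne_zero ha hr0) (div_ne_zero hb hr0)
  have e1 : ∀ w z : ℂ, thetaPair p (w / r) (z / r) =
      ellTheta (w * z / (y * y')) p * ellTheta (w / z) p := fun w z => by
    rw [thetaPair, div_mul_div_comm, ← pow_two r, hr, div_div_div_cancel_right₀ hr0]
  simp only [e1] at key
  have e2 : ∀ w : ℂ, w * y / (y * y') = w / y' := fun w => by field_simp
  have e3 : ∀ w, w ≠ 0 → x * w / (y * y') = x / (y * y' / w) := fun w hw => by field_simp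
  have e4 : y * b / (y * y') = b / y' := by field_simp
  rw [e2, e2, e3 a ha, e3 b hb, e4, div_div_div_cancel_right₀ hr0] at key
  linear_combination key

lemma pfSum_step (hp0 : p ≠ 0) (hp : ‖p‖ < 1) {s : Finset ι} {x : ι → ℂ} {Y : Multiset ℂ} {y y' : ℂ}
    (hx : ∀ i ∈ s, x i ≠ 0)
    (hθ : ∀ i ∈ s, ∀ j ∈ s, i ≠ j → ellTheta (x i / x j) p ≠ 0) (hy : y ≠ 0) (hy' : y' ≠ 0)
    {a b : ι} (ha : a ∈ s) (hb : b ∈ s)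
    (h1 : pfSum p (s.erase a) x (y * y' / x a ::ₘ Y) = 0)
    (h2 : pfSum p (s.erase b) x (y * y' / x b ::ₘ Y) = 0) :
    ellTheta (x a * x b / (y * y')) p * ellTheta (x a / x b) p * pfSum p s x (y ::ₘ y' ::ₘ Y) =
      0 := by
  set R : ι → ℂ := fun k => (Y.map fun y => ellTheta (x k / y) p).prod
  have hR : ∀ c ∈ s, pfSum p (s.erase c) x (y * y' / x c ::ₘ Y) = 0 →
      ∑ k ∈ s, (ellTheta (x k / (y * y' / x c)) p * R k) * ellTheta (x k / x c) p /
        ∏ j ∈ s.erase k, ellTheta (x k / x j) p = 0 := by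
    intro c hc h
    rw [sum_mul_theta_div_erase _ hθ hc (hx c hc), ← h, pfSum]
    simp [R]
  have e : ellTheta (x a * x b / (y * y')) p * ellTheta (x a / x b) p *
      pfSum p s x (y ::ₘ y' ::ₘ Y) =
      (ellTheta (x a / y) p * ellTheta (x a / y') p) *
        (∑ k ∈ s, (ellTheta (x k / (y * y' / x b)) p * R k) * ellTheta (x k / x b) p /
          ∏ j ∈ s.erase k, ellTheta (x k / x j) p) +
      (x a / y * (ellTheta (x b / y') p * ellTheta (y / x b) p)) *
        (∑ k ∈ s, (ellTheta (x k / (y * y' / x a)) p * R k) * ellTheta (x k / x a) p /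
          ∏ j ∈ s.erase k, ellTheta (x k / x j) p) := by
    rw [pfSum, Finset.mul_sum, Finset.mul_sum, Finset.mul_sum, ← Finset.sum_add_distrib]
    refine Finset.sum_congr rfl fun k hk => ?_
    have := ellTheta_three_term hp0 hp (hx k hk) hy hy' (hx a ha) (hx b hb)
    simp only [Multiset.map_cons, Multiset.prod_cons]
    change _ * ((_ * (_ * R k)) / _) = _
    rw [mul_div_assoc', mul_div_assoc', mul_div_assoc', ← add_div]
    congr 1
    linear_combination R k * this
  rw [e, hR a ha h1, hR b hb h2]
  ring

lemma pfSum_pair (hp0 : p ≠ 0) (hp : ‖p‖ < 1) {x : ι → ℂ} {a b : ι} (hab : a ≠ b) (ha : x a ≠ 0)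
    (hb : x b ≠ 0) {y y' : ℂ}
    (hy : y ≠ 0) (hy' : y' ≠ 0) (hθ : ellTheta (x a / x b) p ≠ 0) (h : x a * x b = y * y') :
    pfSum p {a, b} x {y, y'} = 0 := by
  have hb' : x b = y * y' / x a := by
    rw [← h]
    field_simp
  have e1 : x b / y = 1 / (x a / y') := by
    rw [hb']
    field_simp
  have e2 : x b / y' = 1 / (x a / y) := by
    rw [hb']
    field_simp
  have e3 : x b / x a = 1 / (x a / x b) := by field_simp
  rw [pfSum, Finset.sum_pair hab, Finset.pair_comm, Finset.erase_insert (by simpa using hab.symm)]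
  rw [Finset.pair_comm, Finset.erase_insert (by simpa using hab)]
  simp only [Multiset.insert_eq_cons, Multiset.map_cons, Multiset.map_singleton, Multiset.prod_cons,
    Multiset.prod_singleton, Finset.prod_singleton]
  rw [e1, e2, e3, ellTheta_inv hp0 hp _ (div_ne_zero ha hy'),
    ellTheta_inv hp0 hp _ (div_ne_zero ha hy), ellTheta_inv hp0 hp _ (div_ne_zero ha hb)]
  field_simp
  rw [h]
  ring

/-- The elliptic partial fraction identity. -/
lemma pfSum_eq_zero (hp0 : p ≠ 0) (hp : ‖p‖ < 1) {s : Finset ι} {x : ι → ℂ} {Y : Multiset ℂ}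
    (hx : ∀ i ∈ s, x i ≠ 0)
    (hY : ∀ y ∈ Y, y ≠ 0) (hθ : ∀ i ∈ s, ∀ j ∈ s, i ≠ j → ellTheta (x i / x j) p ≠ 0)
    (hcard : Y.card = s.card) (hprod : ∏ i ∈ s, x i = Y.prod) : pfSum p s x Y = 0 := by
  induction hm : s.card generalizing s Y with
  | zero =>
    rw [Finset.card_eq_zero.1 hm]
    simp [pfSum]
  | succ m ih =>
    have hstep : ∀ (y y' : ℂ) (Z : Multiset ℂ), Y = y ::ₘ y' ::ₘ Z → ∀ c ∈ s,
        pfSum p (s.erase c) x (y * y' / x c ::ₘ Z) = 0 := by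
      intro y y' Z hZ c hc
      have hxc := hx c hc
      refine ih (fun i hi => hx i (Finset.mem_of_mem_erase hi)) ?_
        (fun i hi j hj => hθ i (Finset.mem_of_mem_erase hi) j (Finset.mem_of_mem_erase hj)) ?_ ?_ ?_
      · intro w hw
        rcases Multiset.mem_cons.1 hw with rfl | hw
        · exact div_ne_zero (mul_ne_zero (hY _ (by simp [hZ])) (hY _ (by simp [hZ]))) hxc
        · exact hY _ (by simp [hZ, hw])
      · rw [Finset.card_erase_of_mem hc, ← hcard, hZ]
        simp
      · apply mul_left_cancel₀ hxc
        rw [Finset.mul_prod_erase _ _ hc, hprod, hZ]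
        simp
        field_simp
      · rw [Finset.card_erase_of_mem hc, hm]
        simp
    rcases m with _ | _ | m
    · obtain ⟨a, rfl⟩ := Finset.card_eq_one.1 hm
      obtain ⟨y, rfl⟩ := Multiset.card_eq_one.1 (hcard.trans hm)
      have : x a = y := by simpa using hprod
      simp [pfSum, this, hY y (by simp)]
    · obtain ⟨a, b, hab, rfl⟩ := Finset.card_eq_two.1 hm
      obtain ⟨y, y', rfl⟩ := Multiset.card_eq_two.1 (hcard.trans hm)
      refine pfSum_pair hp0 hp hab (hx _ (by simp)) (hx _ (by simp)) (hY _ (by simp))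
        (hY _ (by simp)) (hθ _ (by simp) _ (by simp) hab) ?_
      simpa [Finset.prod_pair hab] using hprod
    · obtain ⟨y, hy⟩ := Multiset.card_pos_iff_exists_mem.1 (show 0 < Y.card by omega)
      obtain ⟨Y', rfl⟩ := Multiset.exists_cons_of_mem hy
      rw [Multiset.card_cons] at hcard
      obtain ⟨y', hy'⟩ := Multiset.card_pos_iff_exists_mem.1 (show 0 < Y'.card by omega)
      obtain ⟨Z, rfl⟩ := Multiset.exists_cons_of_mem hy'
      have h0y : y ≠ 0 := hY _ (by simp)
      have h0y' : y' ≠ 0 := hY _ (by simp)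
      obtain ⟨a, b, c, ha, hb, hc, hab, hac, hbc⟩ := Finset.two_lt_card_iff.1
        (show 2 < s.card by omega)
      by_cases h : ellTheta (x a * x b / (y * y')) p = 0
      · have h' : ellTheta (x a * x c / (y * y')) p ≠ 0 := by
          intro h'
          have h0a := hx a ha
          have h0b := hx b hb
          have h0c := hx c hc
          obtain ⟨k, hk⟩ := exists_zpow_of_ellTheta_eq_zero hp
            (div_ne_zero (mul_ne_zero h0a h0b) (mul_ne_zero h0y h0y')) h
          obtain ⟨l, hl⟩ := exists_zpow_of_ellTheta_eq_zero hp
            (div_ne_zero (mul_ne_zero h0a h0c) (mul_ne_zero h0y h0y')) h'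
          have : x b / x c = p ^ (k - l) := by
            rw [zpow_sub₀ hp0, ← hk, ← hl]
            field_simp
          exact hθ b hb c hc hbc (this ▸ ellTheta_zpow hp0 hp _)
        have := pfSum_step hp0 hp hx hθ h0y h0y' ha hc (hstep y y' Z rfl a ha)
          (hstep y y' Z rfl c hc)
        exact (mul_eq_zero.1 this).resolve_left (mul_ne_zero h' (hθ a ha c hc hac))
      · have := pfSum_step hp0 hp hx hθ h0y h0y' ha hb (hstep y y' Z rfl a ha)
          (hstep y y' Z rfl b hb)
        exact (mul_eq_zero.1 this).resolve_left (mul_ne_zero h (hθ a ha b hb hab))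

end PartialFractions

section HolomorphicFamilies

open Filter Topology

lemma integrable_of_continuous_of_compactSpace {K E : Type*} [TopologicalSpace K] [CompactSpace K]
    [MeasurableSpace K] [OpensMeasurableSpace K] {μ : Measure K} [IsFiniteMeasure μ]
    [NormedAddCommGroup E] {f : K → E} (hf : Continuous f) : Integrable f μ := by
  have := hf.integrable_of_hasCompactSupport (μ := μ) (HasCompactSupport.of_compactSpace _)
  exact this

variable {K : Type*} [TopologicalSpace K] {Ω : Set ℂ} {f g h : ℂ → K → ℂ}

/-- A family of functions on `Ω`, parametrized by `K`, that is jointly continuous, and holomorphic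
for every value of the parameter. -/
structure HolFam (Ω : Set ℂ) (f : ℂ → K → ℂ) : Prop where
  cont : ContinuousOn (fun v : ℂ × K => f v.1 v.2) (Ω ×ˢ Set.univ)
  diff : ∀ x, DifferentiableOn ℂ (fun w => f w x) Ω

namespace HolFam

lemma congr (hf : HolFam Ω f) (h : ∀ w ∈ Ω, ∀ x, g w x = f w x) : HolFam Ω g :=
  ⟨hf.cont.congr fun v hv => h v.1 hv.1 v.2, fun x => (hf.diff x).congr fun w hw => h w hw x⟩

lemma of_continuous {f : K → ℂ} (hf : Continuous f) : HolFam Ω fun _ x => f x :=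
  ⟨(hf.comp continuous_snd).continuousOn, fun _ => differentiableOn_const _⟩

lemma of_differentiableOn {f : ℂ → ℂ} (hf : DifferentiableOn ℂ f Ω) :
    HolFam Ω fun w (_ : K) => f w :=
  ⟨hf.continuousOn.comp continuousOn_fst fun _ hv => hv.1, fun _ => hf⟩

lemma mul (hf : HolFam Ω f) (hg : HolFam Ω g) : HolFam Ω fun w x => f w x * g w x :=
  ⟨hf.cont.mul hg.cont, fun x => (hf.diff x).mul (hg.diff x)⟩

lemma inv (hf : HolFam Ω f) (h0 : ∀ w ∈ Ω, ∀ x, f w x ≠ 0) : HolFam Ω fun w x => (f w x)⁻¹ :=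
  ⟨hf.cont.inv₀ fun v hv => h0 v.1 hv.1 v.2, fun x => (hf.diff x).inv fun w hw => h0 w hw x⟩

lemma div (hf : HolFam Ω f) (hg : HolFam Ω g) (h0 : ∀ w ∈ Ω, ∀ x, g w x ≠ 0) :
    HolFam Ω fun w x => f w x / g w x := by
  simpa only [div_eq_mul_inv] using hf.mul (hg.inv h0)

lemma prod {ι : Type*} {s : Finset ι} {f : ι → ℂ → K → ℂ} (hf : ∀ i ∈ s, HolFam Ω (f i)) :
    HolFam Ω fun w x => ∏ i ∈ s, f i w x :=
  ⟨continuousOn_finsetProd s fun i hi => (hf i hi).cont,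
    fun x => DifferentiableOn.fun_finsetProd fun i hi => (hf i hi).diff x⟩

lemma dblPoch (hΩ : IsOpen Ω) (hf : HolFam Ω f) (hg : HolFam Ω g) (hh : HolFam Ω h)
    (hg1 : ∀ w ∈ Ω, ∀ x, ‖g w x‖ < 1) (hh1 : ∀ w ∈ Ω, ∀ x, ‖h w x‖ < 1) :
    HolFam Ω fun w x => dblPoch (f w x) (g w x) (h w x) := by
  refine ⟨ContinuousOn.comp (f := fun v : ℂ × K => (f v.1 v.2, g v.1 v.2, h v.1 v.2))
    continuousOn_dblPoch (hf.cont.prodMk (hg.cont.prodMk hh.cont))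
    fun v hv => ⟨hg1 _ hv.1 _, hh1 _ hv.1 _⟩, fun x w hw => ?_⟩
  have hev : ∀ {f : ℂ → K → ℂ}, HolFam Ω f → ∀ᶠ z in 𝓝 w, DifferentiableAt ℂ (fun w => f w x) z :=
    fun hf => (hΩ.mem_nhds hw |> eventually_mem_set.2).mono fun z hz =>
      (hf.diff x).differentiableAt (hΩ.mem_nhds hz)
  exact (differentiableAt_dblPoch (hg1 w hw x) (hh1 w hw x) (hev hf) (hev hg)
    (hev hh)).differentiableWithinAt

lemma ellGamma (hΩ : IsOpen Ω) (hf : HolFam Ω f) (hg : HolFam Ω g) (hh : HolFam Ω h)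
    (hg1 : ∀ w ∈ Ω, ∀ x, ‖g w x‖ < 1) (hh1 : ∀ w ∈ Ω, ∀ x, ‖h w x‖ < 1)
    (hf0 : ∀ w ∈ Ω, ∀ x, f w x ≠ 0) (hf1 : ∀ w ∈ Ω, ∀ x, ‖f w x‖ < 1) :
    HolFam Ω fun w x => ellGamma (f w x) (g w x) (h w x) := by
  refine HolFam.congr (HolFam.div (HolFam.dblPoch hΩ ((hg.mul hh).div hf hf0) hg hh hg1 hh1)
    (HolFam.dblPoch hΩ hf hg hh hg1 hh1) fun w hw x =>
      dblPoch_ne_zero_of_norm_lt_one (hg1 w hw x) (hh1 w hw x) (hf1 w hw x)) ?_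
  intro w hw x
  exact ellGamma_eq (hg1 w hw x) (hh1 w hw x) _

lemma ellGamma_const {p q : ℂ} (hp : ‖p‖ < 1) (hq : ‖q‖ < 1) (hΩ : IsOpen Ω) (hf : HolFam Ω f)
    (hf0 : ∀ w ∈ Ω, ∀ x, f w x ≠ 0) (hf1 : ∀ w ∈ Ω, ∀ x, ‖f w x‖ < 1) :
    HolFam Ω fun w x => _root_.ellGamma (f w x) p q :=
  hf.ellGamma hΩ (of_continuous continuous_const) (of_continuous continuous_const)
    (fun _ _ _ => hp) (fun _ _ _ => hq) hf0 hf1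

lemma ellTheta_const {p : ℂ} (hp : ‖p‖ < 1) (hΩ : IsOpen Ω) (hf : HolFam Ω f)
    (hf0 : ∀ w ∈ Ω, ∀ x, f w x ≠ 0) : HolFam Ω fun w x => ellTheta (f w x) p := by
  have h1 : HolFam (K := K) Ω fun _ _ => p := of_continuous continuous_const
  have h0 : HolFam (K := K) Ω fun _ _ => (0 : ℂ) := of_continuous continuous_const
  refine ((hf.dblPoch hΩ h1 h0 (fun _ _ _ => hp) (by simp)).mul
    ((h1.div hf hf0).dblPoch hΩ h1 h0 (fun _ _ _ => hp) (by simp))).congr fun w hw x => ?_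
  simp only [dblPoch_zero_right _ p hp, ellTheta]

lemma continuous (hf : HolFam Ω f) {w : ℂ} (hw : w ∈ Ω) : Continuous (f w) :=
  hf.cont.comp_continuous (f := fun x => (w, x)) (by fun_prop) fun _ => ⟨hw, trivial⟩

variable [MeasurableSpace K] [OpensMeasurableSpace K] {μ : Measure K}

lemma aestronglyMeasurable (hf : HolFam Ω f) {w : ℂ} (hw : w ∈ Ω) :
    AEStronglyMeasurable (f w) μ := (hf.continuous hw).aestronglyMeasurable

variable [CompactSpace K] [IsFiniteMeasure μ]

lemma integrable (hf : HolFam Ω f) {w : ℂ} (hw : w ∈ Ω) : Integrable (f w) μ :=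
  integrable_of_continuous_of_compactSpace (hf.continuous hw)

/-- The integral of a holomorphic family over the parameter is holomorphic. -/
lemma differentiableOn_integral (hΩ : IsOpen Ω) (hf : HolFam Ω f) :
    DifferentiableOn ℂ (fun w => ∫ x, f w x ∂μ) Ω := by
  intro w₀ hw₀
  obtain ⟨r, hr, hball⟩ := Metric.isOpen_iff.1 hΩ w₀ hw₀
  set ρ := r / 4 with hρ
  have hρ0 : 0 < ρ := by positivity
  have hsub : Metric.closedBall w₀ (2 * ρ) ⊆ Ω :=
    (Metric.closedBall_subset_ball (by linarith)).trans hball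
  have hK : IsCompact (Metric.closedBall w₀ (2 * ρ) ×ˢ (Set.univ : Set K)) :=
    (isCompact_closedBall _ _).prod isCompact_univ
  obtain ⟨M, hM⟩ := hK.exists_bound_of_continuousOn (hf.cont.mono (Set.prod_mono_left hsub))
  have hder : ∀ x, ∀ w ∈ Metric.ball w₀ ρ, ‖deriv (fun w => f w x) w‖ ≤ M / ρ := by
    intro x w hw
    have hcl : Metric.closedBall w ρ ⊆ Metric.closedBall w₀ (2 * ρ) :=
      Metric.closedBall_subset_closedBall' (by linarith [Metric.mem_ball.1 hw])
    refine Complex.norm_deriv_le_of_forall_mem_sphere_norm_le hρ0 ?_ fun z hz =>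
      hM (z, x) ⟨hcl (Metric.sphere_subset_closedBall hz), trivial⟩
    exact DifferentiableOn.diffContOnCl
      (((hf.diff x).mono (hcl.trans hsub)).mono (Metric.closure_ball_subset_closedBall))
  have hd : ∀ x, ∀ w ∈ Metric.ball w₀ ρ,
      HasDerivAt (fun w => f w x) (deriv (fun w => f w x) w) w := fun x w hw =>
    ((hf.diff x).differentiableAt (hΩ.mem_nhds (hball
      (Metric.ball_subset_ball (by linarith) hw)))).hasDerivAt
  have hmeas : AEStronglyMeasurable (fun x => deriv (fun w => f w x) w₀) μ := by
    have hlim : Tendsto (fun k : ℕ => w₀ + ((ρ / (k + 2) : ℝ) : ℂ)) atTop (𝓝[≠] w₀) := by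
      refine tendsto_nhdsWithin_iff.2 ⟨?_, Eventually.of_forall fun k => ?_⟩
      · have h1 : Tendsto (fun k : ℕ => ρ / ((k : ℝ) + 2)) atTop (𝓝 0) :=
          tendsto_const_nhds.div_atTop
            (tendsto_atTop_add_const_right _ _ tendsto_natCast_atTop_atTop)
        have h2 := (Complex.continuous_ofReal.tendsto 0).comp h1
        simpa using h2.const_add w₀
      · have : (ρ / ((k : ℝ) + 2)) ≠ 0 := by positivity
        simpa [-Complex.ofReal_div] using this
    refine aestronglyMeasurable_of_tendsto_ae (u := atTop)
      (f := fun (k : ℕ) x => slope (fun w => f w x) w₀ (w₀ + ((ρ / (k + 2) : ℝ) : ℂ))) ?_ ?_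
    · intro k
      have hk : w₀ + ((ρ / (k + 2) : ℝ) : ℂ) ∈ Ω := by
        refine hball ?_
        have hle : ρ / ((k : ℝ) + 2) ≤ ρ := div_le_self hρ0.le
          (by linarith [k.cast_nonneg (α := ℝ)])
        have h0 : 0 ≤ ρ / ((k : ℝ) + 2) := by positivity
        rw [Metric.mem_ball, dist_eq_norm, add_sub_cancel_left, Complex.norm_real,
          Real.norm_of_nonneg h0]
        linarith
      simp only [slope_def_field]
      exact (((hf.continuous hk).sub (hf.continuous hw₀)).div_const _).aestronglyMeasurable
    · refine Eventually.of_forall fun x => ?_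
      exact (hasDerivAt_iff_tendsto_slope.1 (hd x w₀ (Metric.mem_ball_self hρ0))).comp hlim
  have := hasDerivAt_integral_of_dominated_loc_of_deriv_le (μ := μ) (F := f)
    (F' := fun w x => deriv (fun w => f w x) w) (x₀ := w₀) (s := Metric.ball w₀ ρ)
    (bound := fun _ => M / ρ) (Metric.ball_mem_nhds w₀ hρ0)
    ((hΩ.mem_nhds hw₀ |> eventually_mem_set.2).mono fun w hw => hf.aestronglyMeasurable hw)
    (hf.integrable hw₀) hmeas (Eventually.of_forall fun x w hw => hder x w hw)
    (integrable_const _) (Eventually.of_forall fun x w hw => hd x w hw)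
  exact this.2.differentiableAt.differentiableWithinAt

end HolFam

end HolomorphicFamilies

section Torus

open Filter Topology

instance factTwoPiPos : Fact (0 < 2 * π) := ⟨Real.two_pi_pos⟩

variable {n : ℕ}

/-- The coordinates of a point of the maximal torus of `SU(n + 1)`: `n + 1` angles of sum zero,
the last `n` of which are prescribed. -/
noncomputable def torusExt (x : Fin n → AddCircle (2 * π)) : Fin (n + 1) → AddCircle (2 * π) :=
  Fin.cons (-∑ j, x j) x

/-- The point of the maximal torus of `SU(n + 1)` with given angles. -/
noncomputable def torusPt (x : Fin n → AddCircle (2 * π)) : Fin (n + 1) → ℂ :=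
  fun i => (torusExt x i).toCircle

lemma sum_torusExt (x : Fin n → AddCircle (2 * π)) : ∑ i, torusExt x i = 0 := by
  simp [torusExt, Fin.sum_univ_succ]

lemma torusExt_tail (y : Fin (n + 1) → AddCircle (2 * π)) (h : ∑ i, y i = 0) :
    torusExt (Fin.tail y) = y := by
  rw [Fin.sum_univ_succ] at h
  conv_rhs => rw [← Fin.cons_self_tail y]
  rw [torusExt, eq_neg_of_add_eq_zero_left h]
  rfl

lemma torusExt_add (x y : Fin n → AddCircle (2 * π)) :
    torusExt (x + y) = torusExt x + torusExt y := by
  funext i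
  refine Fin.cases ?_ (fun j => ?_) i
  · simp [torusExt, Finset.sum_add_distrib, add_comm]
  · simp [torusExt]

lemma torusExt_neg (x : Fin n → AddCircle (2 * π)) : torusExt (-x) = -torusExt x := by
  funext i
  refine Fin.cases ?_ (fun j => ?_) i <;> simp [torusExt]

@[fun_prop]
lemma continuous_torusExt : Continuous (torusExt (n := n)) := by
  refine continuous_pi fun i => ?_
  refine Fin.cases ?_ (fun j => ?_) i
  · simp only [torusExt, Fin.cons_zero]
    fun_prop
  · simp only [torusExt, Fin.cons_succ]
    fun_prop

lemma continuous_torusPt (i : Fin (n + 1)) :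
    Continuous fun x : Fin n → AddCircle (2 * π) => torusPt x i :=
  continuous_subtype_val.comp (AddCircle.continuous_toCircle.comp
    ((continuous_apply i).comp continuous_torusExt))

@[simp] lemma norm_torusPt (x : Fin n → AddCircle (2 * π)) (i : Fin (n + 1)) : ‖torusPt x i‖ = 1 :=
  Circle.norm_coe _

lemma torusPt_ne_zero (x : Fin n → AddCircle (2 * π)) (i : Fin (n + 1)) : torusPt x i ≠ 0 :=
  Circle.coe_ne_zero _

lemma toCircle_sum {ι : Type*} (s : Finset ι) (y : ι → AddCircle (2 * π)) :
    (∑ i ∈ s, y i).toCircle = ∏ i ∈ s, (y i).toCircle := by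
  classical
  induction s using Finset.induction_on with
  | empty => simp
  | insert a s ha ih => rw [Finset.sum_insert ha, Finset.prod_insert ha, AddCircle.toCircle_add, ih]

lemma prod_torusPt (x : Fin n → AddCircle (2 * π)) : ∏ i, torusPt x i = 1 := by
  have : ∏ i, torusPt x i = Circle.coeHom (∏ i, (torusExt x i).toCircle) :=
    (map_prod Circle.coeHom _ _).symm
  rw [this, ← toCircle_sum, sum_torusExt]
  simp

lemma toCircle_coe_two_pi (a : ℝ) :
    (AddCircle.toCircle (a : AddCircle (2 * π)) : ℂ) = Complex.exp (a * Complex.I) := by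
  rw [AddCircle.toCircle_apply_mk, div_self Real.two_pi_pos.ne', one_mul, Circle.coe_exp]

lemma torusPt_add (x y : Fin n → AddCircle (2 * π)) (i : Fin (n + 1)) :
    torusPt (x + y) i = torusPt x i * torusPt y i := by
  simp [torusPt, torusExt_add, AddCircle.toCircle_add]

lemma torusPt_neg (x : Fin n → AddCircle (2 * π)) (i : Fin (n + 1)) :
    torusPt (-x) i = (torusPt x i)⁻¹ := by
  simp [torusPt, torusExt_neg, AddCircle.toCircle_neg]

lemma torusExt_tail_comp (σ : Equiv.Perm (Fin (n + 1))) (x : Fin n → AddCircle (2 * π)) :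
    torusExt (Fin.tail (torusExt x ∘ σ)) = torusExt x ∘ σ :=
  torusExt_tail _ ((Equiv.sum_comp σ (torusExt x)).trans (sum_torusExt x))

/-- Permutations of the coordinates of the torus. -/
noncomputable def torusPerm (σ : Equiv.Perm (Fin (n + 1))) :
    (Fin n → AddCircle (2 * π)) ≃+ (Fin n → AddCircle (2 * π)) where
  toFun x := Fin.tail (torusExt x ∘ σ)
  invFun x := Fin.tail (torusExt x ∘ σ.symm)
  left_inv x := by
    simp only [torusExt_tail_comp]
    funext i
    simp [Fin.tail, torusExt]
  right_inv x := by
    simp only [torusExt_tail_comp]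
    funext i
    simp [Fin.tail, torusExt]
  map_add' x y := by
    funext i
    simp [Fin.tail, torusExt_add]

lemma torusPt_torusPerm (σ : Equiv.Perm (Fin (n + 1))) (x : Fin n → AddCircle (2 * π)) :
    torusPt (torusPerm σ x) = torusPt x ∘ σ := by
  funext i
  simp only [torusPt, torusPerm, AddEquiv.coe_mk, Equiv.coe_fn_mk]
  rw [torusExt_tail_comp]
  rfl

lemma continuous_torusPerm (σ : Equiv.Perm (Fin (n + 1))) : Continuous (torusPerm σ) := by
  have : ⇑(torusPerm σ) = fun x j => torusExt x (σ (Fin.succ j)) := rfl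
  rw [this]
  fun_prop

lemma measurePreserving_torusPerm (σ : Equiv.Perm (Fin (n + 1))) :
    MeasurePreserving (torusPerm σ) volume volume := by
  have := AddMonoidHom.measurePreserving (μ := (volume : Measure (Fin n → AddCircle (2 * π))))
    (ν := volume) (f := (torusPerm σ).toAddMonoidHom) (continuous_torusPerm σ)
    (torusPerm σ).surjective rfl
  exact this

lemma integral_torusPt_comp_perm (σ : Equiv.Perm (Fin (n + 1))) (f : (Fin (n + 1) → ℂ) → ℂ) :
    ∫ x : Fin n → AddCircle (2 * π), f (torusPt x ∘ σ) =
      ∫ x : Fin n → AddCircle (2 * π), f (torusPt x) := by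
  have hemb : MeasurableEmbedding (torusPerm (n := n) σ) :=
    ((continuous_torusPerm σ).isClosedEmbedding (torusPerm σ).injective).measurableEmbedding
  have := (measurePreserving_torusPerm σ).integral_comp hemb (fun x => f (torusPt x))
  simpa only [torusPt_torusPerm] using this

lemma integral_torusPt_inv (f : (Fin (n + 1) → ℂ) → ℂ) :
    ∫ x : Fin n → AddCircle (2 * π), f (torusPt x)⁻¹ =
      ∫ x : Fin n → AddCircle (2 * π), f (torusPt x) := by
  have hcont : Continuous (AddEquiv.neg (Fin n → AddCircle (2 * π))) := continuous_neg
  have hp : MeasurePreserving (AddEquiv.neg (Fin n → AddCircle (2 * π))) volume volume :=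
    AddMonoidHom.measurePreserving (f := (AddEquiv.neg (Fin n → AddCircle (2 * π))).toAddMonoidHom)
      hcont (AddEquiv.neg _).surjective rfl
  have hemb := (hcont.isClosedEmbedding (AddEquiv.neg _).injective).measurableEmbedding
  have e : ∀ x : Fin n → AddCircle (2 * π), torusPt (-x) = (torusPt x)⁻¹ :=
    fun x => funext fun i => torusPt_neg x i
  simpa [e] using hp.integral_comp hemb (fun x => f (torusPt x))

lemma ae_torusPt_ne {i j : Fin (n + 1)} (hij : i ≠ j) :
    ∀ᵐ x : Fin n → AddCircle (2 * π), torusPt x i ≠ torusPt x j := by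
  let φ : (Fin n → AddCircle (2 * π)) →+ AddCircle (2 * π) :=
    { toFun := fun x => torusExt x i - torusExt x j
      map_zero' := by
        have : torusExt (0 : Fin n → AddCircle (2 * π)) = 0 := by
          have := torusExt_add (0 : Fin n → AddCircle (2 * π)) 0
          simpa using this
        simp [this]
      map_add' := fun x y => by
        simp only [torusExt_add, Pi.add_apply]
        abel }
  have hcont : Continuous φ := by
    change Continuous fun x => torusExt x i - torusExt x j
    fun_prop
  have hsurj : Function.Surjective φ := by
    intro a
    induction a using QuotientAddGroup.induction_on with | H a =>
    let v : Fin (n + 1) → ℝ := Pi.single i (a / 2) - Pi.single j (a / 2)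
    have hv : ∑ k, ((v k : ℝ) : AddCircle (2 * π)) = 0 := by
      have : ∑ k, v k = 0 := by simp [v]
      rw [← AddCircle.coe_zero, ← this]
      exact (map_sum (QuotientAddGroup.mk' _) v Finset.univ).symm
    refine ⟨Fin.tail fun k => (v k : AddCircle (2 * π)), ?_⟩
    change torusExt _ i - torusExt _ j = _
    rw [torusExt_tail _ hv, ← AddCircle.coe_sub]
    congr 1
    simp [v, hij, hij.symm]
  have hH : Measure.IsAddHaarMeasure (Measure.map φ volume) :=
    Measure.isAddHaarMeasure_map _ φ hcont hsurj (by simp)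
  have : ConnectedSpace (AddCircle (2 * π)) :=
    inferInstanceAs (ConnectedSpace (Quotient _))
  have : Nontrivial (AddCircle (2 * π)) :=
    ⟨(0 : AddCircle (2 * π)), (π : ℝ), fun h => by
      have := congrArg (fun y : AddCircle (2 * π) => (y.toCircle : ℂ)) h
      norm_num [toCircle_coe_two_pi, Complex.exp_pi_mul_I] at this⟩
  have h0 : Measure.map φ volume {0} = 0 := measure_singleton 0
  rw [Measure.map_apply hcont.measurable (measurableSet_singleton 0)] at h0
  rw [ae_iff]
  refine measure_mono_null (fun x hx => ?_) h0
  have := AddCircle.injective_toCircle Real.two_pi_pos.ne'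
    (Circle.coe_injective (not_not.1 hx))
  simp [φ, this]

/-- Shifting the contour of integration over the torus. -/
lemma integral_torusPt_shift {f : (Fin (n + 1) → ℂ) → ℂ} {c : Fin (n + 1) → ℝ}
    (hc : ∑ i, c i = 0) {Ω : Set ℂ} {α β : ℝ} (hΩ : Ω = {s : ℂ | α < s.re ∧ s.re < β})
    (hf : HolFam Ω fun s (x : Fin n → AddCircle (2 * π)) =>
      f fun i => torusPt x i * Complex.exp (c i * s))
    {s₁ s₂ : ℂ} (h₁ : s₁ ∈ Ω) (h₂ : s₂ ∈ Ω) :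
    ∫ x : Fin n → AddCircle (2 * π), f (fun i => torusPt x i * Complex.exp (c i * s₁)) =
      ∫ x : Fin n → AddCircle (2 * π), f (fun i => torusPt x i * Complex.exp (c i * s₂)) := by
  have hO : IsOpen Ω := by
    rw [hΩ]
    exact (isOpen_lt continuous_const Complex.continuous_re).inter
      (isOpen_lt Complex.continuous_re continuous_const)
  have hconv : Convex ℝ Ω := by
    rw [hΩ]
    exact (convex_halfSpace_re_gt α).inter (convex_halfSpace_re_lt β)
  have hD := hf.differentiableOn_integral (μ := volume) hO
  set Φ := fun s => ∫ x : Fin n → AddCircle (2 * π),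
    f (fun i => torusPt x i * Complex.exp (c i * s)) with hΦ
  have htrans : ∀ s (τ : ℝ), Φ (s + τ * Complex.I) = Φ s := by
    intro s τ
    have hv : ∑ k, ((c k * τ : ℝ) : AddCircle (2 * π)) = 0 := by
      have : ∑ k, c k * τ = 0 := by rw [← Finset.sum_mul, hc, zero_mul]
      rw [← AddCircle.coe_zero, ← this]
      exact (map_sum (QuotientAddGroup.mk' _) (fun k => c k * τ) Finset.univ).symm
    have hy : ∀ i, torusPt (Fin.tail fun k => ((c k * τ : ℝ) : AddCircle (2 * π))) i =
        Complex.exp (c i * (τ * Complex.I)) := by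
      intro i
      rw [torusPt, torusExt_tail _ hv, toCircle_coe_two_pi]
      congr 1
      push_cast
      ring
    simp only [hΦ]
    rw [← integral_add_right_eq_self (fun x => f fun i => torusPt x i * Complex.exp (c i * s))
      (Fin.tail fun k => ((c k * τ : ℝ) : AddCircle (2 * π)))]
    refine integral_congr_ae (.of_forall fun x => ?_)
    simp only [torusPt_add, hy, mul_assoc, ← Complex.exp_add, mul_add, add_comm (_ * s)]
  refine hO.is_const_of_deriv_eq_zero hconv.isPreconnected hD (fun s hs => ?_) h₁ h₂
  have hd := (hD.differentiableAt (hO.mem_nhds hs)).hasDerivAt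
  have h1 : HasDerivAt (fun τ : ℝ => s + τ * Complex.I) Complex.I 0 := by
    simpa using ((Complex.ofRealCLM.hasDerivAt (x := 0)).mul_const Complex.I).const_add s
  have h2 : HasDerivAt (fun τ : ℝ => Φ (s + τ * Complex.I)) (deriv Φ s * Complex.I) 0 :=
    HasDerivAt.comp_of_eq (h₂ := Φ) 0 hd h1 (by simp)
  simp only [htrans] at h2
  have := h2.unique (hasDerivAt_const 0 (Φ s))
  simpa using this

end Torus

section TorusIntegral

variable {n : ℕ} {p q : ℂ} {t u : Fin (n + 2) → ℂ}

/-- The integrand of the `A_n` elliptic beta integral, with the factors in the denominator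
rewritten by means of the reflection formula. -/
noncomputable def anKernel (p q : ℂ) (t u : Fin (n + 2) → ℂ) (z : Fin (n + 1) → ℂ) : ℂ :=
  (∏ i, ∏ r, ellGamma (t r * z i) p q * ellGamma (u r / z i) p q) *
    ∏ i, ∏ j ∈ Finset.univ.erase i, ellGamma (p * q * (z i / z j)) p q

/-- The (unnormalized) `A_n` elliptic beta integral. -/
noncomputable def anIntegral (p q : ℂ) (t u : Fin (n + 2) → ℂ) : ℂ :=
  ∫ x : Fin n → AddCircle (2 * π), anKernel p q t u (torusPt x)

/-- The product of elliptic Gamma functions evaluating the `A_n` elliptic beta integral. -/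
noncomputable def betaProduct (p q : ℂ) (t u : Fin (n + 2) → ℂ) : ℂ :=
  (∏ r, ∏ s, ellGamma (t r * u s) p q) *
    ∏ r, ellGamma ((∏ s, u s) / u r) p q * ellGamma ((∏ s, t s) / t r) p q

lemma prod_prod_erase_eq_prod_lt {ι : Type*} [Fintype ι] [LinearOrder ι] (f : ι → ι → ℂ) :
    ∏ i, ∏ j ∈ Finset.univ.erase i, f i j = ∏ i, ∏ j, if i < j then f i j * f j i else 1 := by
  have h1 : ∀ i, ∏ j ∈ Finset.univ.erase i, f i j =
      (∏ j, if i < j then f i j else 1) * ∏ j, if j < i then f i j else 1 := by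
    intro i
    rw [← Finset.prod_mul_distrib, ← Finset.mul_prod_erase _ _ (Finset.mem_univ i)]
    simp only [lt_irrefl, if_false, mul_one, one_mul]
    refine Finset.prod_congr rfl fun j hj => ?_
    rcases lt_or_gt_of_ne (Finset.ne_of_mem_erase hj) with h | h <;> simp [h, h.not_gt]
  simp only [h1, Finset.prod_mul_distrib]
  rw [Finset.prod_comm (f := fun i j => if j < i then f i j else 1)]
  simp only [← Finset.prod_mul_distrib]
  refine Finset.prod_congr rfl fun i _ => Finset.prod_congr rfl fun j _ => ?_
  split_ifs <;> simp

lemma anKernel_eq_div (hp0 : 0 < ‖p‖) (hq0 : 0 < ‖q‖) (hp : ‖p‖ < 1) (hq : ‖q‖ < 1)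
    {z : Fin (n + 1) → ℂ} (hz : ∀ i, z i ≠ 0) :
    anKernel p q t u z =
      (∏ i, ∏ r, ellGamma (t r * z i) p q * ellGamma (u r / z i) p q) /
        ∏ i, ∏ j, if i < j then ellGamma (z i / z j) p q * ellGamma (z j / z i) p q else 1 := by
  have h : ∀ i j, ellGamma (p * q * (z i / z j)) p q = (ellGamma (z j / z i) p q)⁻¹ := by
    intro i j
    rw [← ellGamma_reflect (norm_pos_iff.1 hp0) (norm_pos_iff.1 hq0) hp hq _
      (div_ne_zero (hz j) (hz i)), ← mul_div_assoc, div_div_eq_mul_div, mul_div_assoc]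
  rw [anKernel, div_eq_mul_inv, prod_prod_erase_eq_prod_lt]
  simp only [← Finset.prod_inv_distrib, h]
  congr 1
  refine Finset.prod_congr rfl fun i _ => Finset.prod_congr rfl fun j _ => ?_
  split_ifs <;> simp [mul_comm]

lemma torusPt_coe (θ : Fin n → ℝ) :
    torusPt (fun j => (θ j : AddCircle (2 * π))) =
      Fin.cons (1 / ∏ j : Fin n, Complex.exp (Complex.I * θ j))
        (fun j => Complex.exp (Complex.I * θ j)) := by
  have h : ∀ j : Fin n, torusPt (fun j => (θ j : AddCircle (2 * π))) j.succ =
      Complex.exp (Complex.I * θ j) := fun j => by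
    rw [torusPt, torusExt, Fin.cons_succ, toCircle_coe_two_pi, mul_comm]
  funext i
  refine Fin.cases ?_ (fun j => h j) i
  have := prod_torusPt fun j => (θ j : AddCircle (2 * π))
  rw [Fin.prod_univ_succ] at this
  simp only [h] at this
  rw [Fin.cons_zero]
  exact eq_one_div_of_mul_eq_one_left this

lemma setIntegral_Icc_eq_integral_addCircle {f : (Fin n → AddCircle (2 * π)) → ℂ}
    (hf : Continuous f) :
    ∫ θ in Set.univ.pi fun _ : Fin n => Set.Icc (0 : ℝ) (2 * π),
      f (fun j => (θ j : AddCircle (2 * π))) = ∫ x, f x := by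
  have h1 : (volume : Measure (Fin n → ℝ)).restrict (Set.univ.pi fun _ => Set.Icc 0 (2 * π)) =
      Measure.pi fun _ => (volume : Measure ℝ).restrict (Set.Ioc 0 (0 + 2 * π)) := by
    rw [volume_pi, Measure.restrict_pi_pi, zero_add]
    congr 1
    funext _
    exact Measure.restrict_congr_set Ioc_ae_eq_Icc.symm
  have h2 := measurePreserving_pi (fun _ : Fin n => (volume : Measure ℝ).restrict
    (Set.Ioc 0 (0 + 2 * π))) (fun _ => volume)
    (fun _ => AddCircle.measurePreserving_mk (2 * π) 0)
  rw [h1, ← volume_pi] at *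
  rw [← h2.map_eq, integral_map h2.measurable.aemeasurable hf.aestronglyMeasurable]

lemma HolFam.anKernel {K : Type*} [TopologicalSpace K] {Ω : Set ℂ} (hΩ : IsOpen Ω)
    {P : ℂ → ℂ} {t u : Fin (n + 2) → ℂ → ℂ} {z : Fin (n + 1) → ℂ → K → ℂ}
    (hP : DifferentiableOn ℂ P Ω) (ht : ∀ r, DifferentiableOn ℂ (t r) Ω)
    (hu : ∀ r, DifferentiableOn ℂ (u r) Ω) (hz : ∀ i, HolFam Ω (z i))
    (hp1 : ∀ w ∈ Ω, ‖P w‖ < 1) (hp0 : ∀ w ∈ Ω, P w ≠ 0) (hq : ‖q‖ < 1) (hq0 : q ≠ 0)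
    (ht0 : ∀ r, ∀ w ∈ Ω, t r w ≠ 0) (hu0 : ∀ r, ∀ w ∈ Ω, u r w ≠ 0)
    (hz0 : ∀ i, ∀ w ∈ Ω, ∀ x, z i w x ≠ 0)
    (ht1 : ∀ r i, ∀ w ∈ Ω, ∀ x, ‖t r w * z i w x‖ < 1)
    (hu1 : ∀ r i, ∀ w ∈ Ω, ∀ x, ‖u r w / z i w x‖ < 1)
    (hz1 : ∀ i j, ∀ w ∈ Ω, ∀ x, ‖P w * q * (z i w x / z j w x)‖ < 1) :
    HolFam Ω fun w x => anKernel (P w) q (fun r => t r w) (fun r => u r w) fun i => z i w x := by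
  have HP : HolFam (K := K) Ω fun w _ => P w := of_differentiableOn hP
  have HQ : HolFam (K := K) Ω fun _ _ => q := of_continuous continuous_const
  have HT : ∀ r, HolFam (K := K) Ω fun w _ => t r w := fun r => of_differentiableOn (ht r)
  have HU : ∀ r, HolFam (K := K) Ω fun w _ => u r w := fun r => of_differentiableOn (hu r)
  refine HolFam.mul (HolFam.prod fun i _ => HolFam.prod fun r _ => HolFam.mul ?_ ?_)
    (HolFam.prod fun i _ => HolFam.prod fun j _ => ?_)
  · exact ellGamma hΩ ((HT r).mul (hz i)) HP HQ (fun w hw _ => hp1 w hw) (fun _ _ _ => hq)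
      (fun w hw x => mul_ne_zero (ht0 r w hw) (hz0 i w hw x)) (ht1 r i)
  · exact ellGamma hΩ ((HU r).div (hz i) (hz0 i)) HP HQ (fun w hw _ => hp1 w hw)
      (fun _ _ _ => hq) (fun w hw x => div_ne_zero (hu0 r w hw) (hz0 i w hw x)) (hu1 r i)
  · exact ellGamma hΩ ((HP.mul HQ).mul ((hz i).div (hz j) (hz0 j))) HP HQ
      (fun w hw _ => hp1 w hw) (fun _ _ _ => hq)
      (fun w hw x => mul_ne_zero (mul_ne_zero (hp0 w hw) hq0)
        (div_ne_zero (hz0 i w hw x) (hz0 j w hw x))) (hz1 i j)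

lemma HolFam.anKernel_torusPt {Ω : Set ℂ} (hΩ : IsOpen Ω)
    {P : ℂ → ℂ} {t u : Fin (n + 2) → ℂ → ℂ}
    (hP : DifferentiableOn ℂ P Ω) (ht : ∀ r, DifferentiableOn ℂ (t r) Ω)
    (hu : ∀ r, DifferentiableOn ℂ (u r) Ω)
    (hp1 : ∀ w ∈ Ω, ‖P w‖ < 1) (hp0 : ∀ w ∈ Ω, P w ≠ 0) (hq : ‖q‖ < 1) (hq0 : q ≠ 0)
    (ht0 : ∀ r, ∀ w ∈ Ω, t r w ≠ 0) (hu0 : ∀ r, ∀ w ∈ Ω, u r w ≠ 0)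
    (ht1 : ∀ r, ∀ w ∈ Ω, ‖t r w‖ < 1) (hu1 : ∀ r, ∀ w ∈ Ω, ‖u r w‖ < 1) :
    HolFam Ω fun w (x : Fin n → AddCircle (2 * π)) =>
      _root_.anKernel (P w) q (fun r => t r w) (fun r => u r w) (torusPt x) := by
  refine HolFam.anKernel (z := fun i _ x => torusPt x i) hΩ hP ht hu
    (fun i => of_continuous (continuous_torusPt i)) hp1 hp0 hq hq0 ht0 hu0
    (fun i _ _ x => torusPt_ne_zero x i) ?_ ?_ ?_
  · intro r i w hw x
    simpa using ht1 r w hw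
  · intro r i w hw x
    simpa using hu1 r w hw
  · intro i j w hw x
    have := mul_lt_one_of_nonneg_of_lt_one_left (norm_nonneg _) (hp1 w hw) hq.le
    simpa using this

lemma continuous_anKernel (hp0 : p ≠ 0) (hq0 : q ≠ 0) (hp : ‖p‖ < 1) (hq : ‖q‖ < 1)
    (ht0 : ∀ r, t r ≠ 0) (hu0 : ∀ r, u r ≠ 0) (ht : ∀ r, ‖t r‖ < 1) (hu : ∀ r, ‖u r‖ < 1) :
    Continuous fun x : Fin n → AddCircle (2 * π) => anKernel p q t u (torusPt x) :=
  (HolFam.anKernel_torusPt (P := fun _ => p) (t := fun r _ => t r) (u := fun r _ => u r)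
    isOpen_univ (differentiableOn_const _) (fun _ => differentiableOn_const _)
    (fun _ => differentiableOn_const _) (fun _ _ => hp) (fun _ _ => hp0) hq hq0
    (fun r _ _ => ht0 r) (fun r _ _ => hu0 r) (fun r _ _ => ht r) (fun r _ _ => hu r)).continuous
    (Set.mem_univ 0)

lemma integrable_anKernel (hp0 : p ≠ 0) (hq0 : q ≠ 0) (hp : ‖p‖ < 1) (hq : ‖q‖ < 1)
    (ht0 : ∀ r, t r ≠ 0) (hu0 : ∀ r, u r ≠ 0) (ht : ∀ r, ‖t r‖ < 1) (hu : ∀ r, ‖u r‖ < 1) :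
    Integrable fun x : Fin n → AddCircle (2 * π) => anKernel p q t u (torusPt x) := by
  have := (continuous_anKernel hp0 hq0 hp hq ht0 hu0 ht hu).integrable_of_hasCompactSupport
    (μ := volume) (HasCompactSupport.of_compactSpace _)
  exact this

/-- The integral over the box of angles is an integral over the torus. -/
lemma setIntegral_eq_anIntegral (hp0 : 0 < ‖p‖) (hq0 : 0 < ‖q‖) (hp : ‖p‖ < 1)
    (hq : ‖q‖ < 1) (ht0 : ∀ r, t r ≠ 0) (hu0 : ∀ r, u r ≠ 0) (ht : ∀ r, ‖t r‖ < 1)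
    (hu : ∀ r, ‖u r‖ < 1) :
    (∫ θ in Set.univ.pi fun _ : Fin n => Set.Icc (0 : ℝ) (2 * Real.pi),
        (fun z : Fin (n + 1) → ℂ =>
          (∏ i, ∏ r, ellGamma (t r * z i) p q * ellGamma (u r / z i) p q) /
            ∏ i, ∏ j, if i < j then ellGamma (z i / z j) p q * ellGamma (z j / z i) p q else 1)
        (Fin.cons (1 / ∏ j : Fin n, Complex.exp (Complex.I * θ j))
          (fun j => Complex.exp (Complex.I * θ j)))) = anIntegral p q t u := by
  rw [anIntegral, ← setIntegral_Icc_eq_integral_addCircle (continuous_anKernel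
    (norm_pos_iff.1 hp0) (norm_pos_iff.1 hq0) hp hq ht0 hu0 ht hu)]
  congr 1
  funext θ
  rw [← torusPt_coe, anKernel_eq_div hp0 hq0 hp hq (torusPt_ne_zero _)]

/-- The symmetry exchanging the two sets of parameters. -/
lemma anIntegral_symm : anIntegral p q t u = anIntegral p q u t := by
  rw [anIntegral, ← integral_torusPt_inv (anKernel p q t u), anIntegral]
  congr 1
  funext x
  simp only [anKernel, Pi.inv_apply, div_inv_eq_mul, ← div_eq_mul_inv,
    mul_comm (ellGamma (t _ / _) p q)]
  congr 1
  simp only [prod_prod_erase_eq_prod_lt]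
  refine Finset.prod_congr rfl fun i _ => Finset.prod_congr rfl fun j _ => ?_
  split_ifs
  · rw [mul_comm]
    congr 3 <;> field_simp
  · rfl

lemma betaProduct_symm : betaProduct p q t u = betaProduct p q u t := by
  rw [betaProduct, Finset.prod_comm]
  simp only [betaProduct, mul_comm (t _),
    mul_comm (ellGamma _ p q) (ellGamma ((∏ s, t s) / _) p q)]

lemma anIntegral_comp_perm (σ : Equiv.Perm (Fin (n + 2))) :
    anIntegral p q (t ∘ σ) u = anIntegral p q t u := by
  have h : ∀ y, ∏ r, ellGamma (t (σ r) * y) p q = ∏ r, ellGamma (t r * y) p q :=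
    fun y => Equiv.prod_comp σ fun r => ellGamma (t r * y) p q
  simp only [anIntegral, anKernel, Finset.prod_mul_distrib, Function.comp_apply, h]

end TorusIntegral

section DifferenceEquation

variable {n : ℕ} {p q : ℂ}

lemma prod_erase_eq_prod_ite {ι : Type*} [Fintype ι] [DecidableEq ι] (k : ι) (f : ι → ℂ) :
    ∏ j ∈ Finset.univ.erase k, f j = ∏ j, if j = k then 1 else f j := by
  rw [← Finset.mul_prod_erase _ _ (Finset.mem_univ k), if_pos rfl, one_mul]
  exact Finset.prod_congr rfl fun j hj => by rw [if_neg (Finset.ne_of_mem_erase hj)]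

lemma prod_prod_erase_ite {ι : Type*} [Fintype ι] [DecidableEq ι] (k : ι) (f : ι → ℂ) :
    ∏ i, ∏ j ∈ Finset.univ.erase i, (if i = k then f j else 1) =
      ∏ j ∈ Finset.univ.erase k, f j := by
  rw [Finset.prod_eq_single k (fun i _ hi => by simp [hi]) (by simp)]
  simp

lemma prod_prod_erase_ite' {ι : Type*} [Fintype ι] [DecidableEq ι] (k : ι) (f : ι → ℂ) :
    ∏ i, ∏ j ∈ Finset.univ.erase i, (if j = k then f i else 1) =
      ∏ i ∈ Finset.univ.erase k, f i := by
  rw [prod_erase_eq_prod_ite]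
  refine Finset.prod_congr rfl fun i _ => ?_
  by_cases hi : i = k
  · subst hi
    rw [if_pos rfl]
    exact Finset.prod_eq_one fun j hj => if_neg (Finset.ne_of_mem_erase hj)
  · rw [if_neg hi, Finset.prod_eq_single k (fun j _ hj => by simp [hj])
      (fun h => (h (Finset.mem_erase.2 ⟨Ne.symm hi, Finset.mem_univ k⟩)).elim), if_pos rfl]

lemma ellTheta_div_ne_zero (hp : ‖p‖ < 1) {x y : ℂ} (hxy : x ≠ y)
    (h : ‖x‖ = ‖y‖) (hy : y ≠ 0) : ellTheta (x / y) p ≠ 0 := by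
  intro h0
  obtain ⟨m, hm⟩ := exists_zpow_of_ellTheta_eq_zero hp (div_ne_zero (by
    rwa [← norm_pos_iff, h, norm_pos_iff]) hy) h0
  have h1 : ‖p‖ ^ m = 1 := by
    rw [← norm_zpow, ← hm, norm_div, h, div_self (norm_ne_zero_iff.2 hy)]
  have hm0 : m = 0 := by
    by_contra hm0
    exact hm0 ((zpow_eq_one_iff_right₀ (norm_nonneg p) hp.ne).1 h1)
  rw [hm0, zpow_zero, div_eq_one_iff_eq hy] at hm
  exact hxy hm

lemma ellTheta_div_comm (hp0 : p ≠ 0) (hp : ‖p‖ < 1) {x y : ℂ} (hx : x ≠ 0) (hy : y ≠ 0) :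
    ellTheta (x / y) p = -(x / y) * ellTheta (y / x) p := by
  have := ellTheta_inv hp0 hp (y / x) (div_ne_zero hy hx)
  rw [one_div_div] at this
  exact this

/-- The partial fractions expansion behind the difference equation of the integral. -/
lemma ellTheta_bracket (hp0 : p ≠ 0) (hp : ‖p‖ < 1) {a b : ℂ} {u : Fin (n + 2) → ℂ}
    {z : Fin (n + 1) → ℂ} (hu0 : ∀ r, u r ≠ 0) (hz0 : ∀ i, z i ≠ 0) (ha0 : a ≠ 0) (hb0 : b ≠ 0)
    (hz : ∏ i, z i = 1) (hzz : ∀ i j, i ≠ j → ellTheta (z i / z j) p ≠ 0)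
    (haz : ∀ i, ellTheta (a * z i) p ≠ 0) (hbz : ∀ i, ellTheta (b * z i) p ≠ 0)
    (hab : ellTheta (b / a) p ≠ 0) :
    (∏ s, ellTheta (b * u s) p) * ellTheta (a * ∏ s, u s) p * ∏ j, ellTheta (a * z j) p -
        (∏ s, ellTheta (a * u s) p) * ellTheta (b * ∏ s, u s) p * ∏ j, ellTheta (b * z j) p =
      -a * ellTheta (b / a) p * ∑ k, z k * ellTheta (a * b * (∏ s, u s) * z k) p *
        ((∏ s, ellTheta (u s / z k) p) *
          (∏ j ∈ Finset.univ.erase k, ellTheta (a * z j) p * ellTheta (b * z j) p) /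
            ∏ j ∈ Finset.univ.erase k, ellTheta (z j / z k) p) := by
  set U := ∏ s, u s with hU
  have hU0 : U ≠ 0 := Finset.prod_ne_zero_iff.2 fun s _ => hu0 s
  have hinv := fun {x y : ℂ} => ellTheta_div_comm (x := x) (y := y) hp0 hp
  have haz' : ∀ i, ellTheta (z i / (1 / a)) p ≠ 0 := fun i => by
    rw [div_div_eq_mul_div, div_one, mul_comm]; exact haz i
  have hbz' : ∀ i, ellTheta (z i / (1 / b)) p ≠ 0 := fun i => by
    rw [div_div_eq_mul_div, div_one, mul_comm]; exact hbz i
  have ha1 : (1 / a) ≠ 0 := one_div_ne_zero ha0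
  have hb1 : (1 / b) ≠ 0 := one_div_ne_zero hb0
  have hsymm : ∀ {x y : ℂ}, x ≠ 0 → y ≠ 0 → ellTheta (y / x) p ≠ 0 → ellTheta (x / y) p ≠ 0 := by
    intro x y hx hy h
    rw [hinv hx hy]
    exact mul_ne_zero (neg_ne_zero.2 (div_ne_zero hx hy)) h
  have hab' : ellTheta ((1 / a) / (1 / b)) p ≠ 0 := by
    have : (1 / a) / (1 / b) = b / a := by field_simp
    rwa [this]
  let X : Option (Option (Fin (n + 1))) → ℂ := fun o => o.elim (1 / a) fun o => o.elim (1 / b) z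
  have key := pfSum_eq_zero (s := Finset.univ) (x := X)
    (Y := (1 / (a * b * U)) ::ₘ Finset.univ.val.map u) hp0 hp ?_ ?_ ?_ ?_ ?_
  · simp only [pfSum, prod_erase_eq_prod_ite, Fintype.sum_option, Fintype.prod_option,
      Multiset.map_cons, Multiset.prod_cons, Multiset.map_map, X, Option.elim, reduceCtorEq,
      Option.some.injEq, if_true, if_false, one_mul, Function.comp_def] at key
    simp only [Finset.prod_map_val] at key
    simp only [← prod_erase_eq_prod_ite] at key
    have eu : ∀ x, x ≠ 0 → ∏ s, ellTheta (x / u s) p =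
        (-x) ^ (n + 2) / U * ∏ s, ellTheta (u s / x) p := by
      intro x hx
      rw [Finset.prod_congr rfl fun s _ => hinv hx (hu0 s), Finset.prod_mul_distrib]
      simp only [← neg_div, Finset.prod_div_distrib, Finset.prod_const, Finset.card_univ,
        Fintype.card_fin, hU]
    have ez : ∀ x, x ≠ 0 → ∏ s, ellTheta (x / z s) p =
        (-x) ^ (n + 1) * ∏ s, ellTheta (z s / x) p := by
      intro x hx
      rw [Finset.prod_congr rfl fun s _ => hinv hx (hz0 s), Finset.prod_mul_distrib]
      simp only [← neg_div, Finset.prod_div_distrib, Finset.prod_const, Finset.card_univ,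
        Fintype.card_fin, hz, div_one]
    have ek : ∀ k, ∏ j ∈ Finset.univ.erase k, ellTheta (z k / z j) p =
        (-z k) ^ n * z k * ∏ j ∈ Finset.univ.erase k, ellTheta (z j / z k) p := by
      intro k
      have h1 : ∏ j ∈ Finset.univ.erase k, z j = 1 / z k := by
        rw [eq_div_iff (hz0 k), mul_comm, Finset.mul_prod_erase _ _ (Finset.mem_univ k), hz]
      rw [Finset.prod_congr rfl fun s _ => hinv (hz0 k) (hz0 s), Finset.prod_mul_distrib]
      simp only [← neg_div, Finset.prod_div_distrib, Finset.prod_const, h1,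
        Finset.card_erase_of_mem (Finset.mem_univ k), Finset.card_univ,
        Fintype.card_fin, add_tsub_cancel_right, div_div_eq_mul_div, div_one]
    have d1 : ∀ x y : ℂ, x / (1 / y) = y * x := fun x y => by
      rw [div_div_eq_mul_div, div_one, mul_comm]
    have c1 : a * b * U * (1 / a) = b * U := by field_simp
    have c2 : a * b * U * (1 / b) = a * U := by field_simp
    have c3 : ellTheta (a * (1 / b)) p = -(a / b) * ellTheta (b / a) p := by
      rw [mul_one_div, hinv ha0 hb0]
    have c4 : b * (1 / a) = b / a := by ring
    rw [eu _ ha1, eu _ hb1, ez _ ha1, ez _ hb1] at key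
    simp only [eu _ (hz0 _), ek] at key
    simp only [d1, c1, c2, c3, c4] at key
    have hA0 : ∏ j, ellTheta (a * z j) p ≠ 0 := Finset.prod_ne_zero_iff.2 fun i _ => haz i
    have hB0 : ∏ j, ellTheta (b * z j) p ≠ 0 := Finset.prod_ne_zero_iff.2 fun i _ => hbz i
    have hneg : (-1 : ℂ) ^ n ≠ 0 := pow_ne_zero _ (by norm_num)
    have t3 : ∀ k, z k * ellTheta (a * b * U * z k) p *
        ((∏ s, ellTheta (u s / z k) p) *
          (∏ j ∈ Finset.univ.erase k, ellTheta (a * z j) p * ellTheta (b * z j) p) /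
            ∏ j ∈ Finset.univ.erase k, ellTheta (z j / z k) p) =
        U * (∏ j, ellTheta (a * z j) p) * (∏ j, ellTheta (b * z j) p) *
        (ellTheta (a * b * U * z k) p * ((-z k) ^ (n + 2) / U * ∏ s, ellTheta (u s / z k) p) /
            (ellTheta (a * z k) p * (ellTheta (b * z k) p * ((-z k) ^ n * z k *
              ∏ j ∈ Finset.univ.erase k, ellTheta (z j / z k) p)))) := by
      intro k
      have hD : ∏ j ∈ Finset.univ.erase k, ellTheta (z j / z k) p ≠ 0 :=
        Finset.prod_ne_zero_iff.2 fun j hj => hzz j k (Finset.ne_of_mem_erase hj)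
      rw [← Finset.mul_prod_erase _ (fun j => ellTheta (a * z j) p) (Finset.mem_univ k),
        ← Finset.mul_prod_erase _ (fun j => ellTheta (b * z j) p) (Finset.mem_univ k),
        Finset.prod_mul_distrib]
      have h1 := haz k
      have h2 := hbz k
      have h3 := hz0 k
      have : (-z k) ^ n ≠ 0 := pow_ne_zero _ (neg_ne_zero.2 h3)
      rw [pow_add (-z k)]
      generalize ellTheta (a * z k) p = θ₁ at h1 ⊢
      generalize ellTheta (b * z k) p = θ₂ at h2 ⊢
      field_simp
    have t1 : ellTheta (b * U) p * ((-(1 / a)) ^ (n + 2) / U * ∏ s, ellTheta (a * u s) p) /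
        (ellTheta (b / a) p * ((-(1 / a)) ^ (n + 1) * ∏ s, ellTheta (a * z s) p)) =
        -(ellTheta (b * U) p * (∏ s, ellTheta (a * u s) p)) /
          (a * U * ellTheta (b / a) p * ∏ s, ellTheta (a * z s) p) := by
      have : (-(1 / a)) ^ (n + 1) ≠ 0 := pow_ne_zero _ (neg_ne_zero.2 ha1)
      rw [pow_succ _ (n + 1)]
      field_simp
    have t2 : ellTheta (a * U) p * ((-(1 / b)) ^ (n + 2) / U * ∏ s, ellTheta (b * u s) p) /
        (-(a / b) * ellTheta (b / a) p * ((-(1 / b)) ^ (n + 1) * ∏ s, ellTheta (b * z s) p)) =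
        (ellTheta (a * U) p * (∏ s, ellTheta (b * u s) p)) /
          (a * U * ellTheta (b / a) p * ∏ s, ellTheta (b * z s) p) := by
      have : (-(1 / b)) ^ (n + 1) ≠ 0 := pow_ne_zero _ (neg_ne_zero.2 hb1)
      rw [pow_succ _ (n + 1)]
      field_simp
    rw [t1, t2] at key
    rw [Finset.sum_congr rfl fun k _ => t3 k, ← Finset.mul_sum]
    rw [← add_assoc, add_eq_zero_iff_eq_neg'] at key
    rw [key]
    field_simp
    ring
  · rintro (_ | _ | i) _
    exacts [ha1, hb1, hz0 i]
  · intro y hy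
    rcases Multiset.mem_cons.1 hy with rfl | hy
    · exact one_div_ne_zero (mul_ne_zero (mul_ne_zero ha0 hb0) hU0)
    · obtain ⟨s, _, rfl⟩ := Multiset.mem_map.1 hy
      exact hu0 s
  · rintro (_ | _ | i) _ (_ | _ | j) _ hij
    · exact (hij rfl).elim
    · exact hab'
    · exact hsymm ha1 (hz0 j) (haz' j)
    · exact hsymm hb1 ha1 hab'
    · exact (hij rfl).elim
    · exact hsymm hb1 (hz0 j) (hbz' j)
    · exact haz' i
    · exact hbz' i
    · exact hzz i j fun h => hij (by rw [h])
  · simp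
  · simp only [Fintype.prod_option, X, Option.elim, hz, Multiset.prod_cons, Finset.prod_map_val,
      ← hU]
    field_simp

/-- The kernels whose integrals telescope in the proof of the difference equation. -/
noncomputable def diffKernel (p q a b : ℂ) (t : Fin n → ℂ) (u : Fin (n + 2) → ℂ)
    (k : Fin (n + 1)) (z : Fin (n + 1) → ℂ) : ℂ :=
  (∏ j, ellGamma ((if j = k then a else q * a) * z j) p q *
      ellGamma ((if j = k then b else q * b) * z j) p q *
      (∏ r, ellGamma (t r * z j) p q) *
      ∏ s, ellGamma ((if j = k then q * u s else u s) / z j) p q) *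
    ∏ i, ∏ j ∈ Finset.univ.erase i, ellGamma ((if i = k then p else p * q) * (z i / z j)) p q

lemma ellGamma_mul_q_of_norm_lt_one (hq0 : q ≠ 0) (hp : ‖p‖ < 1) (hq : ‖q‖ < 1) {x : ℂ}
    (hx : ‖x‖ < 1) : ellGamma (q * x) p q = ellTheta x p * ellGamma x p q :=
  ellGamma_mul_q hq0 hp hq x (infPoch_ne_zero_of_norm_lt_one hp hx)

variable {a b : ℂ} {t : Fin n → ℂ} {u : Fin (n + 2) → ℂ} {z : Fin (n + 1) → ℂ}

lemma anKernel_cons_mul_left (hq0 : q ≠ 0) (hp : ‖p‖ < 1) (hq : ‖q‖ < 1)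
    (ha : ∀ j, ‖a * z j‖ < 1) :
    anKernel p q (Fin.cons (q * a) (Fin.cons b t)) u z =
      (∏ j, ellTheta (a * z j) p) * anKernel p q (Fin.cons a (Fin.cons b t)) u z := by
  simp only [anKernel, Finset.prod_mul_distrib, Fin.prod_univ_succ (n := n + 1),
    Fin.prod_univ_succ (n := n), Fin.cons_zero, Fin.cons_succ, mul_assoc q,
    ellGamma_mul_q_of_norm_lt_one hq0 hp hq (ha _)]
  ring

lemma anKernel_cons_mul_right (hq0 : q ≠ 0) (hp : ‖p‖ < 1) (hq : ‖q‖ < 1)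
    (hb : ∀ j, ‖b * z j‖ < 1) :
    anKernel p q (Fin.cons a (Fin.cons (q * b) t)) u z =
      (∏ j, ellTheta (b * z j) p) * anKernel p q (Fin.cons a (Fin.cons b t)) u z := by
  simp only [anKernel, Finset.prod_mul_distrib, Fin.prod_univ_succ (n := n + 1),
    Fin.prod_univ_succ (n := n), Fin.cons_zero, Fin.cons_succ, mul_assoc q,
    ellGamma_mul_q_of_norm_lt_one hq0 hp hq (hb _)]
  ring

lemma diffKernel_eq (hp0 : p ≠ 0) (hq0 : q ≠ 0) (hp : ‖p‖ < 1) (hq : ‖q‖ < 1)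
    (ha : ∀ j, ‖a * z j‖ < 1) (hb : ∀ j, ‖b * z j‖ < 1) (hu : ∀ s j, ‖u s / z j‖ < 1)
    (hz0 : ∀ i, z i ≠ 0) (hz1 : ∀ i, ‖z i‖ = 1)
    (hzz : ∀ i j, i ≠ j → ellTheta (z i / z j) p ≠ 0) (k : Fin (n + 1)) :
    diffKernel p q a b t u k z =
      ((∏ s, ellTheta (u s / z k) p) *
          (∏ j ∈ Finset.univ.erase k, ellTheta (a * z j) p * ellTheta (b * z j) p) /
            ∏ j ∈ Finset.univ.erase k, ellTheta (z j / z k) p) *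
        anKernel p q (Fin.cons a (Fin.cons b t)) u z := by
  have hΓ := fun {x : ℂ} => ellGamma_mul_q_of_norm_lt_one (x := x) hq0 hp hq
  have h1 : ∀ i j, i ≠ j → ellGamma ((if i = k then p else p * q) * (z i / z j)) p q =
      ellGamma (p * q * (z i / z j)) p q * if i = k then (ellTheta (z j / z k) p)⁻¹ else 1 := by
    intro i j hij
    split_ifs with h
    · subst h
      have hn : ‖p * (z i / z j)‖ < 1 := by simpa [hz1] using hp
      have hθ : ellTheta (p * (z i / z j)) p = ellTheta (z j / z i) p := by
        rw [← ellTheta_p_div hp0 _ (div_ne_zero (hz0 j) (hz0 i)), div_div_eq_mul_div, mul_div_assoc]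
      rw [mul_comm p q, mul_assoc q, hΓ hn, hθ, mul_comm (ellTheta _ _), mul_assoc,
        mul_inv_cancel₀ (hzz j i hij.symm), mul_one]
    · rw [mul_one]
  have h2 : ∏ i, ∏ j ∈ Finset.univ.erase i,
      ellGamma ((if i = k then p else p * q) * (z i / z j)) p q
      = (∏ i, ∏ j ∈ Finset.univ.erase i, ellGamma (p * q * (z i / z j)) p q) *
        ∏ j ∈ Finset.univ.erase k, (ellTheta (z j / z k) p)⁻¹ := by
    rw [← prod_prod_erase_ite k, ← Finset.prod_mul_distrib]
    refine Finset.prod_congr rfl fun i _ => ?_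
    rw [← Finset.prod_mul_distrib]
    exact Finset.prod_congr rfl fun j hj => h1 i j (Finset.ne_of_mem_erase hj).symm
  have h3 : ∀ j, ellGamma ((if j = k then a else q * a) * z j) p q *
      ellGamma ((if j = k then b else q * b) * z j) p q * (∏ r, ellGamma (t r * z j) p q) *
      ∏ s, ellGamma ((if j = k then q * u s else u s) / z j) p q =
      ((if j = k then ∏ s, ellTheta (u s / z j) p else 1) *
        if j = k then 1 else ellTheta (a * z j) p * ellTheta (b * z j) p) *
      (ellGamma (a * z j) p q * ellGamma (b * z j) p q * (∏ r, ellGamma (t r * z j) p q) *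
      ∏ s, ellGamma (u s / z j) p q) := by
    intro j
    split_ifs
    · simp only [mul_div_assoc q, hΓ (hu _ j), Finset.prod_mul_distrib]
      ring
    · rw [mul_assoc q, mul_assoc q, hΓ (ha j), hΓ (hb j)]
      ring
  rw [diffKernel, h2, Finset.prod_congr rfl fun j _ => h3 j, Finset.prod_mul_distrib,
    Finset.prod_mul_distrib, ← prod_erase_eq_prod_ite, Finset.prod_ite_eq',
    if_pos (Finset.mem_univ _)]
  simp only [anKernel, Finset.prod_mul_distrib, Fin.prod_univ_succ (n := n + 1),
    Fin.prod_univ_succ (n := n), Fin.cons_zero, Fin.cons_succ, Finset.prod_inv_distrib,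
      div_eq_mul_inv]
  ring

lemma sum_diffKernel_shift_eq_zero (hp0 : p ≠ 0) (hq0 : q ≠ 0) (hp : ‖p‖ < 1)
    (hq : ‖q‖ < 1) (ht0 : ∀ r, t r ≠ 0)
    (hbal : a * b * (∏ r, t r) * ∏ s, u s = p)
    {r : ℝ} (hz0 : ∀ i, z i ≠ 0) (hz1 : ∀ i, ‖z i‖ = r) (hz : ∏ i, z i = 1 / q)
    (ht : ∀ r j, ‖t r * z j‖ < 1) (hzz : ∀ i j, i ≠ j → ellTheta (z i / z j) p ≠ 0) :
    ∑ k, (q * z k) * ellTheta (a * b * (∏ s, u s) * (q * z k)) p *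
      diffKernel p q a b t u k (fun i => if i = k then q * z i else z i) = 0 := by
  have hΓ := fun {x : ℂ} => ellGamma_mul_q_of_norm_lt_one (x := x) hq0 hp hq
  set T := ∏ r, t r with hT
  have hT0 : T ≠ 0 := Finset.prod_ne_zero_iff.2 fun r _ => ht0 r
  have hr : r ≠ 0 := by
    rw [← hz1 0]
    exact norm_ne_zero_iff.2 (hz0 0)
  set V := (∏ j, ellGamma (q * a * z j) p q * ellGamma (q * b * z j) p q *
    (∏ r, ellGamma (t r * z j) p q) * ∏ s, ellGamma (u s / z j) p q) *
    ∏ i, ∏ j ∈ Finset.univ.erase i, ellGamma (p * q * (z i / z j)) p q with hV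
  have hk : ∀ k, diffKernel p q a b t u k (fun i => if i = k then q * z i else z i) =
      V * ((∏ r, ellTheta (t r * z k) p) / ∏ j ∈ Finset.univ.erase k, ellTheta (z k / z j) p) := by
    intro k
    have h1 : ∀ i j, i ≠ j → ellGamma ((if i = k then p else p * q) *
        ((if i = k then q * z i else z i) / (if j = k then q * z j else z j))) p q =
        ellGamma (p * q * (z i / z j)) p q * if j = k then (ellTheta (z k / z i) p)⁻¹ else 1 := by
      intro i j hij
      by_cases hi : i = k
      · have hj : j ≠ k := fun h => hij (hi.trans h.symm)
        simp only [if_pos hi, if_neg hj, mul_one]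
        congr 1
        ring
      · by_cases hj : j = k
        · subst hj
          have hn : ‖p * (z i / z j)‖ < 1 := by
            rw [norm_mul, norm_div, hz1, hz1, div_self hr, mul_one]; exact hp
          have hθ : ellTheta (p * (z i / z j)) p = ellTheta (z j / z i) p := by
            rw [← ellTheta_p_div hp0 _ (div_ne_zero (hz0 j) (hz0 i)), div_div_eq_mul_div,
              mul_div_assoc]
          have e : p * q * (z i / (q * z j)) = p * (z i / z j) := by field_simp
          simp only [if_neg hi, if_true]
          rw [e, mul_comm p q, mul_assoc q, hΓ hn, hθ, mul_comm (ellTheta _ _), mul_assoc,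
            mul_inv_cancel₀ (hzz j i (Ne.symm hij)), mul_one]
        · simp only [if_neg hi, if_neg hj, mul_one]
    have h2 : ∏ i, ∏ j ∈ Finset.univ.erase i, ellGamma ((if i = k then p else p * q) *
        ((if i = k then q * z i else z i) / (if j = k then q * z j else z j))) p q =
        (∏ i, ∏ j ∈ Finset.univ.erase i, ellGamma (p * q * (z i / z j)) p q) *
        ∏ j ∈ Finset.univ.erase k, (ellTheta (z k / z j) p)⁻¹ := by
      rw [← prod_prod_erase_ite' k, ← Finset.prod_mul_distrib]
      refine Finset.prod_congr rfl fun i _ => ?_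
      rw [← Finset.prod_mul_distrib]
      exact Finset.prod_congr rfl fun j hj => h1 i j (Finset.ne_of_mem_erase hj).symm
    have h3 : ∀ j, ellGamma ((if j = k then a else q * a) * (if j = k then q * z j else z j)) p q *
        ellGamma ((if j = k then b else q * b) * (if j = k then q * z j else z j)) p q *
        (∏ r, ellGamma (t r * (if j = k then q * z j else z j)) p q) *
        ∏ s, ellGamma ((if j = k then q * u s else u s) / (if j = k then q * z j else z j)) p q =
        (if j = k then ∏ r, ellTheta (t r * z j) p else 1) *
        (ellGamma (q * a * z j) p q * ellGamma (q * b * z j) p q *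
        (∏ r, ellGamma (t r * z j) p q) * ∏ s, ellGamma (u s / z j) p q) := by
      intro j
      split_ifs
      · simp only [mul_left_comm (t _) q, hΓ (ht _ j), Finset.prod_mul_distrib,
          mul_div_mul_left _ _ hq0, mul_left_comm _ q (z j), mul_assoc q]
        ring
      · rw [one_mul]
    rw [diffKernel, h2, Finset.prod_congr rfl fun j _ => h3 j, Finset.prod_mul_distrib,
      Finset.prod_ite_eq' , if_pos (Finset.mem_univ _), Finset.prod_inv_distrib, hV]
    ring
  have hθ : ∀ k, (q * z k) * ellTheta (a * b * (∏ s, u s) * (q * z k)) p =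
      -T * ellTheta (z k / (T / q)) p := by
    intro k
    have e : a * b * (∏ s, u s) * (q * z k) = p * (z k / (T / q)) := by
      rw [← hbal]
      field_simp
    have h0 := hz0 k
    rw [e, ellTheta_mul_p hp0 hp _ (div_ne_zero h0 (div_ne_zero hT0 hq0))]
    field_simp
  have key := pfSum_eq_zero (s := Finset.univ) (x := z)
    (Y := (T / q) ::ₘ Finset.univ.val.map fun r => 1 / t r) hp0 hp (fun i _ => hz0 i) ?_
    (fun i _ j _ hij => hzz i j hij) (by simp) ?_
  · have d1 : ∀ x y : ℂ, x / (1 / y) = y * x := fun x y => by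
      rw [div_div_eq_mul_div, div_one, mul_comm]
    simp only [pfSum, Multiset.map_cons, Multiset.prod_cons, Multiset.map_map,
      Function.comp_def, d1] at key
    simp only [Finset.prod_map_val] at key
    simp only [hk, hθ]
    calc _ = -T * V * ∑ k, ellTheta (z k / (T / q)) p * (∏ r, ellTheta (t r * z k) p) /
          ∏ j ∈ Finset.univ.erase k, ellTheta (z k / z j) p := by
          rw [Finset.mul_sum]
          exact Finset.sum_congr rfl fun k _ => by ring
      _ = 0 := by rw [key, mul_zero]
  · intro y hy
    rcases Multiset.mem_cons.1 hy with rfl | hy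
    · exact div_ne_zero hT0 hq0
    · obtain ⟨s, _, rfl⟩ := Multiset.mem_map.1 hy
      exact one_div_ne_zero (ht0 s)
  · simp only [Multiset.prod_cons, Finset.prod_map_val, hz, Finset.prod_div_distrib,
      Finset.prod_const_one, ← hT]
    field_simp

end DifferenceEquation

section DifferenceEquationIntegral

open Filter Topology

variable {n : ℕ} {p q a b : ℂ} {t : Fin n → ℂ} {u : Fin (n + 2) → ℂ}

lemma HolFam.diffKernel {K : Type*} [TopologicalSpace K] {Ω : Set ℂ} (hΩ : IsOpen Ω)
    (hp0 : p ≠ 0) (hq0 : q ≠ 0) (hp : ‖p‖ < 1) (hq : ‖q‖ < 1) (ha0 : a ≠ 0) (hb0 : b ≠ 0)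
    (ht0 : ∀ r, t r ≠ 0) (hu0 : ∀ r, u r ≠ 0) {k : Fin (n + 1)} {z : Fin (n + 1) → ℂ → K → ℂ}
    (hz : ∀ i, HolFam Ω (z i)) (hz0 : ∀ i, ∀ w ∈ Ω, ∀ x, z i w x ≠ 0)
    (ha : ∀ i, ∀ w ∈ Ω, ∀ x, ‖(if i = k then a else q * a) * z i w x‖ < 1)
    (hb : ∀ i, ∀ w ∈ Ω, ∀ x, ‖(if i = k then b else q * b) * z i w x‖ < 1)
    (ht : ∀ r i, ∀ w ∈ Ω, ∀ x, ‖t r * z i w x‖ < 1)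
    (hu : ∀ s i, ∀ w ∈ Ω, ∀ x, ‖(if i = k then q * u s else u s) / z i w x‖ < 1)
    (hzz : ∀ i j, i ≠ j → ∀ w ∈ Ω, ∀ x,
      ‖(if i = k then p else p * q) * (z i w x / z j w x)‖ < 1) :
    HolFam Ω fun w x => diffKernel p q a b t u k fun i => z i w x := by
  have hite : ∀ {P : Prop} [Decidable P] {x y : ℂ}, x ≠ 0 → y ≠ 0 → (if P then x else y) ≠ 0 := by
    intro P _ x y hx hy
    split_ifs <;> assumption
  have hc : ∀ c : ℂ, HolFam (K := K) Ω fun _ _ => c := fun c => of_continuous continuous_const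
  refine HolFam.mul (HolFam.prod fun i _ => HolFam.mul (HolFam.mul (HolFam.mul ?_ ?_)
    (HolFam.prod fun r _ => ?_)) (HolFam.prod fun s _ => ?_))
    (HolFam.prod fun i _ => HolFam.prod fun j hj => ?_)
  · exact ellGamma_const hp hq hΩ ((hc _).mul (hz i))
      (fun w hw x => mul_ne_zero (hite ha0 (mul_ne_zero hq0 ha0)) (hz0 i w hw x)) (ha i)
  · exact ellGamma_const hp hq hΩ ((hc _).mul (hz i))
      (fun w hw x => mul_ne_zero (hite hb0 (mul_ne_zero hq0 hb0)) (hz0 i w hw x)) (hb i)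
  · exact ellGamma_const hp hq hΩ ((hc _).mul (hz i))
      (fun w hw x => mul_ne_zero (ht0 r) (hz0 i w hw x)) (ht r i)
  · exact ellGamma_const hp hq hΩ ((hc _).div (hz i) (hz0 i))
      (fun w hw x => div_ne_zero (hite (mul_ne_zero hq0 (hu0 s)) (hu0 s)) (hz0 i w hw x)) (hu s i)
  · exact ellGamma_const hp hq hΩ ((hc _).mul ((hz i).div (hz j) (hz0 j)))
      (fun w hw x => mul_ne_zero (hite hp0 (mul_ne_zero hp0 hq0))
        (div_ne_zero (hz0 i w hw x) (hz0 j w hw x))) (hzz i j (Finset.ne_of_mem_erase hj).symm)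

/-- The exponents of the contour shift used in the proof of the difference equation. -/
noncomputable def shiftExp (k i : Fin (n + 1)) : ℝ :=
  if i = k then n / (n + 1) else -(1 / (n + 1))

lemma sum_shiftExp (k : Fin (n + 1)) : ∑ i, shiftExp k i = 0 := by
  rw [← Finset.add_sum_erase _ _ (Finset.mem_univ k), shiftExp, if_pos rfl,
    Finset.sum_congr rfl fun i hi => show shiftExp k i = -(1 / (n + 1)) by
      rw [shiftExp, if_neg (Finset.ne_of_mem_erase hi)]]
  simp
  ring

lemma eventually_mul_exp_lt_one {x : ℝ} (hx : x < 1) :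
    ∀ᶠ ε in 𝓝[>] (0 : ℝ), x * Real.exp ε < 1 := by
  have h : Tendsto (fun ε : ℝ => x * Real.exp ε) (𝓝[>] 0) (𝓝 (x * Real.exp 0)) :=
    ((continuous_const.mul Real.continuous_exp).tendsto 0).mono_left nhdsWithin_le_nhds
  exact h.eventually_lt_const (by simpa using hx)

lemma holFam_diffKernel_shift (hp0 : p ≠ 0) (hq0 : q ≠ 0) (hp : ‖p‖ < 1) (hq : ‖q‖ < 1)
    (ha0 : a ≠ 0) (hb0 : b ≠ 0) (ht0 : ∀ r, t r ≠ 0) (hu0 : ∀ r, u r ≠ 0) (ha : ‖a‖ < 1)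
    (hb : ‖b‖ < 1) (ht : ∀ r, ‖t r‖ ^ (n + 1) < ‖q‖) (hu : ∀ r, ‖u r‖ < 1) (k : Fin (n + 1)) :
    ∃ ε > 0, HolFam {s : ℂ | Real.log ‖q‖ - ε < s.re ∧ s.re < ε}
      fun s (x : Fin n → AddCircle (2 * π)) => diffKernel p q a b t u k
        fun i => torusPt x i * Complex.exp (shiftExp k i * s) := by
  set κ := Real.exp (-(Real.log ‖q‖ / (n + 1))) with hκ
  have hq0' : 0 < ‖q‖ := norm_pos_iff.2 hq0
  have hL : Real.log ‖q‖ < 0 := Real.log_neg hq0' hq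
  have hn : (0 : ℝ) < n + 1 := by positivity
  have htκ : ∀ r, ‖t r‖ * κ < 1 := by
    intro r
    have h1 : (‖t r‖ * κ) ^ (n + 1) < 1 := by
      have : κ ^ (n + 1) = ‖q‖⁻¹ := by
        rw [hκ, ← Real.exp_nat_mul]
        push_cast
        rw [mul_neg, mul_div_cancel₀ _ hn.ne', Real.exp_neg, Real.exp_log hq0']
      rw [mul_pow, this, ← div_eq_mul_inv, div_lt_one hq0']
      exact ht r
    exact (pow_lt_one_iff_of_nonneg (by positivity) (Nat.succ_ne_zero n)).1 h1
  obtain ⟨ε, ⟨⟨⟨⟨hε, hεa⟩, hεb⟩, hεp⟩, hεu⟩, hεt⟩ := ((((eventually_mem_nhdsWithin.and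
    (eventually_mul_exp_lt_one ha)).and (eventually_mul_exp_lt_one hb)).and
    (eventually_mul_exp_lt_one hp)).and (eventually_all.2 fun s => eventually_mul_exp_lt_one (hu s))
    |>.and (eventually_all.2 fun r => eventually_mul_exp_lt_one (htκ r))).exists
  replace hε : 0 < ε := hε
  refine ⟨ε, hε, ?_⟩
  have hΩ : IsOpen {s : ℂ | Real.log ‖q‖ - ε < s.re ∧ s.re < ε} :=
    (isOpen_lt continuous_const Complex.continuous_re).inter
      (isOpen_lt Complex.continuous_re continuous_const)
  have hnorm : ∀ (i : Fin (n + 1)) (s : ℂ) (x : Fin n → AddCircle (2 * π)),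
      ‖torusPt x i * Complex.exp (shiftExp k i * s)‖ = Real.exp (shiftExp k i * s.re) := by
    intro i s x
    simp [Complex.norm_exp]
  have hfrac : (n : ℝ) / (n + 1) = 1 - 1 / (n + 1) := by
    field_simp
    ring
  have hν0 : (0 : ℝ) < 1 / (n + 1) := by positivity
  have hν1 : (1 : ℝ) / (n + 1) ≤ 1 := by
    rw [div_le_one hn]
    linarith [(Nat.cast_nonneg n : (0 : ℝ) ≤ n)]
  set ν : ℝ := 1 / (n + 1) with hν
  have hck : shiftExp k k = 1 - ν := by rw [shiftExp, if_pos rfl, hfrac]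
  have hcj : ∀ {i}, i ≠ k → shiftExp k i = -ν := fun h => by rw [shiftExp, if_neg h]
  have hκν : κ = Real.exp (-(Real.log ‖q‖) * ν) := by
    rw [hκ, hν]
    congr 1
    ring
  have hqexp : ‖q‖ = Real.exp (Real.log ‖q‖) := (Real.exp_log hq0').symm
  set L := Real.log ‖q‖ with hLdef
  -- the elementary estimates on the exponents
  have b1 : ∀ i {σ : ℝ}, L - ε < σ → σ < ε → shiftExp k i * σ ≤ -L * ν + ε := by
    intro i σ h1 h2
    by_cases h : i = k
    · rw [h, hck]
      nlinarith
    · rw [hcj h]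
      nlinarith
  have b2 : ∀ {σ : ℝ}, σ < ε → shiftExp k k * σ ≤ ε := by
    intro σ h2
    rw [hck]
    nlinarith
  have b3 : ∀ {i}, i ≠ k → ∀ {σ : ℝ}, σ < ε → -(shiftExp k i * σ) ≤ ε := by
    intro i h σ h2
    rw [hcj h]
    nlinarith
  have b4 : ∀ {σ : ℝ}, L - ε < σ → σ < ε → -(shiftExp k k * σ) ≤ -L + ε := by
    intro σ h1 h2
    rw [hck]
    nlinarith
  have main : ∀ {x y e : ℝ}, 0 ≤ x → y ≤ e → x * Real.exp e < 1 → x * Real.exp y < 1 :=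
    fun hx hy h => (mul_le_mul_of_nonneg_left (Real.exp_le_exp.2 hy) hx).trans_lt h
  have mainq : ∀ {x y e : ℝ}, 0 ≤ x → y + L ≤ e → x * Real.exp e < 1 →
      ‖q‖ * x * Real.exp y < 1 := by
    intro x y e hx hy h
    have := main hx hy h
    rwa [Real.exp_add, ← hqexp, ← mul_assoc, mul_right_comm, mul_comm x] at this
  have hLν : 0 ≤ -L * (1 - ν) := mul_nonneg (by linarith) (by linarith)
  refine HolFam.diffKernel hΩ hp0 hq0 hp hq ha0 hb0 ht0 hu0 (fun i => ?_) ?_ ?_ ?_ ?_ ?_ ?_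
  · exact (HolFam.of_continuous (continuous_torusPt i)).mul
      (HolFam.of_differentiableOn (by fun_prop))
  · exact fun i w _ x => mul_ne_zero (torusPt_ne_zero x i) (Complex.exp_ne_zero _)
  · intro i w hw x
    rw [norm_mul, hnorm]
    split_ifs with h
    · subst h
      exact main (norm_nonneg _) (b2 hw.2) hεa
    · rw [norm_mul]
      exact mainq (norm_nonneg _) (by linarith [b1 i hw.1 hw.2]) hεa
  · intro i w hw x
    rw [norm_mul, hnorm]
    split_ifs with h
    · subst h
      exact main (norm_nonneg _) (b2 hw.2) hεb
    · rw [norm_mul]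
      exact mainq (norm_nonneg _) (by linarith [b1 i hw.1 hw.2]) hεb
  · intro r i w hw x
    have h := hεt r
    rw [hκν, mul_assoc, ← Real.exp_add] at h
    rw [norm_mul, hnorm]
    exact main (norm_nonneg _) (b1 i hw.1 hw.2) h
  · intro s i w hw x
    rw [norm_div, hnorm, div_eq_mul_inv, ← Real.exp_neg]
    split_ifs with h
    · subst h
      rw [norm_mul]
      exact mainq (norm_nonneg _) (by linarith [b4 hw.1 hw.2]) (hεu s)
    · exact main (norm_nonneg _) (b3 h hw.2) (hεu s)
  · intro i j hij w hw x
    rw [norm_mul, norm_div, hnorm, hnorm, ← Real.exp_sub]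
    split_ifs with h
    · subst h
      refine main (norm_nonneg _) ?_ hεp
      rw [hck, hcj hij.symm]
      linarith [hw.2]
    · rw [norm_mul, mul_comm ‖p‖]
      refine mainq (norm_nonneg _) ?_ hεp
      by_cases hj : j = k
      · subst hj
        rw [hck, hcj h]
        linarith [hw.1]
      · rw [hcj h, hcj hj]
        linarith

/-- The integral of each term of the telescoping kernel can be taken over a shifted torus. -/
lemma integral_diffKernel_shift (hp0 : p ≠ 0) (hq0 : q ≠ 0) (hp : ‖p‖ < 1) (hq : ‖q‖ < 1)
    (ha0 : a ≠ 0) (hb0 : b ≠ 0) (ht0 : ∀ r, t r ≠ 0) (hu0 : ∀ r, u r ≠ 0) (ha : ‖a‖ < 1)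
    (hb : ‖b‖ < 1) (ht : ∀ r, ‖t r‖ ^ (n + 1) < ‖q‖) (hu : ∀ r, ‖u r‖ < 1) (k : Fin (n + 1))
    {c : ℂ} (hc : c ≠ 0) {g : (Fin (n + 1) → ℂ) → ℂ}
    (hg : g = fun z => z k * ellTheta (c * z k) p * diffKernel p q a b t u k z) :
    (Integrable fun x : Fin n → AddCircle (2 * π) => g (torusPt x)) ∧
    (Integrable fun x : Fin n → AddCircle (2 * π) =>
      g fun i => torusPt x i * Complex.exp (shiftExp k i * Complex.log q)) ∧
    ∫ x : Fin n → AddCircle (2 * π), g (torusPt x) = ∫ x : Fin n → AddCircle (2 * π),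
      g fun i => torusPt x i * Complex.exp (shiftExp k i * Complex.log q) := by
  obtain ⟨ε, hε, hd⟩ := holFam_diffKernel_shift hp0 hq0 hp hq ha0 hb0 ht0 hu0 ha hb ht hu k
  set Ω := {s : ℂ | Real.log ‖q‖ - ε < s.re ∧ s.re < ε} with hΩ
  have hO : IsOpen Ω := (isOpen_lt continuous_const Complex.continuous_re).inter
      (isOpen_lt Complex.continuous_re continuous_const)
  have hL : Real.log ‖q‖ < 0 := Real.log_neg (norm_pos_iff.2 hq0) hq
  have h0 : (0 : ℂ) ∈ Ω := ⟨by simp; linarith, by simpa using hε⟩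
  have h1 : Complex.log q ∈ Ω := by
    constructor <;> rw [Complex.log_re] <;> linarith
  have hz : HolFam Ω fun s (x : Fin n → AddCircle (2 * π)) =>
      torusPt x k * Complex.exp (shiftExp k k * s) :=
    (HolFam.of_continuous (continuous_torusPt k)).mul (HolFam.of_differentiableOn (by fun_prop))
  have hfam : HolFam Ω fun s (x : Fin n → AddCircle (2 * π)) =>
      g fun i => torusPt x i * Complex.exp (shiftExp k i * s) := by
    rw [hg]
    refine (hz.mul (HolFam.ellTheta_const hp hO ((HolFam.of_continuous continuous_const).mul hz)
      fun w _ x => ?_)).mul hd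
    exact mul_ne_zero hc (mul_ne_zero (torusPt_ne_zero x k) (Complex.exp_ne_zero _))
  have e0 : ∀ x : Fin n → AddCircle (2 * π),
      (fun i => torusPt x i * Complex.exp (shiftExp k i * 0)) = torusPt x := fun x => by simp
  have i0 := hfam.integrable (μ := volume) h0
  have s01 := integral_torusPt_shift (sum_shiftExp k) hΩ hfam h0 h1
  simp only [e0] at i0 s01
  exact ⟨i0, hfam.integrable h1, s01⟩

lemma ellTheta_ne_zero_of_norm_div (hp : ‖p‖ < 1) (hp0 : p ≠ 0) {x y : ℂ} (hx : x ≠ 0)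
    (hy : y ≠ 0) (hxy : x ≠ y) (h1 : ‖p‖ * ‖y‖ < ‖x‖) (h2 : ‖p‖ * ‖x‖ < ‖y‖) :
    ellTheta (x / y) p ≠ 0 := by
  have hx' := norm_pos_iff.2 hx
  have hy' := norm_pos_iff.2 hy
  rcases lt_trichotomy ‖x‖ ‖y‖ with h | h | h
  · refine ellTheta_ne_zero hp ?_ ?_
    · rwa [norm_div, div_lt_one hy']
    · rwa [norm_div, lt_div_iff₀ hy']
  · exact ellTheta_div_ne_zero hp hxy h hy
  · rw [ellTheta_div_comm hp0 hp hx hy]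
    refine mul_ne_zero (neg_ne_zero.2 (div_ne_zero hx hy)) (ellTheta_ne_zero hp ?_ ?_)
    · rwa [norm_div, div_lt_one hx']
    · rwa [norm_div, lt_div_iff₀ hx']

/-- The difference equation satisfied by the elliptic beta integral. -/
theorem anIntegral_difference (hp0 : p ≠ 0) (hq0 : q ≠ 0) (hp : ‖p‖ < 1) (hq : ‖q‖ < 1)
    (ha0 : a ≠ 0) (hb0 : b ≠ 0) (ht0 : ∀ r, t r ≠ 0) (hu0 : ∀ r, u r ≠ 0) (ha : ‖a‖ < 1)
    (hb : ‖b‖ < 1) (ht : ∀ r, ‖t r‖ ^ (n + 1) < ‖q‖) (hu : ∀ r, ‖u r‖ < 1)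
    (hbal : a * b * (∏ r, t r) * ∏ s, u s = p) :
    (∏ s, ellTheta (b * u s) p) * ellTheta (a * ∏ s, u s) p *
        anIntegral p q (Fin.cons (q * a) (Fin.cons b t)) u =
      (∏ s, ellTheta (a * u s) p) * ellTheta (b * ∏ s, u s) p *
        anIntegral p q (Fin.cons a (Fin.cons (q * b) t)) u := by
  by_cases hab : a = b
  · subst hab
    congr 1
    rw [← anIntegral_comp_perm (Equiv.swap 0 1)]
    congr 1
    funext i
    refine Fin.cases ?_ (fun i => Fin.cases ?_ (fun i => ?_) i) i
    · simp only [Function.comp_apply, Equiv.swap_apply_left]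
      rfl
    · have : (Fin.succ 0 : Fin (n + 2)) = 1 := rfl
      rw [Function.comp_apply, this, Equiv.swap_apply_right]
      rfl
    · have h1 : i.succ.succ ≠ (1 : Fin (n + 2)) := fun h =>
        Fin.succ_ne_zero i (Fin.succ_injective _ h)
      rw [Function.comp_apply, Equiv.swap_apply_of_ne_of_ne (Fin.succ_ne_zero _) h1]
      rfl
  set U := ∏ s, u s with hU
  have hU0 : U ≠ 0 := Finset.prod_ne_zero_iff.2 fun s _ => hu0 s
  have ht1 : ∀ r, ‖t r‖ < 1 := fun r =>
    (pow_lt_one_iff_of_nonneg (norm_nonneg _) (Nat.succ_ne_zero n)).1 ((ht r).trans hq)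
  -- comparison of `p` with `a` and `b`
  have hpab : ‖p‖ ≤ ‖a‖ * ‖b‖ := by
    have h1 : ‖∏ r, t r‖ ≤ 1 := by
      rw [norm_prod]
      exact Finset.prod_le_one (fun _ _ => norm_nonneg _) fun r _ => (ht1 r).le
    have h2 : ‖U‖ ≤ 1 := by
      rw [hU, norm_prod]
      exact Finset.prod_le_one (fun _ _ => norm_nonneg _) fun r _ => (hu r).le
    rw [← hbal, norm_mul, norm_mul, norm_mul]
    have h3 : ‖∏ r, t r‖ * ‖U‖ ≤ 1 := mul_le_one₀ h1 (norm_nonneg _) h2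
    calc _ = ‖a‖ * ‖b‖ * (‖∏ r, t r‖ * ‖U‖) := by ring
      _ ≤ ‖a‖ * ‖b‖ * 1 := mul_le_mul_of_nonneg_left h3 (by positivity)
      _ = _ := mul_one _
  have ha0' := norm_pos_iff.2 ha0
  have hb0' := norm_pos_iff.2 hb0
  have hpa : ‖p‖ < ‖a‖ := hpab.trans_lt (mul_lt_of_lt_one_right ha0' hb)
  have hpb : ‖p‖ < ‖b‖ := hpab.trans_lt (mul_lt_of_lt_one_left hb0' ha)
  have hba : ellTheta (b / a) p ≠ 0 := by
    refine ellTheta_ne_zero_of_norm_div hp hp0 hb0 ha0 (Ne.symm hab) ?_ ?_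
    · exact (mul_le_of_le_one_right (norm_nonneg _) ha.le).trans_lt hpb
    · exact (mul_le_of_le_one_right (norm_nonneg _) hb.le).trans_lt hpa
  set c := a * b * U with hc
  have hc0 : c ≠ 0 := mul_ne_zero (mul_ne_zero ha0 hb0) hU0
  set g : Fin (n + 1) → (Fin (n + 1) → ℂ) → ℂ :=
    fun k z => z k * ellTheta (c * z k) p * diffKernel p q a b t u k z with hg
  have hshift := fun k => integral_diffKernel_shift hp0 hq0 hp hq ha0 hb0 ht0 hu0 ha hb ht hu k
    hc0 (g := g k) rfl
  have hdist : ∀ᵐ x : Fin n → AddCircle (2 * π), ∀ i j, i ≠ j → torusPt x i ≠ torusPt x j :=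
    ae_all_iff.2 fun i => ae_all_iff.2 fun j => by
      by_cases h : i = j
      · exact .of_forall fun _ h' => (h' h).elim
      · filter_upwards [ae_torusPt_ne h] with x hx _ using hx
  have hzero : ∑ k, ∫ x : Fin n → AddCircle (2 * π), g k (torusPt x) = 0 := by
    rw [Finset.sum_congr rfl fun k _ => (hshift k).2.2,
      ← integral_finsetSum _ fun k _ => (hshift k).2.1]
    refine integral_eq_zero_of_ae ?_
    filter_upwards [hdist] with x hx
    set y : Fin (n + 1) → ℂ := fun i =>
      torusPt x i * Complex.exp (-(1 / (n + 1)) * Complex.log q) with hy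
    have hn : (n : ℂ) + 1 ≠ 0 := by exact_mod_cast Nat.succ_ne_zero n
    have hexp : Complex.exp (-(1 / (n + 1)) * Complex.log q) ^ (n + 1) = 1 / q := by
      rw [← Complex.exp_nat_mul]
      push_cast
      rw [← mul_assoc, mul_neg, mul_one_div, div_self hn, neg_one_mul, Complex.exp_neg,
        Complex.exp_log hq0, one_div]
    have hyn : ∀ i, ‖y i‖ = ‖Complex.exp (-(1 / (n + 1)) * Complex.log q)‖ := fun i => by simp [hy]
    have hyk : ∀ k, (fun i => torusPt x i * Complex.exp (shiftExp k i * Complex.log q)) =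
        fun i => if i = k then q * y i else y i := by
      intro k
      funext i
      rw [shiftExp]
      split_ifs with h
      · have : Complex.exp (((n : ℝ) / (n + 1) : ℝ) * Complex.log q) =
            q * Complex.exp (-(1 / (n + 1)) * Complex.log q) := by
          conv_rhs =>
            rw [← Complex.exp_log hq0, Complex.log_exp (Complex.neg_pi_lt_log_im q)
              (Complex.log_im_le_pi q), ← Complex.exp_add]
          congr 1
          push_cast
          field_simp
          ring
        rw [this, hy]
        ring
      · rw [hy]
        push_cast
        rfl
    have hyz : ∏ i, y i = 1 / q := by
      rw [hy, Finset.prod_mul_distrib, prod_torusPt, one_mul, Finset.prod_const,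
        Finset.card_univ, Fintype.card_fin, hexp]
    have hyr : ∀ r j, ‖t r * y j‖ < 1 := by
      intro r j
      refine (pow_lt_one_iff_of_nonneg (norm_nonneg _) (n := n + 1) (Nat.succ_ne_zero n)).1 ?_
      rw [norm_mul, mul_pow, hyn, ← norm_pow (Complex.exp _), hexp, norm_div, norm_one, mul_one_div,
        div_lt_one (norm_pos_iff.2 hq0)]
      exact ht r
    have hy0 : ∀ i, y i ≠ 0 := fun i => mul_ne_zero (torusPt_ne_zero x i) (Complex.exp_ne_zero _)
    have := sum_diffKernel_shift_eq_zero hp0 hq0 hp hq ht0 hbal hy0 hyn hyz hyr fun i j hij =>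
      ellTheta_div_ne_zero hp (fun h =>
        hx i j hij (mul_right_cancel₀ (Complex.exp_ne_zero _) h))
        ((hyn i).trans (hyn j).symm) (hy0 j)
    simpa [hg, hyk] using this
  have hq1 : ‖q * a‖ < 1 := by
    rw [norm_mul]
    exact mul_lt_one_of_nonneg_of_lt_one_left (norm_nonneg _) hq ha.le
  have hq2 : ‖q * b‖ < 1 := by
    rw [norm_mul]
    exact mul_lt_one_of_nonneg_of_lt_one_left (norm_nonneg _) hq hb.le
  have hI1 : Integrable fun x : Fin n → AddCircle (2 * π) =>
      anKernel p q (Fin.cons (q * a) (Fin.cons b t)) u (torusPt x) := by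
    refine integrable_anKernel hp0 hq0 hp hq ?_ hu0 ?_ hu <;>
    refine fun i => Fin.cases ?_ (fun i => Fin.cases ?_ (fun i => ?_) i) i
    exacts [mul_ne_zero hq0 ha0, hb0, ht0 i, hq1, hb, ht1 i]
  have hI2 : Integrable fun x : Fin n → AddCircle (2 * π) =>
      anKernel p q (Fin.cons a (Fin.cons (q * b) t)) u (torusPt x) := by
    refine integrable_anKernel hp0 hq0 hp hq ?_ hu0 ?_ hu <;>
    refine fun i => Fin.cases ?_ (fun i => Fin.cases ?_ (fun i => ?_) i) i
    exacts [ha0, mul_ne_zero hq0 hb0, ht0 i, ha, hq2, ht1 i]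
  rw [← sub_eq_zero, anIntegral, anIntegral, ← integral_const_mul, ← integral_const_mul,
    ← integral_sub (hI1.const_mul _) (hI2.const_mul _)]
  have hpt : ∀ᵐ x : Fin n → AddCircle (2 * π),
      (∏ s, ellTheta (b * u s) p) * ellTheta (a * U) p *
        anKernel p q (Fin.cons (q * a) (Fin.cons b t)) u (torusPt x) -
      (∏ s, ellTheta (a * u s) p) * ellTheta (b * U) p *
        anKernel p q (Fin.cons a (Fin.cons (q * b) t)) u (torusPt x) =
      -a * ellTheta (b / a) p * ∑ k, g k (torusPt x) := by
    filter_upwards [hdist] with x hx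
    set z := torusPt x with hz
    have hzn : ∀ i, ‖z i‖ = 1 := fun i => norm_torusPt x i
    have hz0 : ∀ i, z i ≠ 0 := torusPt_ne_zero x
    have hzz : ∀ i j, i ≠ j → ellTheta (z i / z j) p ≠ 0 := fun i j hij =>
      ellTheta_div_ne_zero hp (hx i j hij) ((hzn i).trans (hzn j).symm) (hz0 j)
    have haz : ∀ j, ‖a * z j‖ < 1 := fun j => by rwa [norm_mul, hzn, mul_one]
    have hbz : ∀ j, ‖b * z j‖ < 1 := fun j => by rwa [norm_mul, hzn, mul_one]
    have huz : ∀ s j, ‖u s / z j‖ < 1 := fun s j => by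
      rw [norm_div, hzn, div_one]; exact hu s
    rw [anKernel_cons_mul_left hq0 hp hq haz, anKernel_cons_mul_right hq0 hp hq hbz]
    have key := ellTheta_bracket (a := a) (b := b) hp0 hp hu0 hz0 ha0 hb0 (prod_torusPt x) hzz
      (fun i => ellTheta_ne_zero hp (haz i) (by rwa [norm_mul, hzn, mul_one]))
      (fun i => ellTheta_ne_zero hp (hbz i) (by rwa [norm_mul, hzn, mul_one])) hba
    simp only [hg, diffKernel_eq hp0 hq0 hp hq haz hbz huz hz0 hzn hzz, ← mul_assoc (_ * _) (_ / _)]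
    rw [← Finset.sum_mul, ← mul_assoc (-a * _), ← key]
    ring
  rw [integral_congr_ae hpt, integral_const_mul, integral_finsetSum _ fun k _ => (hshift k).1,
    hzero, mul_zero]

end DifferenceEquationIntegral

section Constancy

/-- A `2πi`-periodic holomorphic function on a strip that is also invariant under a translation
in the transversal direction is constant. -/
lemma eq_of_differentiableOn_strip_of_periodic {f : ℂ → ℂ} {A l : ℝ} {c : ℂ} (hc : c.re = -l)
    (hl : 0 < l) (hA : A < -l) (hf : DifferentiableOn ℂ f {w | A < w.re ∧ w.re < 0})
    (hper : Function.Periodic f (2 * π * Complex.I))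
    (hshift : ∀ w : ℂ, A + l < w.re → w.re < 0 → f (w + c) = f w) {w w' : ℂ}
    (hw : A < w.re ∧ w.re < 0) (hw' : A < w'.re ∧ w'.re < 0) : f w = f w' := by
  obtain ⟨r, hr, hr0⟩ := exists_between (max_lt (by linarith : A + l < 0) (neg_lt_zero.2 hl))
  obtain ⟨hr1, hr2⟩ := max_lt_iff.1 hr
  set K : Set ℂ := Set.Icc (r - l) r ×ℂ Set.Icc 0 (2 * π) with hK
  have hKc : IsCompact K := isCompact_Icc.reProdIm isCompact_Icc
  set S : Set ℂ := {w | A < w.re ∧ w.re < 0} with hS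
  have hstrip : ∀ B : ℝ, IsOpen {w : ℂ | B < w.re ∧ w.re < 0} ∧
      IsPreconnected {w : ℂ | B < w.re ∧ w.re < 0} := fun B =>
    ⟨(isOpen_lt continuous_const Complex.continuous_re).inter
      (isOpen_lt Complex.continuous_re continuous_const),
      ((convex_halfSpace_re_gt B).inter (convex_halfSpace_re_lt 0)).isPreconnected⟩
  have hKS : K ⊆ S := fun w hw => by
    obtain ⟨⟨h1, h2⟩, -⟩ := Complex.mem_reProdIm.1 hw
    exact ⟨by linarith, by linarith⟩
  obtain ⟨w₀, hw₀, hmax⟩ := hKc.exists_isMaxOn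
    ⟨(r : ℂ), by simp [hK, Complex.mem_reProdIm, hl.le, Real.pi_pos.le]⟩
    ((hf.continuousOn.mono hKS).norm)
  set U : Set ℂ := {w | max A (r - 2 * l) < w.re ∧ w.re < 0} with hU
  have hUS : U ⊆ S := fun w hw => ⟨(max_lt_iff.1 hw.1).1, hw.2⟩
  have hKU : K ⊆ U := fun w hw => by
    obtain ⟨⟨h1, h2⟩, -⟩ := Complex.mem_reProdIm.1 hw
    exact ⟨max_lt (by linarith) (by linarith), by linarith⟩
  have hred : ∀ w : ℂ, r - l ≤ w.re → w.re ≤ r → ‖f w‖ ≤ ‖f w₀‖ := by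
    intro w h1 h2
    have := hper.int_mul (-⌊w.im / (2 * π)⌋) w
    rw [← this]
    refine hmax (Complex.mem_reProdIm.2 ⟨?_, ?_⟩)
    · simpa using And.intro (sub_le_iff_le_add.1 h1) h2
    · have h3 := Int.floor_le (w.im / (2 * π))
      have h4 := Int.lt_floor_add_one (w.im / (2 * π))
      rw [le_div_iff₀ Real.two_pi_pos] at h3
      rw [div_lt_iff₀ Real.two_pi_pos] at h4
      simp
      constructor <;> linarith
  have hmaxU : IsMaxOn (norm ∘ f) U w₀ := by
    intro w hw
    obtain ⟨h1, h2⟩ := max_lt_iff.1 hw.1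
    have h3 := hw.2
    simp only [Set.mem_ofPred_eq, Function.comp_apply]
    rcases lt_or_ge w.re (r - l) with h | h
    · have := hshift (w - c) (by simp [hc]; linarith) (by simp [hc]; linarith)
      rw [sub_add_cancel] at this
      rw [this]
      exact hred _ (by simp [hc]; linarith) (by simp [hc]; linarith)
    · rcases le_or_gt w.re r with h' | h'
      · exact hred w h h'
      · rw [← hshift w (by linarith) h3]
        exact hred _ (by simp [hc]; linarith) (by simp [hc]; linarith)
  have hconst := Complex.eqOn_of_isPreconnected_of_isMaxOn_norm (hstrip _).2 (hstrip _).1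
    (hf.mono hUS) (hKU hw₀) hmaxU
  have han : AnalyticOnNhd ℂ f S := hf.analyticOnNhd (hstrip A).1
  have := han.eqOn_of_preconnected_of_eventuallyEq (g := fun _ => f w₀) analyticOnNhd_const
    (hstrip A).2 (hKS hw₀) (Filter.eventually_of_mem ((hstrip _).1.mem_nhds (hKU hw₀)) hconst)
  rw [this hw, this hw']

end Constancy

section BetaProduct

variable {n : ℕ} {p q : ℂ}

lemma prod_div_eq_prod_erase {ι : Type*} [Fintype ι] [DecidableEq ι] {t : ι → ℂ}
    (ht0 : ∀ r, t r ≠ 0) (r : ι) : (∏ s, t s) / t r = ∏ s ∈ Finset.univ.erase r, t s := by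
  rw [← Finset.mul_prod_erase _ _ (Finset.mem_univ r), mul_div_cancel_left₀ _ (ht0 r)]

lemma norm_prod_lt_one {ι : Type*} {s : Finset ι} {t : ι → ℂ} (hs : s.Nonempty)
    (ht : ∀ r ∈ s, ‖t r‖ < 1) : ‖∏ r ∈ s, t r‖ < 1 := by
  obtain ⟨r, hr⟩ := hs
  classical
  rw [← Finset.mul_prod_erase _ _ hr, norm_mul, norm_prod]
  exact mul_lt_one_of_nonneg_of_lt_one_left (norm_nonneg _) (ht r hr)
    (Finset.prod_le_one (fun _ _ => norm_nonneg _) fun i hi =>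
      (ht i (Finset.mem_of_mem_erase hi)).le)

lemma norm_prod_div_lt_one {t : Fin (n + 2) → ℂ} (ht0 : ∀ r, t r ≠ 0) (ht : ∀ r, ‖t r‖ < 1)
    (r : Fin (n + 2)) : ‖(∏ s, t s) / t r‖ < 1 := by
  rw [prod_div_eq_prod_erase ht0]
  refine norm_prod_lt_one ?_ fun s _ => ht s
  rw [← Finset.card_pos, Finset.card_erase_of_mem (Finset.mem_univ r)]
  simp

lemma betaProduct_ne_zero {t u : Fin (n + 2) → ℂ} (hp : ‖p‖ < 1) (hq : ‖q‖ < 1)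
    (ht0 : ∀ r, t r ≠ 0) (hu0 : ∀ r, u r ≠ 0) (ht : ∀ r, ‖t r‖ < 1) (hu : ∀ r, ‖u r‖ < 1)
    (hbal : (∏ r, t r) * ∏ r, u r = p * q) : betaProduct p q t u ≠ 0 := by
  have h1 : ‖∏ r, t r‖ < 1 := norm_prod_lt_one ⟨0, Finset.mem_univ _⟩ fun r _ => ht r
  have h2 : ‖∏ r, u r‖ < 1 := norm_prod_lt_one ⟨0, Finset.mem_univ _⟩ fun r _ => hu r
  have h3 : ∀ {t : Fin (n + 2) → ℂ} (ht0 : ∀ r, t r ≠ 0) r, ∏ s, t s = (∏ s, t s) / t r * t r :=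
    fun ht0 r => (div_mul_cancel₀ _ (ht0 r)).symm
  have h4 : ∀ {t : Fin (n + 2) → ℂ} (_ : ∀ r, t r ≠ 0), 0 < ‖∏ r, t r‖ := fun ht0 =>
    norm_pos_iff.2 (Finset.prod_ne_zero_iff.2 fun r _ => ht0 r)
  refine mul_ne_zero (Finset.prod_ne_zero_iff.2 fun r _ => Finset.prod_ne_zero_iff.2 fun s _ => ?_)
    (Finset.prod_ne_zero_iff.2 fun r _ => mul_ne_zero ?_ ?_) <;> refine ellGamma_ne_zero hp hq ?_ ?_
  · rw [norm_mul]
    exact mul_lt_one_of_nonneg_of_lt_one_left (norm_nonneg _) (ht r) (hu s).le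
  · rw [← hbal, h3 ht0 r, h3 hu0 s, mul_mul_mul_comm, norm_mul]
    refine mul_lt_of_lt_one_left (norm_pos_iff.2 (mul_ne_zero (ht0 r) (hu0 s))) ?_
    rw [norm_mul]
    exact mul_lt_one_of_nonneg_of_lt_one_left (norm_nonneg _) (norm_prod_div_lt_one ht0 ht r)
      (norm_prod_div_lt_one hu0 hu s).le
  · exact norm_prod_div_lt_one hu0 hu r
  · rw [← hbal, norm_mul, norm_div, lt_div_iff₀ (norm_pos_iff.2 (hu0 r)), mul_right_comm]
    exact mul_lt_of_lt_one_left (h4 hu0)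
      (mul_lt_one_of_nonneg_of_lt_one_left (norm_nonneg _) h1 (hu r).le)
  · exact norm_prod_div_lt_one ht0 ht r
  · rw [← hbal, norm_mul, norm_div, lt_div_iff₀ (norm_pos_iff.2 (ht0 r)), mul_assoc]
    exact mul_lt_of_lt_one_right (h4 ht0)
      (mul_lt_one_of_nonneg_of_lt_one_left (norm_nonneg _) h2 (ht r).le)

lemma differentiableOn_betaProduct {Ω : Set ℂ} (hΩ : IsOpen Ω)
    {P : ℂ → ℂ} {t u : Fin (n + 2) → ℂ → ℂ}
    (hP : DifferentiableOn ℂ P Ω) (ht : ∀ r, DifferentiableOn ℂ (t r) Ω)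
    (hu : ∀ r, DifferentiableOn ℂ (u r) Ω) (hp1 : ∀ w ∈ Ω, ‖P w‖ < 1) (hq : ‖q‖ < 1)
    (ht0 : ∀ r, ∀ w ∈ Ω, t r w ≠ 0) (hu0 : ∀ r, ∀ w ∈ Ω, u r w ≠ 0)
    (ht1 : ∀ r, ∀ w ∈ Ω, ‖t r w‖ < 1) (hu1 : ∀ r, ∀ w ∈ Ω, ‖u r w‖ < 1) :
    DifferentiableOn ℂ
      (fun w => betaProduct (P w) q (fun r => t r w) (fun r => u r w)) Ω := by
  have key : ∀ {f : ℂ → ℂ}, DifferentiableOn ℂ f Ω → (∀ w ∈ Ω, f w ≠ 0) → (∀ w ∈ Ω, ‖f w‖ < 1) →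
      HolFam (K := Unit) Ω fun w _ => ellGamma (f w) (P w) q := fun hf h0 h1 =>
    (HolFam.of_differentiableOn hf).ellGamma hΩ (HolFam.of_differentiableOn hP)
      (HolFam.of_continuous continuous_const) (fun w hw _ => hp1 w hw) (fun _ _ _ => hq)
      (fun w hw _ => h0 w hw) fun w hw _ => h1 w hw
  have aux : ∀ {t : Fin (n + 2) → ℂ → ℂ} (_ : ∀ r, DifferentiableOn ℂ (t r) Ω)
      (_ : ∀ r, ∀ w ∈ Ω, t r w ≠ 0) (_ : ∀ r, ∀ w ∈ Ω, ‖t r w‖ < 1) (r : Fin (n + 2)),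
      HolFam (K := Unit) Ω fun w _ => ellGamma ((∏ s, t s w) / t r w) (P w) q :=
    fun ht ht0 ht1 r => key
      ((DifferentiableOn.fun_finsetProd fun s _ => ht s).div (ht r) (ht0 r))
      (fun w hw => div_ne_zero (Finset.prod_ne_zero_iff.2 fun s _ => ht0 s w hw) (ht0 r w hw))
      fun w hw => norm_prod_div_lt_one (fun s => ht0 s w hw) (fun s => ht1 s w hw) r
  have : HolFam (K := Unit) Ω fun w _ => betaProduct (P w) q (fun r => t r w) fun r => u r w :=
    (HolFam.prod fun r _ => HolFam.prod fun s _ => key ((ht r).mul (hu s))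
      (fun w hw => mul_ne_zero (ht0 r w hw) (hu0 s w hw)) fun w hw => by
        rw [Pi.mul_apply, norm_mul]
        exact mul_lt_one_of_nonneg_of_lt_one_left (norm_nonneg _) (ht1 r w hw) (hu1 s w hw).le).mul
    (HolFam.prod fun r _ => (aux hu hu0 hu1 r).mul (aux ht ht0 ht1 r))
  exact this.diff ()

variable {a b : ℂ} {t : Fin n → ℂ} {u : Fin (n + 2) → ℂ}

lemma betaProduct_cons_cons (ha0 : a ≠ 0) (hb0 : b ≠ 0) :
    betaProduct p q (Fin.cons a (Fin.cons b t)) u =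
      ((∏ s, ellGamma (a * u s) p q) * ellGamma (a * ∏ r, t r) p q) *
      ((∏ s, ellGamma (b * u s) p q) * ellGamma (b * ∏ r, t r) p q) *
      ((∏ r, ∏ s, ellGamma (t r * u s) p q) * (∏ r, ellGamma ((∏ s, u s) / u r) p q) *
        ∏ r, ellGamma (a * b * (∏ s, t s) / t r) p q) := by
  rw [betaProduct, Finset.prod_mul_distrib]
  simp only [Fin.prod_univ_succ (n := n + 1), Fin.prod_univ_succ (n := n), Fin.cons_zero,
    Fin.cons_succ]
  have e1 : a * (b * ∏ i, t i) / a = b * ∏ i, t i := by field_simp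
  have e2 : a * (b * ∏ i, t i) / b = a * ∏ i, t i := by field_simp
  rw [e1, e2]
  simp only [← mul_assoc]
  ring

/-- The ratio of both sides of the beta integral evaluation is invariant under moving a factor `q`
from one parameter to another. -/
lemma anIntegral_mul_betaProduct_shift (hp0 : p ≠ 0) (hq0 : q ≠ 0) (hp : ‖p‖ < 1) (hq : ‖q‖ < 1)
    (ha0 : a ≠ 0) (hb0 : b ≠ 0) (ht0 : ∀ r, t r ≠ 0) (hu0 : ∀ r, u r ≠ 0) (ha : ‖a‖ < 1)
    (hb : ‖b‖ < 1) (ht : ∀ r, ‖t r‖ ^ (n + 1) < ‖q‖) (hu : ∀ r, ‖u r‖ < 1)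
    (hbal : a * b * (∏ r, t r) * ∏ s, u s = p) :
    anIntegral p q (Fin.cons (q * a) (Fin.cons b t)) u *
        betaProduct p q (Fin.cons a (Fin.cons (q * b) t)) u =
      anIntegral p q (Fin.cons a (Fin.cons (q * b) t)) u *
        betaProduct p q (Fin.cons (q * a) (Fin.cons b t)) u := by
  have hD := anIntegral_difference hp0 hq0 hp hq ha0 hb0 ht0 hu0 ha hb ht hu hbal
  have ht1 : ∀ r, ‖t r‖ ≤ 1 := fun r =>
    ((pow_lt_one_iff_of_nonneg (norm_nonneg _) (Nat.succ_ne_zero n)).1 ((ht r).trans hq)).le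
  have hT : ‖∏ r, t r‖ ≤ 1 := by
    rw [norm_prod]
    exact Finset.prod_le_one (fun _ _ => norm_nonneg _) fun r _ => ht1 r
  have hT0 : ∏ r, t r ≠ 0 := Finset.prod_ne_zero_iff.2 fun r _ => ht0 r
  have hU0 : ∏ r, u r ≠ 0 := Finset.prod_ne_zero_iff.2 fun r _ => hu0 r
  have hx : ∀ {x : ℂ}, ‖x‖ < 1 → (∏ s, ellGamma (q * x * u s) p q) *
      ellGamma (q * x * ∏ r, t r) p q = ((∏ s, ellTheta (x * u s) p) * ellTheta (x * ∏ r, t r) p) *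
        ((∏ s, ellGamma (x * u s) p q) * ellGamma (x * ∏ r, t r) p q) := by
    intro x hx
    have h : ∀ {y : ℂ}, ‖y‖ ≤ 1 → ellGamma (q * x * y) p q =
        ellTheta (x * y) p * ellGamma (x * y) p q := fun {y} hy => by
      rw [mul_assoc]
      refine ellGamma_mul_q_of_norm_lt_one hq0 hp hq ?_
      rw [norm_mul]
      exact mul_lt_one_of_nonneg_of_lt_one_left (norm_nonneg _) hx hy
    rw [h hT, Finset.prod_congr rfl fun s _ => h (hu s).le, Finset.prod_mul_distrib]
    ring
  have e1 : ellTheta (a * ∏ s, u s) p = ellTheta (b * ∏ r, t r) p := by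
    rw [← ellTheta_p_div hp0 _ (mul_ne_zero hb0 hT0)]
    congr 1
    rw [← hbal]
    field_simp
  have e2 : ellTheta (b * ∏ s, u s) p = ellTheta (a * ∏ r, t r) p := by
    rw [← ellTheta_p_div hp0 _ (mul_ne_zero ha0 hT0)]
    congr 1
    rw [← hbal]
    field_simp
  rw [e1, e2] at hD
  rw [betaProduct_cons_cons (mul_ne_zero hq0 ha0) hb0,
    betaProduct_cons_cons ha0 (mul_ne_zero hq0 hb0),
    hx ha, hx hb, mul_left_comm a q b, mul_assoc q a b]
  linear_combination ((∏ s, ellGamma (a * u s) p q) * ellGamma (a * ∏ r, t r) p q) *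
      ((∏ s, ellGamma (b * u s) p q) * ellGamma (b * ∏ r, t r) p q) *
      ((∏ r, ∏ s, ellGamma (t r * u s) p q) * (∏ r, ellGamma ((∏ s, u s) / u r) p q) *
        ∏ r, ellGamma (q * (a * b) * (∏ s, t s) / t r) p q) * hD

end BetaProduct

section Deformation

variable {n : ℕ} {p q P Q : ℂ} {t u : Fin n → ℂ}

lemma Fin.forall_cons_cons {α : Type*} {m : ℕ} {φ : α → Prop} {a b : α} {t : Fin m → α} (ha : φ a)
    (hb : φ b) (ht : ∀ r, φ (t r)) (r : Fin (m + 2)) :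
    φ ((Fin.cons a (Fin.cons b t) : Fin (m + 2) → α) r) :=
  Fin.cases ha (fun r => Fin.cases hb ht r) r

lemma norm_lt_one_of_pow_lt (hq : ‖q‖ < 1) {x : ℂ} (h : ‖x‖ ^ (n + 1) < ‖q‖) : ‖x‖ < 1 :=
  (pow_lt_one_iff_of_nonneg (norm_nonneg _) (Nat.succ_ne_zero n)).1 (h.trans hq)

/-- The ratio of both sides of the beta integral evaluation does not change when two parameters
are varied with fixed product. -/
lemma anIntegral_div_betaProduct_deform (hp0 : p ≠ 0) (hq0 : q ≠ 0) (hp : ‖p‖ < 1) (hq : ‖q‖ < 1)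
    (hP0 : P ≠ 0) (hPq : ‖P‖ < ‖q‖) {u : Fin (n + 2) → ℂ} (ht0 : ∀ r, t r ≠ 0)
    (hu0 : ∀ r, u r ≠ 0) (ht : ∀ r, ‖t r‖ ^ (n + 1) < ‖q‖) (hu : ∀ r, ‖u r‖ < 1)
    (hbal : P * (∏ r, t r) * ∏ s, u s = p * q) {a a' : ℂ} (ha : ‖P‖ < ‖a‖) (ha1 : ‖a‖ < 1)
    (ha' : ‖P‖ < ‖a'‖) (ha1' : ‖a'‖ < 1) :
    anIntegral p q (Fin.cons a (Fin.cons (P / a) t)) u /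
        betaProduct p q (Fin.cons a (Fin.cons (P / a) t)) u =
      anIntegral p q (Fin.cons a' (Fin.cons (P / a') t)) u /
        betaProduct p q (Fin.cons a' (Fin.cons (P / a') t)) u := by
  have hP0' := norm_pos_iff.2 hP0
  have hq0' := norm_pos_iff.2 hq0
  have ht1 : ∀ r, ‖t r‖ < 1 := fun r => norm_lt_one_of_pow_lt hq (ht r)
  set τ : Fin (n + 2) → ℂ → ℂ := fun r w =>
    (Fin.cons (Complex.exp w) (Fin.cons (P / Complex.exp w) t) : Fin (n + 2) → ℂ) r with hτ
  set f : ℂ → ℂ := fun w => anIntegral p q (fun r => τ r w) u / betaProduct p q (fun r => τ r w) u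
    with hf
  set S : Set ℂ := {w | Real.log ‖P‖ < w.re ∧ w.re < 0} with hS
  have hSo : IsOpen S := (isOpen_lt continuous_const Complex.continuous_re).inter
      (isOpen_lt Complex.continuous_re continuous_const)
  have hexp : ∀ w ∈ S, ‖P‖ < ‖Complex.exp w‖ ∧ ‖Complex.exp w‖ < 1 := fun w hw => by
    rw [Complex.norm_exp, ← Real.log_lt_iff_lt_exp hP0', Real.exp_lt_one_iff]
    exact hw
  have hτ0 : ∀ r w, τ r w ≠ 0 := fun r w =>
    Fin.forall_cons_cons (φ := fun x => x ≠ 0) (Complex.exp_ne_zero w)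
      (div_ne_zero hP0 (Complex.exp_ne_zero w)) ht0 r
  have hτ1 : ∀ r, ∀ w ∈ S, ‖τ r w‖ < 1 := fun r w hw =>
    Fin.forall_cons_cons (φ := fun x => ‖x‖ < 1) (hexp w hw).2 (norm_div_lt_one (hexp w hw).1) ht1 r
  have hτd : ∀ r, DifferentiableOn ℂ (τ r) S := by
    refine fun r => Fin.cases ?_ (fun r => Fin.cases ?_ (fun r => ?_) r) r
    · exact Complex.differentiable_exp.differentiableOn
    · exact (differentiableOn_const P).div Complex.differentiable_exp.differentiableOn
        fun w _ => Complex.exp_ne_zero w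
    · exact differentiableOn_const _
  have hτP : ∀ w, ∏ r, τ r w = P * ∏ r, t r := fun w => by
    simp only [hτ, Fin.prod_univ_succ (n := n + 1), Fin.prod_univ_succ (n := n), Fin.cons_zero,
      Fin.cons_succ, ← mul_assoc]
    rw [mul_div_cancel₀ _ (Complex.exp_ne_zero w)]
  have hR : ∀ w ∈ S, betaProduct p q (fun r => τ r w) u ≠ 0 := fun w hw =>
    betaProduct_ne_zero hp hq (fun r => hτ0 r w) hu0 (fun r => hτ1 r w hw) hu (by rw [hτP, hbal])
  have hfd : DifferentiableOn ℂ f S := by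
    refine DifferentiableOn.div ?_ ?_ hR
    · exact (HolFam.anKernel_torusPt (P := fun _ => p) (u := fun r _ => u r) hSo
        (differentiableOn_const _) hτd (fun _ => differentiableOn_const _) (fun _ _ => hp)
        (fun _ _ => hp0) hq hq0 (fun r w _ => hτ0 r w) (fun r _ _ => hu0 r) hτ1
        fun r _ _ => hu r).differentiableOn_integral hSo
    · exact differentiableOn_betaProduct (P := fun _ => p) (u := fun r _ => u r) hSo
        (differentiableOn_const _) hτd (fun _ => differentiableOn_const _) (fun _ _ => hp) hq
        (fun r w _ => hτ0 r w) (fun r _ _ => hu0 r) hτ1 fun r _ _ => hu r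
  have hper : Function.Periodic f (2 * π * Complex.I) := fun w => by
    simp only [hf, hτ, Complex.exp_periodic w]
  have hlog : Real.log ‖P‖ < Real.log ‖q‖ := Real.log_lt_log hP0' hPq
  have hlq : Real.log ‖q‖ < 0 := Real.log_neg hq0' hq
  have hshift : ∀ w : ℂ, Real.log ‖P‖ + -Real.log ‖q‖ < w.re → w.re < 0 →
      f (w + Complex.log q) = f w := by
    intro w h1 h2
    have hw : w ∈ S := ⟨by linarith, h2⟩
    have hw' : w + Complex.log q ∈ S := by
      constructor <;> rw [Complex.add_re, Complex.log_re] <;> linarith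
    have he : Complex.exp (w + Complex.log q) = q * Complex.exp w := by
      rw [Complex.exp_add, Complex.exp_log hq0, mul_comm]
    have e1 : (fun r => τ r (w + Complex.log q)) =
        Fin.cons (q * Complex.exp w) (Fin.cons (P / (q * Complex.exp w)) t) := by
      funext r
      simp only [hτ, he]
    have e2 : (fun r => τ r w) =
        Fin.cons (Complex.exp w) (Fin.cons (q * (P / (q * Complex.exp w))) t) := by
      funext r
      simp only [hτ]
      congr 3
      field_simp [Complex.exp_ne_zero w]
    have h3 : ‖P / (q * Complex.exp w)‖ < 1 := by
      rw [← he]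
      exact norm_div_lt_one (hexp _ hw').1
    simp only [hf]
    rw [div_eq_div_iff (hR _ hw') (hR _ hw), e1, e2]
    refine anIntegral_mul_betaProduct_shift hp0 hq0 hp hq (Complex.exp_ne_zero w)
      (div_ne_zero hP0 (mul_ne_zero hq0 (Complex.exp_ne_zero w))) ht0 hu0 (hexp w hw).2 h3 ht hu ?_
    have h4 : Complex.exp w * (P / (q * Complex.exp w)) = P / q := by
      field_simp [Complex.exp_ne_zero w]
    rw [h4, div_mul_eq_mul_div, div_mul_eq_mul_div, hbal, mul_div_cancel_right₀ _ hq0]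
  have hmem : ∀ {a : ℂ}, ‖P‖ < ‖a‖ → ‖a‖ < 1 → a ≠ 0 ∧
      Real.log ‖P‖ < (Complex.log a).re ∧ (Complex.log a).re < 0 := fun h1 h2 => by
    have h0 := hP0'.trans h1
    rw [Complex.log_re]
    exact ⟨norm_pos_iff.1 h0, Real.log_lt_log hP0' h1, Real.log_neg h0 h2⟩
  obtain ⟨h1, h2⟩ := hmem ha ha1
  obtain ⟨h1', h2'⟩ := hmem ha' ha1'
  have := eq_of_differentiableOn_strip_of_periodic (c := Complex.log q)
    (by rw [Complex.log_re, neg_neg])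
    (neg_pos.2 hlq) (by rwa [neg_neg]) hfd hper hshift h2 h2'
  simpa only [hf, hτ, Complex.exp_log h1, Complex.exp_log h1'] using this

lemma Fin.prod_cons_cons {m : ℕ} (a b : ℂ) (t : Fin m → ℂ) :
    ∏ r, (Fin.cons a (Fin.cons b t) : Fin (m + 2) → ℂ) r = a * b * ∏ r, t r := by
  simp only [Fin.prod_univ_succ (n := m + 1), Fin.prod_univ_succ (n := m), Fin.cons_zero,
    Fin.cons_succ, ← mul_assoc]

/-- Two pairs of parameters can be moved to `(a, P / a)` and `(b, Q / b)`. -/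
lemma anIntegral_div_betaProduct_deform_pair (hp0 : p ≠ 0) (hq0 : q ≠ 0) (hp : ‖p‖ < 1)
    (hq : ‖q‖ < 1) {t₀ t₁ u₀ u₁ : ℂ} (ht₀0 : t₀ ≠ 0) (ht₁0 : t₁ ≠ 0) (hu₀0 : u₀ ≠ 0) (hu₁0 : u₁ ≠ 0)
    (ht₀ : ‖t₀‖ < 1) (ht₁ : ‖t₁‖ < 1) (hu₀ : ‖u₀‖ < 1) (hu₁ : ‖u₁‖ < 1)
    (hPq : ‖t₀ * t₁‖ < ‖q‖) (hQq : ‖u₀ * u₁‖ < ‖q‖) (ht0 : ∀ r, t r ≠ 0)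
    (hu0 : ∀ r, u r ≠ 0) (ht : ∀ r, ‖t r‖ ^ (n + 1) < ‖q‖) (hu : ∀ r, ‖u r‖ ^ (n + 1) < ‖q‖)
    (hbal : t₀ * t₁ * (∏ r, t r) * (u₀ * u₁ * ∏ s, u s) = p * q) {a b : ℂ}
    (ha : ‖t₀ * t₁‖ < ‖a‖) (ha1 : ‖a‖ < 1) (hb : ‖u₀ * u₁‖ < ‖b‖) (hb1 : ‖b‖ < 1) :
    anIntegral p q (Fin.cons t₀ (Fin.cons t₁ t)) (Fin.cons u₀ (Fin.cons u₁ u)) /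
        betaProduct p q (Fin.cons t₀ (Fin.cons t₁ t)) (Fin.cons u₀ (Fin.cons u₁ u)) =
      anIntegral p q (Fin.cons a (Fin.cons (t₀ * t₁ / a) t))
          (Fin.cons b (Fin.cons (u₀ * u₁ / b) u)) /
        betaProduct p q (Fin.cons a (Fin.cons (t₀ * t₁ / a) t))
          (Fin.cons b (Fin.cons (u₀ * u₁ / b) u)) := by
  have h1 := fun r => norm_lt_one_of_pow_lt hq (ht r)
  have h2 := fun r => norm_lt_one_of_pow_lt hq (hu r)
  have ha0 : a ≠ 0 := norm_pos_iff.1 ((norm_nonneg _).trans_lt ha)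
  have hlt : ∀ {x y : ℂ}, x ≠ 0 → ‖y‖ < 1 → ‖x * y‖ < ‖x‖ := fun hx hy => by
    rw [norm_mul]
    exact mul_lt_of_lt_one_right (norm_pos_iff.2 hx) hy
  have e1 := anIntegral_div_betaProduct_deform (u := Fin.cons u₀ (Fin.cons u₁ u)) hp0 hq0 hp hq
    (mul_ne_zero ht₀0 ht₁0) hPq ht0
    (Fin.forall_cons_cons (φ := fun x => x ≠ 0) hu₀0 hu₁0 hu0) ht
    (Fin.forall_cons_cons (φ := fun x => ‖x‖ < 1) hu₀ hu₁ h2)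
    (by rw [Fin.prod_cons_cons]; exact hbal) (hlt ht₀0 ht₁) ht₀ ha ha1
  have e2 := anIntegral_div_betaProduct_deform (u := Fin.cons a (Fin.cons (t₀ * t₁ / a) t))
    hp0 hq0 hp hq (mul_ne_zero hu₀0 hu₁0) hQq hu0
    (Fin.forall_cons_cons (φ := fun x => x ≠ 0) ha0 (div_ne_zero (mul_ne_zero ht₀0 ht₁0) ha0) ht0)
    hu
    (Fin.forall_cons_cons (φ := fun x => ‖x‖ < 1) ha1 (norm_div_lt_one ha) h1)
    (by rw [Fin.prod_cons_cons, mul_div_cancel₀ _ ha0, mul_comm]; exact hbal) (hlt hu₀0 hu₁) hu₀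
    hb hb1
  rw [mul_div_cancel_left₀ _ ht₀0] at e1
  rw [mul_div_cancel_left₀ _ hu₀0, anIntegral_symm, betaProduct_symm,
    anIntegral_symm (t := Fin.cons b _), betaProduct_symm (t := Fin.cons b _)] at e2
  rw [e1, e2]

end Deformation

section PartialFractions

variable {ι : Type*} [Fintype ι] [DecidableEq ι]

lemma prod_one_sub_mul_inv_eq_sum {x : ι → ℂ} (hx : Function.Injective x) (hx0 : ∀ i, x i ≠ 0)
    [Nonempty ι] {ρ : ℂ} (hρ : ∀ i, 1 - ρ * x i ≠ 0) :
    (∏ i, (1 - ρ * x i))⁻¹ =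
      ∑ l, (1 - ρ * x l)⁻¹ * ∏ j ∈ Finset.univ.erase l, (1 - x j / x l)⁻¹ := by
  have hv : Set.InjOn (fun i => (x i)⁻¹) (Finset.univ : Finset ι) :=
    fun i _ j _ h => hx (inv_injective h)
  have h := congrArg (Polynomial.eval ρ) (Lagrange.sum_basis hv Finset.univ_nonempty)
  rw [Polynomial.eval_finsetSum, Polynomial.eval_one] at h
  rw [inv_eq_one_div, div_eq_iff (Finset.prod_ne_zero_iff.2 fun i _ => hρ i), Finset.sum_mul]
  refine h.symm.trans ?_
  refine Finset.sum_congr rfl fun l _ => ?_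
  rw [Lagrange.basis, Polynomial.eval_prod, ← Finset.mul_prod_erase _ _ (Finset.mem_univ l),
    mul_mul_mul_comm, inv_mul_cancel₀ (hρ l), one_mul, ← Finset.prod_mul_distrib]
  refine Finset.prod_congr rfl fun j hj => ?_
  have hjl : x l - x j ≠ 0 := sub_ne_zero.2 fun h => Finset.ne_of_mem_erase hj (hx h.symm)
  have h1 : (x l)⁻¹ - (x j)⁻¹ ≠ 0 :=
    sub_ne_zero.2 fun h => hjl (sub_eq_zero.2 (inv_injective h))
  have h2 : 1 - x j / x l ≠ 0 := by
    rw [one_sub_div (hx0 l)]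
    exact div_ne_zero hjl (hx0 l)
  rw [Lagrange.basisDivisor, Polynomial.eval_mul, Polynomial.eval_C, Polynomial.eval_sub,
    Polynomial.eval_X, Polynomial.eval_C]
  have hl := hx0 l
  have hj := hx0 j
  rw [inv_mul_eq_iff_eq_mul₀ h1, inv_mul_eq_div, mul_div_assoc', eq_div_iff h2]
  field_simp
  ring

/-- The coefficient of `((1 - ρ / z k) * (1 - ρ * z l))⁻¹` in the partial fraction expansion of
`∏ i, ∏ j ≠ i, (1 - z i / z j) / ∏ i, (1 - ρ / z i) * (1 - ρ * z i)`. -/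
noncomputable def pinchCoeff (k l : ι) (z : ι → ℂ) : ℂ :=
  (if k = l then 1 else -(z l / z k)) *
    ∏ i, ∏ j, if i = j ∨ i = k ∨ j = l ∨ (i = l ∧ j = k) then 1 else 1 - z i / z j

lemma prod_erase_one_sub_div_eq {z : ι → ℂ} (hz : Function.Injective z) (hz0 : ∀ i, z i ≠ 0)
    (k l : ι) :
    (∏ i, ∏ j ∈ Finset.univ.erase i, (1 - z i / z j)) *
        ((∏ j ∈ Finset.univ.erase k, (1 - z k / z j)⁻¹) *
          ∏ i ∈ Finset.univ.erase l, (1 - z i / z l)⁻¹) = pinchCoeff k l z := by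
  set f : ι → ι → ℂ := fun i j => if i = j then 1 else 1 - z i / z j with hf
  have hf0 : ∀ i j, f i j ≠ 0 := by
    intro i j
    simp only [hf]
    split_ifs with h
    · exact one_ne_zero
    · rw [one_sub_div (hz0 j)]
      exact div_ne_zero (sub_ne_zero.2 fun h' => h (hz h').symm) (hz0 j)
  have hfk : ∀ i, f i i = 1 := fun i => by simp [hf]
  have hD : ∀ i, ∏ j ∈ Finset.univ.erase i, (1 - z i / z j) = ∏ j, f i j := by
    intro i
    rw [← Finset.mul_prod_erase _ _ (Finset.mem_univ i), hfk, one_mul]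
    exact Finset.prod_congr rfl fun j hj => by
      rw [hf]; exact (if_neg (Finset.ne_of_mem_erase hj).symm).symm
  have hB : ∏ i ∈ Finset.univ.erase l, (1 - z i / z l) = ∏ i, f i l := by
    rw [← Finset.mul_prod_erase _ _ (Finset.mem_univ l), hfk, one_mul]
    exact Finset.prod_congr rfl fun j hj => by
      rw [hf]; exact (if_neg (Finset.ne_of_mem_erase hj)).symm
  have hc : (if k = l then 1 else -(z l / z k)) = f l k / f k l := by
    rcases eq_or_ne k l with rfl | h
    · simp [hf]
    · have h1 : z k - z l ≠ 0 := sub_ne_zero.2 fun h' => h (hz h')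
      have h2 : z l - z k ≠ 0 := sub_ne_zero.2 fun h' => h (hz h').symm
      have hk := hz0 k
      have hl := hz0 l
      simp only [hf, h, h.symm, if_false]
      rw [one_sub_div hk, one_sub_div hl]
      field_simp
      ring
  have hpt : ∀ i j, f i j =
      (if i = j ∨ i = k ∨ j = l ∨ (i = l ∧ j = k) then 1 else 1 - z i / z j) *
        (if i = k then f k j else 1) * (if j = l then f i l else 1) *
        (if i = l then if j = k then f l k else 1 else 1) *
        (if i = k then if j = l then (f k l)⁻¹ else 1 else 1) := by
    intro i j
    by_cases h1 : i = k <;> by_cases h2 : j = l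
    · subst h1 h2
      have : (if i = j then if j = i then f j i else 1 else 1) = 1 := by
        split_ifs with h <;> simp [h, hfk]
      simp [this, hf0 i j]
    · subst h1
      have : (if i = l then if j = i then f l i else 1 else 1) = 1 := by
        split_ifs with h h' <;> simp_all
      simp [h2, this]
    · subst h2
      have : (if i = j then if j = k then f j k else 1 else 1) = 1 := by
        split_ifs with h h' <;> simp_all
      simp [h1, this]
    · simp only [h1, h2, if_false, mul_one, false_or]
      by_cases h3 : i = l ∧ j = k
      · simp [h3]
      · simp only [h3, or_false]
        have : (if i = l then if j = k then f l k else 1 else 1) = 1 := by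
          split_ifs with h h' <;> simp_all
        rw [this]
        simp [hf]
  have hprod : ∏ i, ∏ j, f i j =
      (∏ i, ∏ j, if i = j ∨ i = k ∨ j = l ∨ (i = l ∧ j = k) then 1 else 1 - z i / z j) *
        (∏ j, f k j) * (∏ i, f i l) * f l k * (f k l)⁻¹ := by
    conv_lhs => enter [2, i, 2, j]; rw [hpt]
    simp only [Finset.prod_mul_distrib]
    congr 1
    · congr 1
      · congr 1
        · congr 1
          rw [Finset.prod_comm]
          simp
        · simp
      · have : ∀ i, ∏ j, (if i = l then if j = k then f l k else 1 else 1) =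
            if i = l then f l k else 1 := fun i => by split_ifs <;> simp
        simp [this]
    · have : ∀ i, ∏ j, (if i = k then if j = l then (f k l)⁻¹ else 1 else 1) =
          if i = k then (f k l)⁻¹ else 1 := fun i => by split_ifs <;> simp
      simp [this]
  rw [Finset.prod_inv_distrib, Finset.prod_inv_distrib, hD, hB]
  simp only [hD]
  rw [hprod, pinchCoeff, hc]
  have h1 : ∏ j, f k j ≠ 0 := Finset.prod_ne_zero_iff.2 fun j _ => hf0 k j
  have h2 : ∏ i, f i l ≠ 0 := Finset.prod_ne_zero_iff.2 fun j _ => hf0 j l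
  field_simp

lemma prod_one_sub_div_partial_fractions [Nonempty ι] {z : ι → ℂ} (hz : Function.Injective z)
    (hz0 : ∀ i, z i ≠ 0) {ρ : ℂ} (h1 : ∀ i, 1 - ρ * z i ≠ 0) (h2 : ∀ i, 1 - ρ / z i ≠ 0) :
    (∏ i, ∏ j ∈ Finset.univ.erase i, (1 - z i / z j)) /
        ∏ i, ((1 - ρ * z i) * (1 - ρ / z i)) =
      ∑ k, ∑ l, pinchCoeff k l z * ((1 - ρ / z k)⁻¹ * (1 - ρ * z l)⁻¹) := by
  have e1 := prod_one_sub_mul_inv_eq_sum (x := z) hz hz0 h1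
  have e2 := prod_one_sub_mul_inv_eq_sum (x := fun i => (z i)⁻¹)
    (fun i j h => hz (inv_injective h)) (fun i => inv_ne_zero (hz0 i)) (ρ := ρ)
    (fun i => by simpa only [div_eq_mul_inv] using h2 i)
  simp only [← div_eq_mul_inv, inv_div_inv] at e2
  rw [Finset.prod_mul_distrib, div_eq_mul_inv, mul_inv, mul_comm (∏ i, (1 - ρ * z i))⁻¹, e1, e2,
    Finset.sum_mul_sum, Finset.mul_sum]
  refine Finset.sum_congr rfl fun k _ => ?_
  rw [Finset.mul_sum]
  refine Finset.sum_congr rfl fun l _ => ?_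
  rw [← prod_erase_one_sub_div_eq hz hz0]
  ring

lemma pinchCoeff_comp_perm (σ : Equiv.Perm ι) (k : ι) (z : ι → ℂ) :
    pinchCoeff k k (z ∘ σ) = pinchCoeff (σ k) (σ k) z := by
  simp only [pinchCoeff, if_true, one_mul, Function.comp_apply]
  refine ((Equiv.prod_comp σ _).symm.trans (Finset.prod_congr rfl fun i _ => ?_)).symm
  refine (Equiv.prod_comp σ _).symm.trans (Finset.prod_congr rfl fun j _ => ?_)
  simp only [σ.injective.eq_iff]

lemma HolFam.pinchCoeff {K : Type*} [TopologicalSpace K] {Ω : Set ℂ} (k l : ι)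
    {z : ι → ℂ → K → ℂ} (hz : ∀ i, HolFam Ω (z i)) (hz0 : ∀ i, ∀ w ∈ Ω, ∀ x, z i w x ≠ 0) :
    HolFam Ω fun w x => pinchCoeff k l fun i => z i w x := by
  have h1 : ∀ i j, HolFam Ω fun w x => z i w x / z j w x := fun i j => (hz i).div (hz j) (hz0 j)
  refine HolFam.mul ?_ (HolFam.prod fun i _ => HolFam.prod fun j _ => ?_)
  · split_ifs
    · exact of_continuous continuous_const
    · exact ⟨(h1 l k).cont.neg, fun x => ((h1 l k).diff x).neg⟩
  · split_ifs
    · exact of_continuous continuous_const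
    · exact ⟨continuousOn_const.sub (h1 i j).cont,
        fun x => (differentiableOn_const _).sub ((h1 i j).diff x)⟩

end PartialFractions

section Pinching

variable {n : ℕ} {p q : ℂ}

/-- The elliptic Gamma function with its pole at `x = 1` removed:
`ellGamma x p q = gammaReg x p q / (1 - x)`. -/
noncomputable def gammaReg (x p q : ℂ) : ℂ :=
  dblPoch (p * q / x) p q / (infPoch (p * x) p * dblPoch (q * x) p q)

lemma ellGamma_eq_gammaReg_div (hp : ‖p‖ < 1) (hq : ‖q‖ < 1) (x : ℂ) :
    ellGamma x p q = gammaReg x p q / (1 - x) := by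
  rw [ellGamma_eq hp hq, dblPoch_eq_mul hp hq x, infPoch_eq_mul hp x, gammaReg, div_div]
  ring

lemma gammaReg_ne_zero (hp : ‖p‖ < 1) (hq : ‖q‖ < 1) {x : ℂ} (hx : ‖x‖ = 1) :
    gammaReg x p q ≠ 0 := by
  refine div_ne_zero (dblPoch_ne_zero_of_norm_lt_one hp hq ?_)
    (mul_ne_zero (infPoch_ne_zero_of_norm_lt_one hp ?_)
      (dblPoch_ne_zero_of_norm_lt_one hp hq ?_))
  · rw [norm_div, hx, div_one, norm_mul]
    exact mul_lt_one_of_nonneg_of_lt_one_left (norm_nonneg _) hp hq.le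
  · rwa [norm_mul, hx, mul_one]
  · rwa [norm_mul, hx, mul_one]

lemma ellGamma_mul_div_eq (hp0 : p ≠ 0) (hq0 : q ≠ 0) (hp : ‖p‖ < 1) (hq : ‖q‖ < 1) {a b : ℂ}
    (ha : a ≠ 0) (hb : b ≠ 0) :
    ellGamma (p * q * (b / a)) p q = (gammaReg (a / b) p q)⁻¹ * (1 - a / b) := by
  have := ellGamma_reflect hp0 hq0 hp hq _ (div_ne_zero ha hb)
  rw [ellGamma_eq_gammaReg_div hp hq (a / b), inv_div, div_div_eq_mul_div,
    mul_div_assoc] at this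
  rw [this, div_eq_inv_mul]

lemma gammaReg_one (hp : ‖p‖ < 1) (hq : ‖q‖ < 1) :
    gammaReg 1 p q = (qPoch p * qPoch q)⁻¹ := by
  have hpq : ‖q * p‖ < 1 := by
    rw [norm_mul]; exact mul_lt_one_of_nonneg_of_lt_one_left (norm_nonneg _) hq hp.le
  have h := dblPoch_ne_zero_of_norm_lt_one hp hq hpq
  have h2 : dblPoch q p q = infPoch q q * dblPoch (q * p) p q := by
    rw [dblPoch_comm, dblPoch_eq_mul hq hp, dblPoch_comm (p * q), mul_comm p q]
  rw [gammaReg, mul_one, mul_one, div_one, h2, qPoch_eq, qPoch_eq, mul_comm p q, ← mul_assoc,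
    div_mul_cancel_right₀ h]

namespace HolFam

variable {K : Type*} [TopologicalSpace K] {Ω : Set ℂ} {f : ℂ → K → ℂ}

lemma gammaReg (hp : ‖p‖ < 1) (hq : ‖q‖ < 1) (hΩ : IsOpen Ω) (hf : HolFam Ω f)
    (hf0 : ∀ w ∈ Ω, ∀ x, f w x ≠ 0) (hfp : ∀ w ∈ Ω, ∀ x, ‖p * f w x‖ < 1)
    (hfq : ∀ w ∈ Ω, ∀ x, ‖q * f w x‖ < 1) :
    HolFam Ω fun w x => gammaReg (f w x) p q := by
  have HP : HolFam (K := K) Ω fun _ _ => p := of_continuous continuous_const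
  have HQ : HolFam (K := K) Ω fun _ _ => q := of_continuous continuous_const
  have H0 : HolFam (K := K) Ω fun _ _ => (0 : ℂ) := of_continuous continuous_const
  refine ((((HP.mul HQ).div hf hf0).dblPoch hΩ HP HQ (fun _ _ _ => hp) (fun _ _ _ => hq)).div
    (((HP.mul hf).dblPoch hΩ HP H0 (fun _ _ _ => hp) (by simp)).mul
      ((HQ.mul hf).dblPoch hΩ HP HQ (fun _ _ _ => hp) (fun _ _ _ => hq))) ?_).congr ?_
  · intro w hw x
    exact mul_ne_zero (dblPoch_ne_zero_of_norm_lt_one hp (by simp) (hfp w hw x))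
      (dblPoch_ne_zero_of_norm_lt_one hp hq (hfq w hw x))
  · intro w hw x
    simp only [dblPoch_zero_right _ p hp, _root_.gammaReg]

lemma gammaReg_inv (hp : ‖p‖ < 1) (hq : ‖q‖ < 1) (hΩ : IsOpen Ω) (hf : HolFam Ω f)
    (hf0 : ∀ w ∈ Ω, ∀ x, f w x ≠ 0) (hf1 : ∀ w ∈ Ω, ∀ x, ‖p * q / f w x‖ < 1) :
    HolFam Ω fun w x => (_root_.gammaReg (f w x) p q)⁻¹ := by
  have HP : HolFam (K := K) Ω fun _ _ => p := of_continuous continuous_const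
  have HQ : HolFam (K := K) Ω fun _ _ => q := of_continuous continuous_const
  have H0 : HolFam (K := K) Ω fun _ _ => (0 : ℂ) := of_continuous continuous_const
  refine HolFam.congr ((((HP.mul hf).dblPoch hΩ HP H0 (fun _ _ _ => hp) (by simp)).mul
      ((HQ.mul hf).dblPoch hΩ HP HQ (fun _ _ _ => hp) (fun _ _ _ => hq))).div
    (((HP.mul HQ).div hf hf0).dblPoch hΩ HP HQ (fun _ _ _ => hp) (fun _ _ _ => hq)) ?_) ?_
  · intro w hw x
    exact dblPoch_ne_zero_of_norm_lt_one hp hq (hf1 w hw x)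
  · intro w hw x
    simp only [dblPoch_zero_right _ p hp, _root_.gammaReg, inv_div]

end HolFam

/-- The part of `anKernel p q (Fin.cons ρ t) (Fin.cons ρ u)` that is regular at `ρ = 1`. -/
noncomputable def pinchReg (p q ρ : ℂ) (t u : Fin (n + 1) → ℂ) (z : Fin (n + 1) → ℂ) : ℂ :=
  (∏ i, (gammaReg (ρ * z i) p q * gammaReg (ρ / z i) p q *
      ∏ r, ellGamma (t r * z i) p q * ellGamma (u r / z i) p q)) *
    ∏ i, ∏ j ∈ Finset.univ.erase i, (gammaReg (z i / z j) p q)⁻¹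

lemma prod_prod_erase_comm {ι : Type*} [Fintype ι] [DecidableEq ι] (f : ι → ι → ℂ) :
    ∏ i, ∏ j ∈ Finset.univ.erase i, f i j = ∏ i, ∏ j ∈ Finset.univ.erase i, f j i :=
  Finset.prod_comm' fun i j => by simp [eq_comm]

lemma pinchReg_comp_perm (σ : Equiv.Perm (Fin (n + 1))) (ρ : ℂ) (t u z : Fin (n + 1) → ℂ) :
    pinchReg p q ρ t u (z ∘ σ) = pinchReg p q ρ t u z := by
  unfold pinchReg
  congr 1
  · exact Equiv.prod_comp σ fun i => gammaReg (ρ * z i) p q * gammaReg (ρ / z i) p q *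
      ∏ r, ellGamma (t r * z i) p q * ellGamma (u r / z i) p q
  · refine Eq.trans ?_ (Equiv.prod_comp σ fun i => ∏ j ∈ Finset.univ.erase i,
      (gammaReg (z i / z j) p q)⁻¹)
    refine Finset.prod_congr rfl fun i _ => ?_
    refine Finset.prod_equiv σ (fun j => ?_) fun j _ => rfl
    simp

lemma anKernel_cons_eq (hp0 : p ≠ 0) (hq0 : q ≠ 0) (hp : ‖p‖ < 1) (hq : ‖q‖ < 1) (ρ : ℂ)
    (t u : Fin (n + 1) → ℂ) {z : Fin (n + 1) → ℂ} (hz : ∀ i, z i ≠ 0) :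
    anKernel p q (Fin.cons ρ t) (Fin.cons ρ u) z = pinchReg p q ρ t u z *
      ((∏ i, ∏ j ∈ Finset.univ.erase i, (1 - z i / z j)) /
        ∏ i, ((1 - ρ * z i) * (1 - ρ / z i))) := by
  have h2 : ∀ i, ellGamma (ρ * z i) p q * ellGamma (ρ / z i) p q =
      gammaReg (ρ * z i) p q * gammaReg (ρ / z i) p q * ((1 - ρ * z i) * (1 - ρ / z i))⁻¹ := by
    intro i
    rw [ellGamma_eq_gammaReg_div hp hq, ellGamma_eq_gammaReg_div hp hq, mul_inv]
    ring
  rw [anKernel, prod_prod_erase_comm, pinchReg]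
  simp only [ellGamma_mul_div_eq hp0 hq0 hp hq (hz _) (hz _), Fin.prod_univ_succ (n := n + 1),
    Fin.cons_zero, Fin.cons_succ, h2,
    Finset.prod_mul_distrib, Finset.prod_inv_distrib]
  ring

lemma anKernel_cons_eq_sum (hp0 : p ≠ 0) (hq0 : q ≠ 0) (hp : ‖p‖ < 1) (hq : ‖q‖ < 1) {ρ : ℂ}
    (hρ : ‖ρ‖ < 1) (t u : Fin (n + 1) → ℂ) {z : Fin (n + 1) → ℂ} (hz : ∀ i, ‖z i‖ = 1)
    (hinj : Function.Injective z) :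
    anKernel p q (Fin.cons ρ t) (Fin.cons ρ u) z =
      ∑ k, ∑ l, pinchReg p q ρ t u z * pinchCoeff k l z *
        ((1 - ρ / z k)⁻¹ * (1 - ρ * z l)⁻¹) := by
  have hz0 : ∀ i, z i ≠ 0 := fun i => norm_pos_iff.1 (by rw [hz]; exact one_pos)
  have key : ∀ x : ℂ, ‖x‖ < 1 → 1 - x ≠ 0 := fun x hx h => by
    rw [← sub_eq_zero.1 h] at hx
    simp at hx
  rw [anKernel_cons_eq hp0 hq0 hp hq ρ t u hz0, prod_one_sub_div_partial_fractions hinj hz0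
    (fun i => key _ (by simpa [hz] using hρ)) (fun i => key _ (by simpa [hz] using hρ)),
    Finset.mul_sum]
  refine Finset.sum_congr rfl fun k _ => ?_
  rw [Finset.mul_sum]
  exact Finset.sum_congr rfl fun l _ => (mul_assoc _ _ _).symm

lemma HolFam.pinchReg {K : Type*} [TopologicalSpace K] {Ω : Set ℂ} (hΩ : IsOpen Ω)
    {W : ℂ → ℂ} {t u : Fin (n + 1) → ℂ → ℂ} {z : Fin (n + 1) → ℂ → K → ℂ} {R : ℝ}
    (hp : ‖p‖ < 1) (hq : ‖q‖ < 1)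
    (hpR : ‖p‖ * (R * R) < 1) (hqR : ‖q‖ * (R * R) < 1)
    (hW : DifferentiableOn ℂ W Ω) (ht : ∀ r, DifferentiableOn ℂ (t r) Ω)
    (hu : ∀ r, DifferentiableOn ℂ (u r) Ω) (hz : ∀ i, HolFam Ω (z i))
    (hW0 : ∀ w ∈ Ω, W w ≠ 0) (ht0 : ∀ r, ∀ w ∈ Ω, t r w ≠ 0) (hu0 : ∀ r, ∀ w ∈ Ω, u r w ≠ 0)
    (hz0 : ∀ i, ∀ w ∈ Ω, ∀ x, z i w x ≠ 0)
    (hW1 : ∀ w ∈ Ω, ‖W w‖ < R) (ht1 : ∀ r, ∀ w ∈ Ω, ‖t r w‖ * R < 1)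
    (hu1 : ∀ r, ∀ w ∈ Ω, ‖u r w‖ * R < 1)
    (hz1 : ∀ i, ∀ w ∈ Ω, ∀ x, ‖z i w x‖ < R) (hz2 : ∀ i, ∀ w ∈ Ω, ∀ x, ‖z i w x‖⁻¹ < R) :
    HolFam Ω fun w x => pinchReg p q (W w) (fun r => t r w) (fun r => u r w) fun i => z i w x := by
  have HP : HolFam (K := K) Ω fun _ _ => p := of_continuous continuous_const
  have HQ : HolFam (K := K) Ω fun _ _ => q := of_continuous continuous_const
  have HW : HolFam (K := K) Ω fun w _ => W w := of_differentiableOn hW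
  have HT : ∀ r, HolFam (K := K) Ω fun w _ => t r w := fun r => of_differentiableOn (ht r)
  have HU : ∀ r, HolFam (K := K) Ω fun w _ => u r w := fun r => of_differentiableOn (hu r)
  have key : ∀ {a b c : ℂ}, ‖a‖ * (R * R) < 1 → ‖b‖ < R → ‖c‖ < R → ‖a * (b * c)‖ < 1 := by
    intro a b c ha hb hc
    rw [norm_mul, norm_mul]
    exact (mul_le_mul_of_nonneg_left (mul_le_mul hb.le hc.le (norm_nonneg _)
      ((norm_nonneg _).trans hb.le)) (norm_nonneg _)).trans_lt ha
  have key2 : ∀ {a c : ℂ}, ‖a‖ * R < 1 → ‖c‖ < R → ‖a * c‖ < 1 := by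
    intro a c ha hc
    rw [norm_mul]
    exact (mul_le_mul_of_nonneg_left hc.le (norm_nonneg _)).trans_lt ha
  refine HolFam.mul (HolFam.prod fun i _ => HolFam.mul (HolFam.mul ?_ ?_)
      (HolFam.prod fun r _ => HolFam.mul ?_ ?_))
    (HolFam.prod fun i _ => HolFam.prod fun j _ => ?_)
  · exact gammaReg hp hq hΩ (HW.mul (hz i)) (fun w hw x => mul_ne_zero (hW0 w hw) (hz0 i w hw x))
      (fun w hw x => key hpR (hW1 w hw) (hz1 i w hw x))
      (fun w hw x => key hqR (hW1 w hw) (hz1 i w hw x))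
  · refine gammaReg hp hq hΩ (HW.div (hz i) (hz0 i))
      (fun w hw x => div_ne_zero (hW0 w hw) (hz0 i w hw x)) (fun w hw x => ?_) (fun w hw x => ?_)
    · rw [div_eq_mul_inv]
      exact key hpR (hW1 w hw) (by rw [norm_inv]; exact hz2 i w hw x)
    · rw [div_eq_mul_inv]
      exact key hqR (hW1 w hw) (by rw [norm_inv]; exact hz2 i w hw x)
  · exact ellGamma_const hp hq hΩ ((HT r).mul (hz i))
      (fun w hw x => mul_ne_zero (ht0 r w hw) (hz0 i w hw x))
      (fun w hw x => key2 (ht1 r w hw) (hz1 i w hw x))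
  · refine ellGamma_const hp hq hΩ ((HU r).div (hz i) (hz0 i))
      (fun w hw x => div_ne_zero (hu0 r w hw) (hz0 i w hw x)) (fun w hw x => ?_)
    rw [div_eq_mul_inv]
    exact key2 (hu1 r w hw) (by rw [norm_inv]; exact hz2 i w hw x)
  · refine gammaReg_inv hp hq hΩ ((hz i).div (hz j) (hz0 j))
      (fun w hw x => div_ne_zero (hz0 i w hw x) (hz0 j w hw x)) (fun w hw x => ?_)
    have h : p * q / (z i w x / z j w x) = (p * q) * ((z i w x)⁻¹ * z j w x) := by
      rw [div_div_eq_mul_div, mul_comm (z i w x)⁻¹, div_eq_mul_inv, mul_assoc]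
    rw [h]
    refine key ?_ (by rw [norm_inv]; exact hz2 i w hw x) (hz1 j w hw x)
    rw [norm_mul, mul_right_comm, mul_comm]
    exact mul_lt_one_of_nonneg_of_lt_one_left (norm_nonneg _) hq hpR.le

end Pinching

section PoissonLimit

open Filter Topology

/-- The Poisson kernel of the unit disc, as a function of the angle. -/
noncomputable def circlePoisson (ρ : ℝ) (a : AddCircle (2 * π)) : ℝ :=
  poissonKernel 0 ρ a.toCircle

lemma circlePoisson_eq (ρ : ℝ) (a : AddCircle (2 * π)) :
    circlePoisson ρ a = (1 - ρ ^ 2) / ‖(a.toCircle : ℂ) - ρ‖ ^ 2 := by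
  rw [circlePoisson, poissonKernel_def, sub_zero, sub_zero, Circle.norm_coe, one_pow,
    Complex.norm_real, Real.norm_eq_abs, sq_abs]

lemma ofReal_circlePoisson (ρ : ℝ) (a : AddCircle (2 * π)) :
    (circlePoisson ρ a : ℂ) =
      (1 - (ρ : ℂ) ^ 2) * ((1 - ρ / (a.toCircle : ℂ))⁻¹ * (1 - ρ * (a.toCircle : ℂ))⁻¹) := by
  have hz : (a.toCircle : ℂ) ≠ 0 := Circle.coe_ne_zero _
  have h1 : ‖(a.toCircle : ℂ) - ρ‖ = ‖1 - ρ / (a.toCircle : ℂ)‖ := by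
    rw [one_sub_div hz, norm_div, Circle.norm_coe, div_one]
  have h2 : (starRingEnd ℂ) (1 - ρ / (a.toCircle : ℂ)) = 1 - ρ * (a.toCircle : ℂ) := by
    rw [map_sub, map_one, map_div₀, Complex.conj_ofReal, ← Circle.coe_inv_eq_conj, Circle.coe_inv,
      div_inv_eq_mul]
  rw [circlePoisson_eq, h1, ← mul_inv, ← h2, Complex.mul_conj, Complex.normSq_eq_norm_sq]
  push_cast
  rw [div_eq_mul_inv]

lemma circlePoisson_nonneg {ρ : ℝ} (h0 : 0 ≤ ρ) (h1 : ρ < 1) (a : AddCircle (2 * π)) :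
    0 ≤ circlePoisson ρ a := by
  rw [circlePoisson_eq]
  have : 0 ≤ 1 - ρ ^ 2 := by nlinarith
  positivity

lemma continuous_circlePoisson {ρ : ℝ} (h0 : 0 ≤ ρ) (h1 : ρ < 1) :
    Continuous (circlePoisson ρ) := by
  have : circlePoisson ρ = fun a => (1 - ρ ^ 2) / ‖(a.toCircle : ℂ) - ρ‖ ^ 2 :=
    funext (circlePoisson_eq ρ)
  rw [this]
  have hc : Continuous fun a : AddCircle (2 * π) => (a.toCircle : ℂ) :=
    continuous_subtype_val.comp AddCircle.continuous_toCircle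
  refine continuous_const.div ((hc.sub continuous_const).norm.pow 2) fun a => ?_
  refine pow_ne_zero 2 (norm_ne_zero_iff.2 (sub_ne_zero.2 fun h => ?_))
  have := congrArg norm h
  rw [Circle.norm_coe, Complex.norm_real, Real.norm_of_nonneg h0] at this
  exact h1.ne' this

lemma integral_circlePoisson {ρ : ℝ} (h0 : 0 ≤ ρ) (h1 : ρ < 1) :
    ∫ a, circlePoisson ρ a = 2 * π := by
  have h := DiffContOnCl.circleAverage_poissonKernel_smul (f := fun _ : ℂ => (1 : ℂ)) (c := 0)
    (R := 1) (w := ρ) diffContOnCl_const (by simpa [abs_of_nonneg h0] using h1)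
  rw [Real.circleAverage_def] at h
  have e : ∀ θ : ℝ, (poissonKernel 0 (ρ : ℂ) • fun _ : ℂ => (1 : ℂ)) (circleMap 0 1 θ) =
      ((circlePoisson ρ (θ : AddCircle (2 * π)) : ℝ) : ℂ) := by
    intro θ
    rw [circlePoisson, toCircle_coe_two_pi]
    simp [circleMap]
  simp only [e] at h
  rw [intervalIntegral.integral_ofReal] at h
  have e2 := AddCircle.intervalIntegral_preimage (2 * π) 0 (circlePoisson ρ)
  rw [zero_add] at e2
  rw [e2] at h
  have h' : (2 * π)⁻¹ * ∫ a, circlePoisson ρ a = 1 := by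
    rw [Complex.real_smul] at h
    exact_mod_cast h
  rwa [inv_mul_eq_iff_eq_mul₀ Real.two_pi_pos.ne', mul_one] at h'

lemma circlePoisson_le {ρ : ℝ} (h0 : 0 ≤ ρ) (h1 : ρ < 1) {a : AddCircle (2 * π)} {δ : ℝ}
    (hδ : 0 < δ) (ha : δ ≤ ‖(a.toCircle : ℂ) - 1‖) :
    circlePoisson ρ a ≤ 4 * (1 - ρ ^ 2) / δ ^ 2 := by
  have hρ : ‖(1 : ℂ) - ρ‖ = 1 - ρ := by
    rw [← Complex.ofReal_one, ← Complex.ofReal_sub, Complex.norm_real,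
      Real.norm_of_nonneg (sub_nonneg.2 h1.le)]
  have h2 : ‖(a.toCircle : ℂ) - 1‖ ≤ ‖(a.toCircle : ℂ) - ρ‖ + (1 - ρ) := by
    have := norm_sub_le ((a.toCircle : ℂ) - ρ) (1 - ρ)
    rwa [hρ, sub_sub_sub_cancel_right] at this
  have h3 : 1 - ρ ≤ ‖(a.toCircle : ℂ) - ρ‖ := by
    have := norm_sub_norm_le (a.toCircle : ℂ) ρ
    rwa [Circle.norm_coe, Complex.norm_real, Real.norm_of_nonneg h0] at this
  have h4 : δ / 2 ≤ ‖(a.toCircle : ℂ) - ρ‖ := by linarith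
  rw [circlePoisson_eq]
  calc (1 - ρ ^ 2) / ‖(a.toCircle : ℂ) - ρ‖ ^ 2 ≤ (1 - ρ ^ 2) / (δ / 2) ^ 2 := by
        gcongr
        nlinarith
    _ = 4 * (1 - ρ ^ 2) / δ ^ 2 := by field_simp; ring

lemma eventually_nonneg_lt_one : ∀ᶠ ρ : ℝ in 𝓝[<] 1, 0 ≤ ρ ∧ ρ < 1 := by
  filter_upwards [self_mem_nhdsWithin,
    mem_nhdsWithin_of_mem_nhds (Ici_mem_nhds (zero_lt_one' ℝ))] with ρ h1 h0
  exact ⟨h0, h1⟩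

lemma tendsto_integral_circlePoisson_smul {g : AddCircle (2 * π) → ℂ} (hg : Continuous g) :
    Tendsto (fun ρ : ℝ => ∫ a, circlePoisson ρ a • g a) (𝓝[<] 1) (𝓝 ((2 * π : ℝ) • g 0)) := by
  have hint : Integrable g := integrable_of_continuous_of_compactSpace hg
  have h := tendsto_integral_peak_smul_of_integrable_of_tendsto
    (φ := fun ρ a => (2 * π)⁻¹ * circlePoisson ρ a) (l := 𝓝[<] (1 : ℝ)) (x₀ := 0)
    (t := Set.univ) MeasurableSet.univ univ_mem (measure_ne_top volume _) ?_ ?_ ?_ ?_ hint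
    (hg.tendsto 0)
  · have h2 := h.const_smul (2 * π)
    refine h2.congr fun ρ => ?_
    rw [← integral_smul]
    refine integral_congr_ae (Eventually.of_forall fun a => ?_)
    simp only [smul_smul]
    rw [mul_inv_cancel_left₀ Real.two_pi_pos.ne']
  · filter_upwards [eventually_nonneg_lt_one] with ρ hρ a
    have := circlePoisson_nonneg hρ.1 hρ.2 a
    have := Real.two_pi_pos
    positivity
  · intro u hu h0
    rcases (uᶜ).eq_empty_or_nonempty with he | hne
    · rw [he]
      exact tendstoUniformlyOn_empty
    have hc : Continuous fun a : AddCircle (2 * π) => ‖(a.toCircle : ℂ) - 1‖ :=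
      ((continuous_subtype_val.comp AddCircle.continuous_toCircle).sub continuous_const).norm
    obtain ⟨a₀, ha₀, hmin⟩ := hu.isClosed_compl.isCompact.exists_isMinOn hne hc.continuousOn
    set δ := ‖(a₀.toCircle : ℂ) - 1‖ with hδ
    have hδ0 : 0 < δ := by
      refine norm_pos_iff.2 (sub_ne_zero.2 fun h => ha₀ ?_)
      have h1 : a₀.toCircle = (0 : AddCircle (2 * π)).toCircle := by
        rw [AddCircle.toCircle_zero]; exact Circle.ext h
      rwa [AddCircle.injective_toCircle Real.two_pi_pos.ne' h1]
    have hlim : Tendsto (fun ρ : ℝ => (2 * π)⁻¹ * (4 * (1 - ρ ^ 2) / δ ^ 2)) (𝓝[<] 1) (𝓝 0) := by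
      have : Continuous fun ρ : ℝ => (2 * π)⁻¹ * (4 * (1 - ρ ^ 2) / δ ^ 2) := by fun_prop
      have h1 := this.tendsto 1
      simp only [one_pow, sub_self, mul_zero, zero_div] at h1
      exact h1.mono_left nhdsWithin_le_nhds
    rw [Metric.tendstoUniformlyOn_iff]
    intro ε hε
    filter_upwards [eventually_nonneg_lt_one, hlim.eventually (gt_mem_nhds hε)] with ρ hρ hlt a ha
    have h1 := circlePoisson_nonneg hρ.1 hρ.2 a
    have h2 := circlePoisson_le hρ.1 hρ.2 hδ0 (hmin ha)
    have h3 : 0 < (2 * π)⁻¹ := inv_pos.2 Real.two_pi_pos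
    rw [Pi.zero_apply, dist_zero_left, Real.norm_of_nonneg (mul_nonneg h3.le h1)]
    exact (mul_le_mul_of_nonneg_left h2 h3.le).trans_lt hlt
  · refine tendsto_const_nhds.congr' ?_
    filter_upwards [eventually_nonneg_lt_one] with ρ hρ
    rw [setIntegral_univ, integral_const_mul, integral_circlePoisson hρ.1 hρ.2,
      inv_mul_cancel₀ Real.two_pi_pos.ne']
  · filter_upwards [eventually_nonneg_lt_one] with ρ hρ
    exact (continuous_const.mul (continuous_circlePoisson hρ.1 hρ.2)).aestronglyMeasurable

lemma continuous_cons_addCircle {m : ℕ} :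
    Continuous fun y : AddCircle (2 * π) × (Fin m → AddCircle (2 * π)) =>
      (Fin.cons y.1 y.2 : Fin (m + 1) → AddCircle (2 * π)) :=
  continuous_pi fun i => Fin.cases continuous_fst
    (fun j => (continuous_apply j).comp continuous_snd) i

lemma integral_pi_addCircle_cons {E : Type*} [NormedAddCommGroup E] [NormedSpace ℝ E] {m : ℕ}
    {f : (Fin (m + 1) → AddCircle (2 * π)) → E} (hf : Continuous f) :
    ∫ x, f x = ∫ a : AddCircle (2 * π), ∫ x : Fin m → AddCircle (2 * π), f (Fin.cons a x) := by
  have hmp := volume_preserving_piFinSuccAbove (fun _ : Fin (m + 1) => AddCircle (2 * π)) 0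
  have h1 := hmp.symm.integral_comp' f
  rw [← h1]
  have hcont : Continuous fun y : AddCircle (2 * π) × (Fin m → AddCircle (2 * π)) =>
      f (Fin.cons y.1 y.2) := hf.comp continuous_cons_addCircle
  have h2 : ∀ y, (MeasurableEquiv.piFinSuccAbove (fun _ : Fin (m + 1) => AddCircle (2 * π)) 0).symm
      y = Fin.cons y.1 y.2 := fun y => Fin.insertNth_zero' y.1 y.2
  simp only [h2]
  exact integral_prod _ (integrable_of_continuous_of_compactSpace (μ := volume.prod volume) hcont)

/-- The Poisson kernel in the first angle of a torus concentrates on the subtorus where this angle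
vanishes. -/
lemma HolFam.tendsto_integral_circlePoisson {m : ℕ} {Ω : Set ℂ} (hΩ : IsOpen Ω)
    (h1 : (1 : ℂ) ∈ Ω) {Φ : ℂ → (Fin (m + 1) → AddCircle (2 * π)) → ℂ} (hΦ : HolFam Ω Φ) :
    Tendsto (fun ρ : ℝ => ∫ x, circlePoisson ρ (x 0) • Φ ρ x) (𝓝[<] 1)
      (𝓝 ((2 * π : ℝ) • ∫ x : Fin m → AddCircle (2 * π), Φ 1 (Fin.cons 0 x))) := by
  have hΦ1 := hΦ.continuous h1
  have hcoe : Tendsto (fun ρ : ℝ => (ρ : ℂ)) (𝓝[<] 1) (𝓝 1) := by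
    have := Complex.continuous_ofReal.tendsto 1
    exact this.mono_left nhdsWithin_le_nhds
  have hpc : ∀ {ρ : ℝ}, 0 ≤ ρ → ρ < 1 →
      Continuous fun x : Fin (m + 1) → AddCircle (2 * π) => circlePoisson ρ (x 0) :=
    fun h0 h1 => (continuous_circlePoisson h0 h1).comp (continuous_apply 0)
  have hG : Continuous fun a => ∫ x : Fin m → AddCircle (2 * π), Φ 1 (Fin.cons a x) := by
    have hc : Continuous (Function.uncurry fun (a : AddCircle (2 * π))
        (x : Fin m → AddCircle (2 * π)) => Φ 1 (Fin.cons a x)) :=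
      hΦ1.comp continuous_cons_addCircle
    simpa using continuous_parametric_integral_of_continuous (μ := volume) hc isCompact_univ
  have hmain := tendsto_integral_circlePoisson_smul hG
  have hcongr : ∀ᶠ ρ : ℝ in 𝓝[<] 1, ∫ a, (circlePoisson ρ a •
      ∫ x : Fin m → AddCircle (2 * π), Φ 1 (Fin.cons a x)) =
        ∫ x, circlePoisson ρ (x 0) • Φ 1 x := by
    filter_upwards [eventually_nonneg_lt_one] with ρ hρ
    rw [integral_pi_addCircle_cons (f := fun x => circlePoisson ρ (x 0) • Φ 1 x)
      ((hpc hρ.1 hρ.2).smul hΦ1)]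
    simp only [Fin.cons_zero, integral_smul]
  have hdiff : Tendsto (fun ρ : ℝ => ∫ x, circlePoisson ρ (x 0) • (Φ ρ x - Φ 1 x)) (𝓝[<] 1)
      (𝓝 0) := by
    have hun := ContinuousOn.tendstoUniformly (hΩ.mem_nhds h1) hΦ.cont
    rw [Metric.tendstoUniformly_iff] at hun
    rw [Metric.tendsto_nhds]
    intro ε hε
    obtain ⟨M, hM⟩ : ∃ M : ℝ, ∀ ρ : ℝ, 0 ≤ ρ → ρ < 1 →
        ∫ x : Fin (m + 1) → AddCircle (2 * π), circlePoisson ρ (x 0) = M := by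
      refine ⟨∫ x : Fin m → AddCircle (2 * π), 2 * π, fun ρ h0 h1 => ?_⟩
      rw [integral_pi_addCircle_cons (hpc h0 h1)]
      simp only [Fin.cons_zero, integral_const, smul_eq_mul]
      rw [integral_const_mul, integral_circlePoisson h0 h1]
    have hM0 : 0 ≤ M := by
      rw [← hM 0 le_rfl one_pos]
      exact integral_nonneg fun x => circlePoisson_nonneg le_rfl one_pos _
    filter_upwards [eventually_nonneg_lt_one, hcoe.eventually (hun (ε / (M + 1)) (by positivity))]
      with ρ hρ hlt
    rw [dist_zero_right]
    refine (norm_integral_le_integral_norm _).trans_lt ?_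
    have hi : Integrable fun x : Fin (m + 1) → AddCircle (2 * π) =>
        circlePoisson ρ (x 0) * (ε / (M + 1)) :=
      integrable_of_continuous_of_compactSpace ((hpc hρ.1 hρ.2).mul_const _)
    refine LE.le.trans_lt (integral_mono_of_nonneg (Eventually.of_forall fun _ => norm_nonneg _) hi
      (Eventually.of_forall fun x => ?_)) ?_
    · have h2 := (hlt x).le
      rw [dist_comm, dist_eq_norm] at h2
      simp only [norm_smul, Real.norm_of_nonneg (circlePoisson_nonneg hρ.1 hρ.2 (x 0))]
      exact mul_le_mul_of_nonneg_left h2 (circlePoisson_nonneg hρ.1 hρ.2 _)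
    · rw [integral_mul_const, hM ρ hρ.1 hρ.2]
      rw [mul_div_assoc', div_lt_iff₀ (by positivity)]
      nlinarith
  have := (hmain.congr' hcongr).add hdiff
  rw [add_zero] at this
  refine this.congr' ?_
  filter_upwards [eventually_nonneg_lt_one, hcoe.eventually (hΩ.mem_nhds h1)] with ρ hρ hmem
  rw [← integral_add (f := fun x => circlePoisson ρ (x 0) • Φ 1 x)
    (g := fun x => circlePoisson ρ (x 0) • (Φ ρ x - Φ 1 x))
    (integrable_of_continuous_of_compactSpace ((hpc hρ.1 hρ.2).smul hΦ1))
    (integrable_of_continuous_of_compactSpace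
      ((hpc hρ.1 hρ.2).smul ((hΦ.continuous hmem).sub hΦ1)))]
  simp only [← smul_add, add_sub_cancel]

end PoissonLimit

section PinchLimit

open Filter Topology

variable {p q : ℂ}

lemma pinchReg_mul_pinchCoeff_eq {m : ℕ} (hp0 : p ≠ 0) (hq0 : q ≠ 0) (hp : ‖p‖ < 1)
    (hq : ‖q‖ < 1) (t u z : Fin (m + 2) → ℂ) (hz : ∀ i, ‖z i‖ = 1) (hz1 : z 1 = 1) :
    pinchReg p q 1 t u z * pinchCoeff 1 1 z =
      gammaReg 1 p q ^ 2 * (∏ r, ellGamma (t r) p q * ellGamma (u r) p q) *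
        anKernel p q t u (fun i => z (Fin.succAbove 1 i)) := by
  have hz0 : ∀ i, z i ≠ 0 := fun i => norm_pos_iff.1 (by rw [hz]; exact one_pos)
  have hinj : ∀ i j : Fin (m + 1), (Fin.succAbove 1 i : Fin (m + 2)) = Fin.succAbove 1 j ↔ i = j :=
    fun i j => Fin.succAbove_right_injective.eq_iff
  have hne : ∀ i : Fin (m + 1), (Fin.succAbove 1 i : Fin (m + 2)) ≠ 1 :=
    fun i => Fin.succAbove_ne _ _
  have hne' : ∀ i : Fin (m + 1), (1 : Fin (m + 2)) ≠ Fin.succAbove 1 i :=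
    fun i => Fin.ne_succAbove _ _
  rw [anKernel, prod_prod_erase_comm (fun i j => ellGamma (p * q * _) p q), pinchReg, pinchCoeff]
  simp only [ellGamma_mul_div_eq hp0 hq0 hp hq (hz0 _) (hz0 _), prod_erase_eq_prod_ite,
    Fin.prod_univ_succAbove _ (1 : Fin (m + 2)), hinj, hne, hne', hz1, if_true, if_false,
    one_mul, mul_one, one_div, div_one, true_or, or_true, or_false,
    and_false, Finset.prod_const_one]
  have hmul : ∀ a b : Fin (m + 1) → Fin (m + 1) → ℂ,
      ∏ i, ∏ j, (if j = i then 1 else a i j * b i j) =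
        (∏ i, ∏ j, if j = i then 1 else a i j) * ∏ i, ∏ j, if i = j then 1 else b i j := by
    intro a b
    simp only [← Finset.prod_mul_distrib]
    refine Finset.prod_congr rfl fun i _ => Finset.prod_congr rfl fun j _ => ?_
    by_cases h : i = j
    · simp [h]
    · rw [if_neg (Ne.symm h), if_neg (Ne.symm h), if_neg h]
  have hA : ∏ i : Fin (m + 1), gammaReg (z (Fin.succAbove 1 i)) p q ≠ 0 :=
    Finset.prod_ne_zero_iff.2 fun i _ => gammaReg_ne_zero hp hq (hz _)
  have hB : ∏ i : Fin (m + 1), gammaReg (z (Fin.succAbove 1 i))⁻¹ p q ≠ 0 :=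
    Finset.prod_ne_zero_iff.2 fun i _ => gammaReg_ne_zero hp hq (by rw [norm_inv, hz, inv_one])
  simp only [hmul, Finset.prod_mul_distrib, Finset.prod_inv_distrib, inv_one] at hA hB ⊢
  generalize (∏ i : Fin (m + 1), gammaReg (z (Fin.succAbove 1 i)) p q) = A at *
  generalize (∏ i : Fin (m + 1), gammaReg (z (Fin.succAbove 1 i))⁻¹ p q) = B at *
  rw [show ∀ a b c d : ℂ, a * (A * B * b) * (B⁻¹ * (A⁻¹ * c)) * d =
    a * b * c * d * (A * A⁻¹) * (B * B⁻¹) by intros; ring]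
  rw [mul_inv_cancel₀ hA, mul_inv_cancel₀ hB]
  ring

/-- A term of the partial fraction expansion of `anKernel p q (Fin.cons ρ t) (Fin.cons ρ u)`. -/
noncomputable def pinchTerm {n : ℕ} (p q ρ : ℂ) (t u : Fin (n + 1) → ℂ) (k l : Fin (n + 1))
    (z : Fin (n + 1) → ℂ) : ℂ :=
  pinchReg p q ρ t u z * pinchCoeff k l z * ((1 - ρ / z k)⁻¹ * (1 - ρ * z l)⁻¹)

lemma pinchTerm_comp_perm {n : ℕ} (σ : Equiv.Perm (Fin (n + 1))) (ρ : ℂ)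
    (t u z : Fin (n + 1) → ℂ) (k : Fin (n + 1)) :
    pinchTerm p q ρ t u k k (z ∘ σ) = pinchTerm p q ρ t u (σ k) (σ k) z := by
  simp only [pinchTerm, pinchReg_comp_perm, pinchCoeff_comp_perm, Function.comp_apply]

lemma HolFam.pinchTerm {n : ℕ} {K : Type*} [TopologicalSpace K] {Ω : Set ℂ} (hΩ : IsOpen Ω)
    {W : ℂ → ℂ} {t u : Fin (n + 1) → ℂ → ℂ} {z : Fin (n + 1) → ℂ → K → ℂ} {R : ℝ}
    (hp : ‖p‖ < 1) (hq : ‖q‖ < 1)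
    (hpR : ‖p‖ * (R * R) < 1) (hqR : ‖q‖ * (R * R) < 1)
    (hW : DifferentiableOn ℂ W Ω) (ht : ∀ r, DifferentiableOn ℂ (t r) Ω)
    (hu : ∀ r, DifferentiableOn ℂ (u r) Ω) (hz : ∀ i, HolFam Ω (z i))
    (hW0 : ∀ w ∈ Ω, W w ≠ 0) (ht0 : ∀ r, ∀ w ∈ Ω, t r w ≠ 0) (hu0 : ∀ r, ∀ w ∈ Ω, u r w ≠ 0)
    (hz0 : ∀ i, ∀ w ∈ Ω, ∀ x, z i w x ≠ 0)
    (hW1 : ∀ w ∈ Ω, ‖W w‖ < R) (ht1 : ∀ r, ∀ w ∈ Ω, ‖t r w‖ * R < 1)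
    (hu1 : ∀ r, ∀ w ∈ Ω, ‖u r w‖ * R < 1)
    (hz1 : ∀ i, ∀ w ∈ Ω, ∀ x, ‖z i w x‖ < R) (hz2 : ∀ i, ∀ w ∈ Ω, ∀ x, ‖z i w x‖⁻¹ < R)
    {k l : Fin (n + 1)} (hk : ∀ w ∈ Ω, ∀ x, ‖W w‖ < ‖z k w x‖)
    (hl : ∀ w ∈ Ω, ∀ x, ‖W w * z l w x‖ < 1) :
    HolFam Ω fun w x => pinchTerm p q (W w) (fun r => t r w) (fun r => u r w) k l
      fun i => z i w x := by
  have HW : HolFam (K := K) Ω fun w _ => W w := of_differentiableOn hW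
  have key : ∀ x : ℂ, ‖x‖ < 1 → 1 - x ≠ 0 := fun x hx h => by
    rw [← sub_eq_zero.1 h] at hx
    simp at hx
  have hsub : ∀ {f : ℂ → K → ℂ}, HolFam Ω f → HolFam Ω fun w x => 1 - f w x := fun hf =>
    ⟨continuousOn_const.sub hf.cont, fun x => (differentiableOn_const _).sub (hf.diff x)⟩
  refine ((HolFam.pinchReg hΩ hp hq hpR hqR hW ht hu hz hW0 ht0 hu0 hz0 hW1 ht1 hu1 hz1 hz2).mul
    (HolFam.pinchCoeff k l hz hz0)).mul (((hsub (HW.div (hz k) (hz0 k))).inv ?_).mul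
      ((hsub (HW.mul (hz l))).inv ?_))
  · intro w hw x
    exact key _ (by rw [norm_div]; exact (div_lt_one (norm_pos_iff.2 (hz0 k w hw x))).2 (hk w hw x))
  · intro w hw x
    exact key _ (hl w hw x)

section Limits

variable {m : ℕ} {R : ℝ} {t u : Fin (m + 2) → ℂ → ℂ} {Ω : Set ℂ}

lemma tendsto_integral_pinchTerm_of_ne (hR : 1 < R) (hp : ‖p‖ < 1) (hq : ‖q‖ < 1)
    (hpR : ‖p‖ * (R * R) < 1) (hqR : ‖q‖ * (R * R) < 1) (hΩ : Ω = {w | R⁻¹ < ‖w‖ ∧ ‖w‖ < R})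
    (ht : ∀ r, DifferentiableOn ℂ (t r) Ω) (hu : ∀ r, DifferentiableOn ℂ (u r) Ω)
    (ht0 : ∀ r, ∀ w ∈ Ω, t r w ≠ 0) (hu0 : ∀ r, ∀ w ∈ Ω, u r w ≠ 0)
    (ht1 : ∀ r, ∀ w ∈ Ω, ‖t r w‖ * R < 1) (hu1 : ∀ r, ∀ w ∈ Ω, ‖u r w‖ * R < 1)
    {k l : Fin (m + 2)} (hkl : k ≠ l) :
    Tendsto (fun ρ : ℝ => (1 - (ρ : ℂ) ^ 2) * ∫ x : Fin (m + 1) → AddCircle (2 * π),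
      pinchTerm p q ρ (fun r => t r ρ) (fun r => u r ρ) k l (torusPt x)) (𝓝[<] 1) (𝓝 0) := by
  set L := Real.log R with hL
  have hL0 : 0 < L := Real.log_pos hR
  have hexp : Real.exp L = R := Real.exp_log (one_pos.trans hR)
  have hRinv : R⁻¹ = Real.exp (-L) := by rw [Real.exp_neg, hexp]
  set c : Fin (m + 2) → ℝ := Pi.single k 1 - Pi.single l 1 with hc
  have hck : c k = 1 := by simp [hc, hkl]
  have hcl : c l = -1 := by simp [hc, hkl.symm]
  have hc1 : ∀ i, |c i| ≤ 1 := by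
    intro i
    by_cases h1 : i = k <;> by_cases h2 : i = l <;> simp_all
  have hcsum : ∑ i, c i = 0 := by simp [hc, Finset.sum_sub_distrib]
  have hnorm : ∀ i (s : ℂ) (x : Fin (m + 1) → AddCircle (2 * π)),
      ‖torusPt x i * Complex.exp (c i * s)‖ = Real.exp (c i * s.re) := by
    intro i s x
    rw [norm_mul, norm_torusPt, one_mul, Complex.norm_exp]
    simp
  have hlt : ∀ i (σ : ℝ), |σ| < L → |c i * σ| < L := fun i σ hσ => by
    rw [abs_mul]
    exact (mul_le_of_le_one_left (abs_nonneg _) (hc1 i)).trans_lt hσ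
  have hnR : ∀ i (s : ℂ) (x : Fin (m + 1) → AddCircle (2 * π)), |s.re| < L →
      ‖torusPt x i * Complex.exp (c i * s)‖ < R := fun i s x hs => by
    rw [hnorm, ← hexp]
    exact Real.exp_lt_exp.2 (abs_lt.1 (hlt i _ hs)).2
  have hnR' : ∀ i (s : ℂ) (x : Fin (m + 1) → AddCircle (2 * π)), |s.re| < L →
      ‖torusPt x i * Complex.exp (c i * s)‖⁻¹ < R := fun i s x hs => by
    rw [hnorm, ← hexp, ← Real.exp_neg]
    exact Real.exp_lt_exp.2 (by linarith [(abs_lt.1 (hlt i _ hs)).1])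
  have hmul0 : ∀ i (s : ℂ) (x : Fin (m + 1) → AddCircle (2 * π)),
      torusPt x i * Complex.exp (c i * s) ≠ 0 := fun i s x =>
    mul_ne_zero (torusPt_ne_zero x i) (Complex.exp_ne_zero _)
  set s₁ : ℂ := ((L / 2 : ℝ) : ℂ) with hs₁
  have hs₁re : s₁.re = L / 2 := Complex.ofReal_re _
  have hs₁L : |s₁.re| < L := by rw [hs₁re, abs_of_pos (by linarith)]; linarith
  set J : ℂ → ℂ := fun w => ∫ x : Fin (m + 1) → AddCircle (2 * π),
    pinchTerm p q w (fun r => t r w) (fun r => u r w) k l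
      fun i => torusPt x i * Complex.exp (c i * s₁) with hJ
  have hJc : ContinuousAt J 1 := by
    set Ω' : Set ℂ := {w | R⁻¹ < ‖w‖ ∧ ‖w‖ < Real.exp (L / 2)} with hΩ'
    have hopen : IsOpen Ω' := (isOpen_lt continuous_const continuous_norm).inter
      (isOpen_lt continuous_norm continuous_const)
    have hsub : Ω' ⊆ Ω := fun w hw => by
      rw [hΩ]
      refine ⟨hw.1, hw.2.trans ?_⟩
      rw [← hexp]
      exact Real.exp_lt_exp.2 (by linarith)
    have h1 : (1 : ℂ) ∈ Ω' := ⟨by rw [norm_one]; exact inv_lt_one_of_one_lt₀ hR,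
      by rw [norm_one]; exact Real.one_lt_exp_iff.2 (by linarith)⟩
    refine (DifferentiableOn.continuousOn (𝕜 := ℂ) (HolFam.differentiableOn_integral hopen
      (HolFam.pinchTerm (W := fun w => w) (R := R)
        (z := fun i _ x => torusPt x i * Complex.exp (c i * s₁)) hopen hp hq hpR hqR
        differentiableOn_id (fun r => (ht r).mono hsub) (fun r => (hu r).mono hsub)
        (fun i => HolFam.of_continuous ((continuous_torusPt i).mul continuous_const)) ?_
        (fun r w hw => ht0 r w (hsub hw)) (fun r w hw => hu0 r w (hsub hw))
        (fun i _ _ x => hmul0 i s₁ x) ?_ (fun r w hw => ht1 r w (hsub hw))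
        (fun r w hw => hu1 r w (hsub hw)) (fun i _ _ x => hnR i s₁ x hs₁L)
        (fun i _ _ x => hnR' i s₁ x hs₁L) ?_ ?_))).continuousAt (hopen.mem_nhds h1)
    · intro w hw
      exact norm_pos_iff.1 ((inv_pos.2 (one_pos.trans hR)).trans hw.1)
    · intro w hw
      have := hsub hw
      rw [hΩ] at this
      exact this.2
    · intro w hw x
      rw [hnorm, hck, one_mul, hs₁re]
      exact hw.2
    · intro w hw x
      rw [norm_mul, hnorm, hcl, neg_one_mul, hs₁re, Real.exp_neg, ← div_eq_mul_inv]
      exact (div_lt_one (Real.exp_pos _)).2 hw.2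
  have hcoe : Tendsto (fun ρ : ℝ => (ρ : ℂ)) (𝓝[<] 1) (𝓝 1) := by
    have := Complex.continuous_ofReal.tendsto 1
    exact this.mono_left nhdsWithin_le_nhds
  have hlim : Tendsto (fun ρ : ℝ => (1 - (ρ : ℂ) ^ 2) * J ρ) (𝓝[<] 1) (𝓝 0) := by
    have h := ((tendsto_const_nhds (x := (1 : ℂ))).sub (hcoe.pow 2)).mul (hJc.tendsto.comp hcoe)
    simpa using h
  refine hlim.congr' ?_
  filter_upwards [self_mem_nhdsWithin, mem_nhdsWithin_of_mem_nhds
    (Ioi_mem_nhds (inv_lt_one_of_one_lt₀ hR))] with ρ hρ1 hρR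
  rw [Set.mem_Iio] at hρ1
  rw [Set.mem_Ioi] at hρR
  have hρ0 : 0 < ρ := (inv_pos.2 (one_pos.trans hR)).trans hρR
  have hnρ : ‖(ρ : ℂ)‖ = ρ := by rw [Complex.norm_real, Real.norm_of_nonneg hρ0.le]
  have hρΩ : (ρ : ℂ) ∈ Ω := by
    rw [hΩ]
    exact ⟨by rwa [hnρ], by rw [hnρ]; exact hρ1.trans hR⟩
  have hlog : -L < Real.log ρ := by
    rw [Real.lt_log_iff_exp_lt hρ0, ← hRinv]
    exact hρR
  have hlog0 : Real.log ρ < 0 := Real.log_neg hρ0 hρ1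
  set S : Set ℂ := {s : ℂ | Real.log ρ < s.re ∧ s.re < L} with hS
  have hSL : ∀ s ∈ S, |s.re| < L := fun s hs => abs_lt.2 ⟨hlog.trans hs.1, hs.2⟩
  have hopen : IsOpen S := (isOpen_lt continuous_const Complex.continuous_re).inter
    (isOpen_lt Complex.continuous_re continuous_const)
  have hshift := integral_torusPt_shift (s₁ := 0) (s₂ := s₁)
    (f := pinchTerm p q ρ (fun r => t r ρ) (fun r => u r ρ) k l) hcsum hS
    (HolFam.pinchTerm (W := fun _ => (ρ : ℂ)) (R := R) (t := fun r _ => t r ρ)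
      (u := fun r _ => u r ρ) (z := fun i s x => torusPt x i * Complex.exp (c i * s))
      hopen hp hq hpR hqR (differentiableOn_const _) (fun _ => differentiableOn_const _)
      (fun _ => differentiableOn_const _)
      (fun i => (HolFam.of_continuous (continuous_torusPt i)).mul
        (HolFam.of_differentiableOn (f := fun s => Complex.exp (c i * s)) (by fun_prop)))
      (fun _ _ => Complex.ofReal_ne_zero.2 hρ0.ne') (fun r _ _ => ht0 r _ hρΩ)
      (fun r _ _ => hu0 r _ hρΩ) (fun i s _ x => hmul0 i s x)
      (fun _ _ => by rw [hnρ]; exact hρ1.trans hR) (fun r _ _ => ht1 r _ hρΩ)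
      (fun r _ _ => hu1 r _ hρΩ) (fun i s hs x => hnR i s x (hSL s hs))
      (fun i s hs x => hnR' i s x (hSL s hs))
      (fun s hs x => by
        rw [hnorm, hck, one_mul, hnρ, ← Real.log_lt_iff_lt_exp hρ0]
        exact hs.1)
      (fun s hs x => by
        rw [norm_mul, hnorm, hcl, neg_one_mul, hnρ, Real.exp_neg, ← div_eq_mul_inv,
          div_lt_one (Real.exp_pos _), ← Real.log_lt_iff_lt_exp hρ0]
        exact hs.1))
    ⟨by simpa using hlog0, by simpa using hL0⟩
    ⟨by rw [hs₁re]; linarith, by rw [hs₁re]; linarith⟩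
  simp only [mul_zero, Complex.exp_zero, mul_one] at hshift
  rw [hJ]
  exact congrArg _ hshift.symm

end Limits

end PinchLimit

section PinchLimitDiagonal

open Filter Topology

variable {m : ℕ} {p q : ℂ} {R : ℝ} {t u : Fin (m + 2) → ℂ → ℂ} {Ω : Set ℂ}

lemma tendsto_integral_pinchTerm_self (hR : 1 < R) (hp0 : p ≠ 0) (hq0 : q ≠ 0) (hp : ‖p‖ < 1)
    (hq : ‖q‖ < 1)
    (hpR : ‖p‖ * (R * R) < 1) (hqR : ‖q‖ * (R * R) < 1) (hΩ : Ω = {w | R⁻¹ < ‖w‖ ∧ ‖w‖ < R})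
    (ht : ∀ r, DifferentiableOn ℂ (t r) Ω) (hu : ∀ r, DifferentiableOn ℂ (u r) Ω)
    (ht0 : ∀ r, ∀ w ∈ Ω, t r w ≠ 0) (hu0 : ∀ r, ∀ w ∈ Ω, u r w ≠ 0)
    (ht1 : ∀ r, ∀ w ∈ Ω, ‖t r w‖ * R < 1) (hu1 : ∀ r, ∀ w ∈ Ω, ‖u r w‖ * R < 1)
    (k : Fin (m + 2)) :
    Tendsto (fun ρ : ℝ => (1 - (ρ : ℂ) ^ 2) * ∫ x : Fin (m + 1) → AddCircle (2 * π),
      pinchTerm p q ρ (fun r => t r ρ) (fun r => u r ρ) k k (torusPt x)) (𝓝[<] 1)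
      (𝓝 (2 * π * (gammaReg 1 p q ^ 2 * (∏ r, ellGamma (t r 1) p q * ellGamma (u r 1) p q) *
        anIntegral p q (fun r => t r 1) (fun r => u r 1)))) := by
  have hR0 : 0 < R := one_pos.trans hR
  have hopen : IsOpen Ω := by
    rw [hΩ]
    exact (isOpen_lt continuous_const continuous_norm).inter
      (isOpen_lt continuous_norm continuous_const)
  have h1 : (1 : ℂ) ∈ Ω := by
    rw [hΩ]
    exact ⟨by rw [norm_one]; exact inv_lt_one_of_one_lt₀ hR, by rwa [norm_one]⟩
  have hz : ∀ i : Fin (m + 2), HolFam Ω fun _ (x : Fin (m + 1) → AddCircle (2 * π)) =>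
      torusPt x i := fun i => HolFam.of_continuous (continuous_torusPt i)
  have hΦ := (HolFam.pinchReg (W := fun w => w) (R := R) hopen hp hq hpR hqR differentiableOn_id
    ht hu hz (fun w hw => by
      rw [hΩ] at hw
      exact norm_pos_iff.1 ((inv_pos.2 hR0).trans hw.1)) ht0 hu0
    (fun i _ _ x => torusPt_ne_zero x i) (fun w hw => by rw [hΩ] at hw; exact hw.2) ht1 hu1
    (fun i _ _ x => by rwa [norm_torusPt]) (fun i _ _ x => by rwa [norm_torusPt, inv_one])).mul
    (HolFam.pinchCoeff 1 1 hz fun i _ _ x => torusPt_ne_zero x i)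
  have hlim := HolFam.tendsto_integral_circlePoisson hopen h1 hΦ
  have hval : ((2 * π : ℝ) • ∫ x : Fin m → AddCircle (2 * π),
      pinchReg p q 1 (fun r => t r 1) (fun r => u r 1) (torusPt (Fin.cons 0 x)) *
        pinchCoeff 1 1 (torusPt (Fin.cons 0 x))) =
      2 * π * (gammaReg 1 p q ^ 2 * (∏ r, ellGamma (t r 1) p q * ellGamma (u r 1) p q) *
        anIntegral p q (fun r => t r 1) (fun r => u r 1)) := by
    have hpt : ∀ x : Fin m → AddCircle (2 * π),
        (fun i => torusPt (Fin.cons 0 x) (Fin.succAbove 1 i)) = torusPt x := by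
      intro x
      funext i
      refine Fin.cases ?_ (fun i => ?_) i
      · simp [torusPt, torusExt, Fin.sum_univ_succ]
      · rw [← Fin.succ_zero_eq_one, Fin.succ_succAbove_succ]
        simp [torusPt, torusExt]
    rw [Complex.real_smul, anIntegral, Complex.ofReal_mul, Complex.ofReal_ofNat]
    congr 1
    rw [← integral_const_mul]
    refine integral_congr_ae (.of_forall fun x => ?_)
    dsimp only
    rw [pinchReg_mul_pinchCoeff_eq hp0 hq0 hp hq _ _ _ (fun i => norm_torusPt _ i)
      (by simp [torusPt, torusExt]), hpt]
  rw [hval] at hlim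
  refine hlim.congr fun ρ => ?_
  rw [← integral_torusPt_comp_perm (Equiv.swap k 1) (pinchTerm p q ρ (fun r => t r ρ)
    (fun r => u r ρ) k k), ← integral_const_mul]
  refine integral_congr_ae (.of_forall fun x => ?_)
  dsimp only
  have hx : torusPt x 1 = (x 0).toCircle := by
    rw [← Fin.succ_zero_eq_one]
    simp only [torusPt, torusExt, Fin.cons_succ]
  rw [Complex.real_smul, ofReal_circlePoisson, ← hx, pinchTerm_comp_perm, Equiv.swap_apply_left,
    pinchTerm]
  ring

lemma tendsto_anIntegral_cons (hR : 1 < R) (hp0 : p ≠ 0) (hq0 : q ≠ 0) (hp : ‖p‖ < 1)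
    (hq : ‖q‖ < 1)
    (hpR : ‖p‖ * (R * R) < 1) (hqR : ‖q‖ * (R * R) < 1) (hΩ : Ω = {w | R⁻¹ < ‖w‖ ∧ ‖w‖ < R})
    (ht : ∀ r, DifferentiableOn ℂ (t r) Ω) (hu : ∀ r, DifferentiableOn ℂ (u r) Ω)
    (ht0 : ∀ r, ∀ w ∈ Ω, t r w ≠ 0) (hu0 : ∀ r, ∀ w ∈ Ω, u r w ≠ 0)
    (ht1 : ∀ r, ∀ w ∈ Ω, ‖t r w‖ * R < 1) (hu1 : ∀ r, ∀ w ∈ Ω, ‖u r w‖ * R < 1) :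
    Tendsto (fun ρ : ℝ => (1 - (ρ : ℂ) ^ 2) *
      anIntegral p q (Fin.cons (ρ : ℂ) fun r => t r ρ) (Fin.cons (ρ : ℂ) fun r => u r ρ)) (𝓝[<] 1)
      (𝓝 ((m + 2) *
        (2 * π * (gammaReg 1 p q ^ 2 * (∏ r, ellGamma (t r 1) p q * ellGamma (u r 1) p q) *
          anIntegral p q (fun r => t r 1) (fun r => u r 1))))) := by
  have hR0 : 0 < R := one_pos.trans hR
  set V := 2 * π * (gammaReg 1 p q ^ 2 * (∏ r, ellGamma (t r 1) p q * ellGamma (u r 1) p q) *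
    anIntegral p q (fun r => t r 1) (fun r => u r 1)) with hV
  have hlim : Tendsto (fun ρ : ℝ => ∑ k, ∑ l, (1 - (ρ : ℂ) ^ 2) *
      ∫ x : Fin (m + 1) → AddCircle (2 * π),
        pinchTerm p q ρ (fun r => t r ρ) (fun r => u r ρ) k l (torusPt x)) (𝓝[<] 1)
      (𝓝 (∑ k : Fin (m + 2), ∑ l : Fin (m + 2), if k = l then V else 0)) := by
    refine tendsto_finsetSum _ fun k _ => tendsto_finsetSum _ fun l _ => ?_
    by_cases hkl : k = l
    · subst hkl
      rw [if_pos rfl]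
      exact tendsto_integral_pinchTerm_self hR hp0 hq0 hp hq hpR hqR hΩ ht hu ht0 hu0 ht1 hu1 k
    · rw [if_neg hkl]
      exact tendsto_integral_pinchTerm_of_ne hR hp hq hpR hqR hΩ ht hu ht0 hu0 ht1 hu1 hkl
  simp only [Finset.sum_ite_eq, Finset.mem_univ, if_true, Finset.sum_const, Finset.card_univ,
    Fintype.card_fin, nsmul_eq_mul, Nat.cast_add, Nat.cast_ofNat] at hlim
  refine hlim.congr' ?_
  filter_upwards [self_mem_nhdsWithin, mem_nhdsWithin_of_mem_nhds
    (Ioi_mem_nhds (inv_lt_one_of_one_lt₀ hR))] with ρ hρ1 hρR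
  rw [Set.mem_Iio] at hρ1
  rw [Set.mem_Ioi] at hρR
  have hρ0 : 0 < ρ := (inv_pos.2 hR0).trans hρR
  have hnρ : ‖(ρ : ℂ)‖ = ρ := by rw [Complex.norm_real, Real.norm_of_nonneg hρ0.le]
  have hρΩ : (ρ : ℂ) ∈ Ω := by
    rw [hΩ]
    exact ⟨by rwa [hnρ], by rw [hnρ]; exact hρ1.trans hR⟩
  have hint : ∀ k l, Integrable fun x : Fin (m + 1) → AddCircle (2 * π) =>
      pinchTerm p q ρ (fun r => t r ρ) (fun r => u r ρ) k l (torusPt x) := fun k l =>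
    (HolFam.pinchTerm (W := fun _ => (ρ : ℂ)) (R := R) (t := fun r _ => t r ρ)
      (u := fun r _ => u r ρ) (z := fun i _ x => torusPt x i)
      isOpen_univ hp hq hpR hqR (differentiableOn_const _) (fun _ => differentiableOn_const _)
      (fun _ => differentiableOn_const _)
      (fun i => HolFam.of_continuous (continuous_torusPt i))
      (fun _ _ => Complex.ofReal_ne_zero.2 hρ0.ne') (fun r _ _ => ht0 r _ hρΩ)
      (fun r _ _ => hu0 r _ hρΩ) (fun i _ _ x => torusPt_ne_zero x i)
      (fun _ _ => by rw [hnρ]; exact hρ1.trans hR) (fun r _ _ => ht1 r _ hρΩ)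
      (fun r _ _ => hu1 r _ hρΩ) (fun i _ _ x => by rwa [norm_torusPt])
      (fun i _ _ x => by rwa [norm_torusPt, inv_one])
      (fun _ _ x => by rwa [norm_torusPt, hnρ])
      (fun _ _ x => by rwa [norm_mul, norm_torusPt, hnρ, mul_one])).integrable
        (Set.mem_univ (0 : ℂ))
  simp only [← Finset.mul_sum]
  rw [anIntegral]
  congr 1
  simp only [← integral_finsetSum _ fun l _ => hint _ l]
  rw [← integral_finsetSum _ fun k _ => integrable_finsetSum _ fun l _ => hint k l]
  refine integral_congr_ae ?_
  have hne : ∀ᵐ x : Fin (m + 1) → AddCircle (2 * π), ∀ i j, i ≠ j → torusPt x i ≠ torusPt x j :=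
    ae_all_iff.2 fun i => ae_all_iff.2 fun j => by
      by_cases hij : i = j
      · simp [hij]
      · filter_upwards [ae_torusPt_ne hij] with x hx _ using hx
  filter_upwards [hne] with x hx
  exact (anKernel_cons_eq_sum hp0 hq0 hp hq (by rwa [hnρ]) _ _ (norm_torusPt x)
    fun i j hij => by_contra fun h => hx i j h hij).symm

end PinchLimitDiagonal

section BetaProductLimit

open Filter Topology

variable {m : ℕ} {p q : ℂ}

lemma continuousAt_ellGamma (hp : ‖p‖ < 1) (hq : ‖q‖ < 1) {x : ℂ} (hx0 : x ≠ 0) (hx : ‖x‖ < 1) :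
    ContinuousAt (fun x => ellGamma x p q) x := by
  have hΩ : IsOpen {x : ℂ | x ≠ 0 ∧ ‖x‖ < 1} :=
    isOpen_ne.inter (isOpen_lt continuous_norm continuous_const)
  exact (((HolFam.of_differentiableOn (K := Unit) (f := fun x => x)
    differentiableOn_id).ellGamma_const
    hp hq hΩ (fun _ h _ => h.1) fun _ h _ => h.2).diff ()).continuousOn.continuousAt
      (hΩ.mem_nhds ⟨hx0, hx⟩)

lemma continuousAt_gammaReg_one (hp : ‖p‖ < 1) (hq : ‖q‖ < 1) :
    ContinuousAt (fun x => gammaReg x p q) 1 := by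
  have hΩ : IsOpen {x : ℂ | x ≠ 0 ∧ ‖p * x‖ < 1 ∧ ‖q * x‖ < 1} :=
    isOpen_ne.inter ((isOpen_lt (continuous_norm.comp (continuous_const_mul _))
      continuous_const).inter
      (isOpen_lt (continuous_norm.comp (continuous_const_mul _)) continuous_const))
  exact (((HolFam.of_differentiableOn (K := Unit) (f := fun x => x) differentiableOn_id).gammaReg
    hp hq hΩ (fun _ h _ => h.1) (fun _ h _ => h.2.1) fun _ h _ => h.2.2).diff
      ()).continuousOn.continuousAt
      (hΩ.mem_nhds ⟨one_ne_zero, by rwa [mul_one], by rwa [mul_one]⟩)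

lemma betaProduct_cons {ρ : ℂ} (hρ : ρ ≠ 0) (t u : Fin (m + 2) → ℂ) :
    betaProduct p q (Fin.cons ρ t) (Fin.cons ρ u) =
      ellGamma (ρ ^ 2) p q * ((∏ r, ellGamma (ρ * t r) p q * ellGamma (ρ * u r) p q) *
        (∏ r, ∏ s, ellGamma (t r * u s) p q) *
        (ellGamma (∏ s, u s) p q * ellGamma (∏ s, t s) p q) *
        ∏ r, ellGamma (ρ * ((∏ s, u s) / u r)) p q * ellGamma (ρ * ((∏ s, t s) / t r)) p q) := by
  rw [betaProduct]
  simp only [Fin.prod_univ_succ (n := m + 2), Fin.cons_zero, Fin.cons_succ,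
    Finset.prod_mul_distrib, mul_div_cancel_left₀ _ hρ]
  simp only [mul_div_assoc, pow_two, mul_comm _ ρ]
  ring

lemma tendsto_betaProduct_cons (hp0 : p ≠ 0) (hq0 : q ≠ 0) (hp : ‖p‖ < 1) (hq : ‖q‖ < 1)
    {t u : Fin (m + 2) → ℂ → ℂ} (ht : ∀ r, ContinuousAt (t r) 1) (hu : ∀ r, ContinuousAt (u r) 1)
    (ht0 : ∀ r, t r 1 ≠ 0) (hu0 : ∀ r, u r 1 ≠ 0) (ht1 : ∀ r, ‖t r 1‖ < 1)
    (hu1 : ∀ r, ‖u r 1‖ < 1) (hbal : (∏ r, t r 1) * ∏ r, u r 1 = p * q) :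
    Tendsto (fun ρ : ℝ => (1 - (ρ : ℂ) ^ 2) *
      betaProduct p q (Fin.cons (ρ : ℂ) fun r => t r ρ) (Fin.cons (ρ : ℂ) fun r => u r ρ)) (𝓝[<] 1)
      (𝓝 (gammaReg 1 p q * ((∏ r, ellGamma (t r 1) p q * ellGamma (u r 1) p q) *
        betaProduct p q (fun r => t r 1) (fun r => u r 1)))) := by
  have hcoe : Tendsto (fun ρ : ℝ => (ρ : ℂ)) (𝓝[<] 1) (𝓝 1) :=
    (Complex.continuous_ofReal.tendsto 1).mono_left nhdsWithin_le_nhds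
  have hΓ : ∀ {f : ℂ → ℂ}, ContinuousAt f 1 → f 1 ≠ 0 → ‖f 1‖ < 1 →
      ContinuousAt (fun w => ellGamma (f w) p q) 1 := fun hf h0 h1 =>
    (continuousAt_ellGamma hp hq h0 h1).comp_of_eq hf rfl
  have hT : ∀ {t : Fin (m + 2) → ℂ → ℂ}, (∀ r, ContinuousAt (t r) 1) →
      ContinuousAt (fun w => ∏ r, t r w) 1 := fun ht => tendsto_finsetProd _ fun r _ => ht r
  have hT0 : ∀ {t : Fin (m + 2) → ℂ → ℂ}, (∀ r, t r 1 ≠ 0) → ∏ r, t r 1 ≠ 0 :=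
    fun ht0 => Finset.prod_ne_zero_iff.2 fun r _ => ht0 r
  have hT1 : ∀ {t : Fin (m + 2) → ℂ → ℂ}, (∀ r, ‖t r 1‖ < 1) → ‖∏ r, t r 1‖ < 1 :=
    fun ht1 => norm_prod_lt_one ⟨0, Finset.mem_univ _⟩ fun r _ => ht1 r
  have hprod : ∀ {f : Fin (m + 2) → ℂ → ℂ}, (∀ r, ContinuousAt (f r) 1) →
      ContinuousAt (fun w => ∏ r, f r w) 1 := fun hf => tendsto_finsetProd _ fun r _ => hf r
  have hρt : ∀ {t : Fin (m + 2) → ℂ → ℂ}, (∀ r, ContinuousAt (t r) 1) → (∀ r, t r 1 ≠ 0) →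
      (∀ r, ‖t r 1‖ < 1) → ∀ r, ContinuousAt (fun w => ellGamma (w * t r w) p q) 1 :=
    fun ht ht0 ht1 r => hΓ (continuousAt_id.mul (ht r)) (by simpa using ht0 r)
      (by simpa using ht1 r)
  have hρT : ∀ {t : Fin (m + 2) → ℂ → ℂ}, (∀ r, ContinuousAt (t r) 1) → (∀ r, t r 1 ≠ 0) →
      (∀ r, ‖t r 1‖ < 1) → ∀ r,
        ContinuousAt (fun w => ellGamma (w * ((∏ s, t s w) / t r w)) p q) 1 :=
    fun {t} ht ht0 ht1 r => hρt (t := fun r w => (∏ s, t s w) / t r w)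
      (fun r => (hT ht).div (ht r) (ht0 r)) (fun r => div_ne_zero (hT0 ht0) (ht0 r))
      (norm_prod_div_lt_one ht0 ht1) r
  have hone : ellGamma (∏ s, u s 1) p q * ellGamma (∏ s, t s 1) p q = 1 := by
    have h := hT0 ht0
    rw [eq_div_of_mul_eq h ((mul_comm _ _).trans hbal), ellGamma_reflect hp0 hq0 hp hq _ h,
      inv_mul_cancel₀]
    refine ellGamma_ne_zero hp hq (hT1 ht1) ?_
    rw [← hbal, norm_mul]
    exact mul_lt_of_lt_one_right (norm_pos_iff.2 h) (hT1 hu1)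
  have hmul : ∀ {f g : ℂ → ℂ}, ContinuousAt f 1 → ContinuousAt g 1 →
      ContinuousAt (fun w => f w * g w) 1 := fun hf hg => hf.mul hg
  have hmain := hmul (ContinuousAt.comp_of_eq (f := fun w : ℂ => w ^ 2) (x := 1)
    (continuousAt_gammaReg_one hp hq) (by fun_prop) (one_pow 2))
    (hmul (hmul (hmul (hprod fun r => hmul (hρt ht ht0 ht1 r) (hρt hu hu0 hu1 r))
      (hprod fun r => hprod fun s => hΓ (hmul (ht r) (hu s)) (mul_ne_zero (ht0 r) (hu0 s)) (by
        rw [norm_mul]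
        exact mul_lt_one_of_nonneg_of_lt_one_left (norm_nonneg _) (ht1 r) (hu1 s).le)))
      (hmul (hΓ (hT hu) (hT0 hu0) (hT1 hu1)) (hΓ (hT ht) (hT0 ht0) (hT1 ht1))))
      (hprod fun r => hmul (hρT hu hu0 hu1 r) (hρT ht ht0 ht1 r)))
  have hlim := hmain.tendsto.comp hcoe
  simp only [one_mul, hone, mul_one, Function.comp_def, one_pow] at hlim
  rw [betaProduct, ← mul_assoc (∏ r, _ * _)]
  refine hlim.congr' ?_
  filter_upwards [eventually_nonneg_lt_one, mem_nhdsWithin_of_mem_nhds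
    (Ioi_mem_nhds zero_lt_one)] with ρ hρ hρ0
  have hρ0' : (ρ : ℂ) ≠ 0 := Complex.ofReal_ne_zero.2 (ne_of_gt hρ0)
  have h1 : 1 - (ρ : ℂ) ^ 2 ≠ 0 := by
    norm_cast
    nlinarith [hρ.1, hρ.2]
  rw [betaProduct_cons hρ0', ellGamma_eq_gammaReg_div hp hq ((ρ : ℂ) ^ 2),
    ← mul_assoc (1 - (ρ : ℂ) ^ 2), mul_div_cancel₀ _ h1]

end BetaProductLimit

section DimensionStep

open Filter Topology

variable {m : ℕ} {p q : ℂ}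

/-- The normalizing factor of the `A_n` elliptic beta integral. -/
noncomputable def anNorm (n : ℕ) (p q : ℂ) : ℂ :=
  (qPoch p * qPoch q) ^ n / (((n + 1).factorial : ℕ) : ℂ) * ((1 / (2 * Real.pi) : ℝ) : ℂ) ^ n

lemma qPoch_ne_zero (hp : ‖p‖ < 1) : qPoch p ≠ 0 := by
  rw [qPoch_eq]
  exact infPoch_ne_zero_of_norm_lt_one hp hp

lemma anNorm_succ_mul (hp : ‖p‖ < 1) (hq : ‖q‖ < 1) :
    anNorm (m + 1) p q * ((m + 2) * (2 * π * gammaReg 1 p q)) = anNorm m p q := by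
  have h1 := qPoch_ne_zero hp
  have h2 := qPoch_ne_zero hq
  have h3 : (((m + 1).factorial : ℕ) : ℂ) ≠ 0 := Nat.cast_ne_zero.2 (Nat.factorial_ne_zero _)
  have h4 : (m + 2 : ℂ) ≠ 0 := by norm_cast
  have h5 : (π : ℂ) ≠ 0 := Complex.ofReal_ne_zero.2 Real.pi_ne_zero
  have h6 : (m + 1 + 1 : ℂ) = m + 2 := by ring
  rw [gammaReg_one hp hq, anNorm, anNorm, Nat.factorial_succ (m + 1), pow_succ, pow_succ]
  push_cast
  rw [h6]
  field_simp

lemma eventually_mul_mul_lt_one {a : ℝ} (ha : a < 1) :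
    ∀ᶠ R : ℝ in 𝓝[>] 1, a * (R * R) < 1 := by
  have h : ContinuousAt (fun R : ℝ => a * (R * R)) 1 := by fun_prop
  exact nhdsWithin_le_nhds (h.eventually_lt_const (by simpa using ha))

lemma norm_prod_mul_lt {t : Fin (m + 2) → ℂ} {x : ℂ} (ht0 : ∀ r, t r ≠ 0) (ht : ∀ r, ‖t r‖ < 1)
    (hx : ‖x‖ < 1) (r : Fin (m + 2)) : ‖(∏ s, t s) * x‖ < ‖t r‖ := by
  rw [← div_mul_cancel₀ (∏ s, t s) (ht0 r), mul_right_comm, norm_mul, norm_mul]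
  exact mul_lt_of_lt_one_left (norm_pos_iff.2 (ht0 r))
    (mul_lt_one_of_nonneg_of_lt_one_left (norm_nonneg _) (norm_prod_div_lt_one ht0 ht r) hx.le)

/-- The evaluation of the `A_{m+1}` integral in a range of parameters where it can be deformed to
the pinching point, at which it reduces to the `A_m` integral. -/
lemma anNorm_mul_anIntegral_of_small (hp0 : p ≠ 0) (hq0 : q ≠ 0) (hp : ‖p‖ < 1) (hq : ‖q‖ < 1)
    (ih : ∀ t u : Fin (m + 2) → ℂ, (∀ r, t r ≠ 0) → (∀ r, u r ≠ 0) → (∀ r, ‖t r‖ < 1) →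
      (∀ r, ‖u r‖ < 1) → (∏ r, t r) * ∏ r, u r = p * q →
        anNorm m p q * anIntegral p q t u = betaProduct p q t u)
    {t₀ t₁ u₀ u₁ : ℂ} {t u : Fin (m + 1) → ℂ} (ht₀0 : t₀ ≠ 0) (ht₁0 : t₁ ≠ 0) (hu₀0 : u₀ ≠ 0)
    (hu₁0 : u₁ ≠ 0) (ht₀ : ‖t₀‖ < 1) (ht₁ : ‖t₁‖ < 1) (hu₀ : ‖u₀‖ < 1) (hu₁ : ‖u₁‖ < 1)
    (hPq : ‖t₀ * t₁‖ < ‖q‖) (hQq : ‖u₀ * u₁‖ < ‖q‖) (ht0 : ∀ r, t r ≠ 0)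
    (hu0 : ∀ r, u r ≠ 0) (ht : ∀ r, ‖t r‖ ^ (m + 2) < ‖q‖) (hu : ∀ r, ‖u r‖ ^ (m + 2) < ‖q‖)
    (hbal : t₀ * t₁ * (∏ r, t r) * (u₀ * u₁ * ∏ s, u s) = p * q) :
    anNorm (m + 1) p q *
        anIntegral p q (Fin.cons t₀ (Fin.cons t₁ t)) (Fin.cons u₀ (Fin.cons u₁ u)) =
      betaProduct p q (Fin.cons t₀ (Fin.cons t₁ t)) (Fin.cons u₀ (Fin.cons u₁ u)) := by
  have ht1 := fun r => norm_lt_one_of_pow_lt hq (ht r)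
  have hu1 := fun r => norm_lt_one_of_pow_lt hq (hu r)
  set P := t₀ * t₁ with hP
  set Q := u₀ * u₁ with hQ
  have hP0 : P ≠ 0 := mul_ne_zero ht₀0 ht₁0
  have hQ0 : Q ≠ 0 := mul_ne_zero hu₀0 hu₁0
  have hP1 : ‖P‖ < 1 := hPq.trans hq
  have hQ1 : ‖Q‖ < 1 := hQq.trans hq
  set κ := anIntegral p q (Fin.cons t₀ (Fin.cons t₁ t)) (Fin.cons u₀ (Fin.cons u₁ u)) /
    betaProduct p q (Fin.cons t₀ (Fin.cons t₁ t)) (Fin.cons u₀ (Fin.cons u₁ u)) with hκ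
  have hR : betaProduct p q (Fin.cons t₀ (Fin.cons t₁ t)) (Fin.cons u₀ (Fin.cons u₁ u)) ≠ 0 :=
    betaProduct_ne_zero hp hq (Fin.forall_cons_cons (φ := fun x => x ≠ 0) ht₀0 ht₁0 ht0)
      (Fin.forall_cons_cons (φ := fun x => x ≠ 0) hu₀0 hu₁0 hu0)
      (Fin.forall_cons_cons (φ := fun x => ‖x‖ < 1) ht₀ ht₁ ht1)
      (Fin.forall_cons_cons (φ := fun x => ‖x‖ < 1) hu₀ hu₁ hu1)
      (by rw [Fin.prod_cons_cons, Fin.prod_cons_cons]; exact hbal)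
  suffices h : anNorm (m + 1) p q * κ = 1 by
    rw [← div_mul_cancel₀ (anIntegral p q _ _) hR, ← mul_assoc, ← hκ, h, one_mul]
  obtain ⟨R, hR1, hpR, hqR, hPR, hQR, htR, huR⟩ : ∃ R : ℝ, 1 < R ∧ ‖p‖ * (R * R) < 1 ∧
      ‖q‖ * (R * R) < 1 ∧ ‖P‖ * (R * R) < 1 ∧ ‖Q‖ * (R * R) < 1 ∧
        (∀ r, ‖t r‖ * (R * R) < 1) ∧ ∀ r, ‖u r‖ * (R * R) < 1 := by
    refine Eventually.exists (f := 𝓝[>] (1 : ℝ)) ?_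
    filter_upwards [self_mem_nhdsWithin, eventually_mul_mul_lt_one hp, eventually_mul_mul_lt_one hq,
      eventually_mul_mul_lt_one hP1, eventually_mul_mul_lt_one hQ1,
      eventually_all.2 fun r => eventually_mul_mul_lt_one (ht1 r),
      eventually_all.2 fun r => eventually_mul_mul_lt_one (hu1 r)] with R h1 h2 h3 h4 h5 h6 h7
    exact ⟨h1, h2, h3, h4, h5, h6, h7⟩
  have hR0 : 0 < R := one_pos.trans hR1
  set Ω : Set ℂ := {w | R⁻¹ < ‖w‖ ∧ ‖w‖ < R} with hΩ
  have hΩ0 : ∀ w ∈ Ω, w ≠ 0 := fun w hw => norm_pos_iff.1 ((inv_pos.2 hR0).trans hw.1)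
  have hΩ1 : (1 : ℂ) ∈ Ω :=
    ⟨by rw [norm_one]; exact inv_lt_one_of_one_lt₀ hR1, by rwa [norm_one]⟩
  have hopen : IsOpen Ω := (isOpen_lt continuous_const continuous_norm).inter
    (isOpen_lt continuous_norm continuous_const)
  set f : ℂ → (Fin (m + 1) → ℂ) → Fin (m + 2) → ℂ → ℂ := fun P t r w =>
    (Fin.cons (P / w) t : Fin (m + 2) → ℂ) r with hf
  have hfd : ∀ P t r, DifferentiableOn ℂ (f P t r) Ω := fun P t r =>
    Fin.cases ((differentiableOn_const P).div differentiableOn_id hΩ0)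
      (fun r => differentiableOn_const (t r)) r
  have hf0 : ∀ {P t}, P ≠ 0 → (∀ r, t r ≠ 0) → ∀ r, ∀ w ∈ Ω, f P t r w ≠ 0 :=
    fun hP ht r w hw => Fin.cases (div_ne_zero hP (hΩ0 w hw)) ht r
  have hfR : ∀ {P t}, ‖P‖ * (R * R) < 1 → (∀ r, ‖t r‖ * (R * R) < 1) → ∀ r, ∀ w ∈ Ω,
      ‖f P t r w‖ * R < 1 := by
    intro P t hP ht r w hw
    refine Fin.cases ?_ (fun r => ?_) r
    · have : ‖w‖⁻¹ < R := inv_lt_of_inv_lt₀ hR0 hw.1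
      simp only [hf, Fin.cons_zero, norm_div]
      rw [div_eq_mul_inv, mul_assoc]
      exact (mul_le_mul_of_nonneg_left (mul_le_mul_of_nonneg_right this.le hR0.le)
        (norm_nonneg P)).trans_lt hP
    · refine lt_of_le_of_lt ?_ (ht r)
      exact mul_le_mul_of_nonneg_left (le_mul_of_one_le_left hR0.le hR1.le) (norm_nonneg _)
  have hf1 : ∀ {P t}, ‖P‖ * (R * R) < 1 → (∀ r, ‖t r‖ * (R * R) < 1) → ∀ r, ∀ w ∈ Ω,
      ‖f P t r w‖ < 1 := fun hP ht r w hw =>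
    (le_mul_of_one_le_right (norm_nonneg _) hR1.le).trans_lt (hfR hP ht r w hw)
  have hfprod : ∀ P t, ∏ r, f P t r 1 = P * ∏ r, t r := fun P t => by
    simp [hf, Fin.prod_univ_succ]
  have hbal1 : (∏ r, f P t r 1) * ∏ r, f Q u r 1 = p * q := by rw [hfprod, hfprod, hbal]
  have hI := tendsto_anIntegral_cons hR1 hp0 hq0 hp hq hpR hqR hΩ (hfd P t) (hfd Q u)
    (hf0 hP0 ht0) (hf0 hQ0 hu0) (hfR hPR htR) (hfR hQR huR)
  have hB := tendsto_betaProduct_cons hp0 hq0 hp hq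
    (fun r => (hfd P t r).continuousOn.continuousAt (hopen.mem_nhds hΩ1))
    (fun r => (hfd Q u r).continuousOn.continuousAt (hopen.mem_nhds hΩ1))
    (fun r => hf0 hP0 ht0 r 1 hΩ1) (fun r => hf0 hQ0 hu0 r 1 hΩ1)
    (fun r => hf1 hPR htR r 1 hΩ1) (fun r => hf1 hQR huR r 1 hΩ1) hbal1
  have hIB := tendsto_nhds_unique_of_eventuallyEq hI (hB.const_mul κ) (by
    filter_upwards [self_mem_nhdsWithin, mem_nhdsWithin_of_mem_nhds (Ioi_mem_nhds hP1),
      mem_nhdsWithin_of_mem_nhds (Ioi_mem_nhds hQ1)] with ρ hρ1 hρP hρQ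
    rw [Set.mem_Iio] at hρ1
    rw [Set.mem_Ioi] at hρP hρQ
    have hρ0 : 0 < ρ := (norm_nonneg _).trans_lt hρP
    have hnρ : ‖(ρ : ℂ)‖ = ρ := by rw [Complex.norm_real, Real.norm_of_nonneg hρ0.le]
    rw [← hnρ] at hρ1 hρP hρQ
    have hρ0' := Complex.ofReal_ne_zero.2 hρ0.ne'
    have hd := anIntegral_div_betaProduct_deform_pair hp0 hq0 hp hq ht₀0 ht₁0 hu₀0 hu₁0 ht₀ ht₁ hu₀
      hu₁ hPq hQq ht0 hu0 ht hu hbal hρP hρ1 hρQ hρ1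
    rw [← hκ, eq_div_iff (betaProduct_ne_zero hp hq
      (Fin.forall_cons_cons (φ := fun x => x ≠ 0) hρ0' (div_ne_zero hP0 hρ0') ht0)
      (Fin.forall_cons_cons (φ := fun x => x ≠ 0) hρ0' (div_ne_zero hQ0 hρ0') hu0)
      (Fin.forall_cons_cons (φ := fun x => ‖x‖ < 1) hρ1 (norm_div_lt_one hρP) ht1)
      (Fin.forall_cons_cons (φ := fun x => ‖x‖ < 1) hρ1 (norm_div_lt_one hρQ) hu1)
      (by rw [Fin.prod_cons_cons, Fin.prod_cons_cons, mul_div_cancel₀ _ hρ0',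
        mul_div_cancel₀ _ hρ0', hbal]))] at hd
    rw [mul_left_comm]
    exact congrArg _ hd.symm)
  have hih := ih (fun r => f P t r 1) (fun r => f Q u r 1) (fun r => hf0 hP0 ht0 r 1 hΩ1)
    (fun r => hf0 hQ0 hu0 r 1 hΩ1) (fun r => hf1 hPR htR r 1 hΩ1) (fun r => hf1 hQR huR r 1 hΩ1)
    hbal1
  have hBm : betaProduct p q (fun r => f P t r 1) (fun r => f Q u r 1) ≠ 0 :=
    betaProduct_ne_zero hp hq (fun r => hf0 hP0 ht0 r 1 hΩ1)
      (fun r => hf0 hQ0 hu0 r 1 hΩ1) (fun r => hf1 hPR htR r 1 hΩ1) (fun r => hf1 hQR huR r 1 hΩ1)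
      hbal1
  have hγ : gammaReg 1 p q ≠ 0 := gammaReg_ne_zero hp hq norm_one
  have hE : ∏ r, ellGamma (f P t r 1) p q * ellGamma (f Q u r 1) p q ≠ 0 :=
    Finset.prod_ne_zero_iff.2 fun r _ => mul_ne_zero
      (ellGamma_ne_zero hp hq (hf1 hPR htR r 1 hΩ1) (by
        rw [← hbal1]
        exact norm_prod_mul_lt (hf0 hP0 ht0 · 1 hΩ1) (hf1 hPR htR · 1 hΩ1)
          (norm_prod_lt_one ⟨0, Finset.mem_univ _⟩ fun r _ => hf1 hQR huR r 1 hΩ1) r))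
      (ellGamma_ne_zero hp hq (hf1 hQR huR r 1 hΩ1) (by
        rw [← hbal1, mul_comm]
        exact norm_prod_mul_lt (hf0 hQ0 hu0 · 1 hΩ1) (hf1 hQR huR · 1 hΩ1)
          (norm_prod_lt_one ⟨0, Finset.mem_univ _⟩ fun r _ => hf1 hPR htR r 1 hΩ1) r))
  set E := ∏ r, ellGamma (f P t r 1) p q * ellGamma (f Q u r 1) p q
  rw [← anNorm_succ_mul hp hq] at hih
  rw [← hih] at hIB hBm
  have hI0 := right_ne_zero_of_mul hBm
  have hc0 := right_ne_zero_of_mul (left_ne_zero_of_mul hBm)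
  refine mul_right_cancel₀ (mul_ne_zero (mul_ne_zero hc0 (mul_ne_zero hγ hE)) hI0) ?_
  linear_combination -hIB

end DimensionStep

section Continuation

open Filter Topology

variable {n m : ℕ} {p q : ℂ}

lemma anNorm_mul_anIntegral_of_lt (hp0 : p ≠ 0) (hq0 : q ≠ 0) (hp : ‖p‖ < 1) (hq : ‖q‖ < 1)
    (ih : ∀ t u : Fin (m + 2) → ℂ, (∀ r, t r ≠ 0) → (∀ r, u r ≠ 0) → (∀ r, ‖t r‖ < 1) →
      (∀ r, ‖u r‖ < 1) → (∏ r, t r) * ∏ r, u r = p * q →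
        anNorm m p q * anIntegral p q t u = betaProduct p q t u)
    {t u : Fin (m + 3) → ℂ} (ht0 : ∀ r, t r ≠ 0) (hu0 : ∀ r, u r ≠ 0) (ht : ∀ r, ‖t r‖ < ‖q‖)
    (hu : ∀ r, ‖u r‖ < ‖q‖) (hbal : (∏ r, t r) * ∏ r, u r = p * q) :
    anNorm (m + 1) p q * anIntegral p q t u = betaProduct p q t u := by
  have e : ∀ t : Fin (m + 3) → ℂ,
      t = Fin.cons (t 0) (Fin.cons (t 1) fun r : Fin (m + 1) => t r.succ.succ) := fun t => by
    funext r
    exact Fin.cases rfl (Fin.cases rfl fun r => rfl) r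
  have hpow : ∀ {x : ℂ}, ‖x‖ < ‖q‖ → ‖x‖ ^ (m + 2) < ‖q‖ := fun h =>
    (pow_le_of_le_one (norm_nonneg _) (h.trans hq).le (Nat.succ_ne_zero _)).trans_lt h
  have hmul : ∀ {x y : ℂ}, ‖x‖ < ‖q‖ → ‖y‖ < ‖q‖ → ‖x * y‖ < ‖q‖ := fun hx hy => by
    rw [norm_mul]
    exact (mul_le_of_le_one_right (norm_nonneg _) (hy.trans hq).le).trans_lt hx
  rw [e t, e u]
  refine anNorm_mul_anIntegral_of_small hp0 hq0 hp hq ih (ht0 0) (ht0 1) (hu0 0) (hu0 1)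
    ((ht 0).trans hq) ((ht 1).trans hq) ((hu 0).trans hq) ((hu 1).trans hq) (hmul (ht 0) (ht 1))
    (hmul (hu 0) (hu 1)) (fun r => ht0 _) (fun r => hu0 _) (fun r => hpow (ht _))
    (fun r => hpow (hu _)) ?_
  rw [← hbal]
  conv_rhs => rw [e t, e u, Fin.prod_cons_cons, Fin.prod_cons_cons]

lemma differentiableOn_anNorm {Ω : Set ℂ} (hΩ : IsOpen Ω) {P : ℂ → ℂ}
    (hP : DifferentiableOn ℂ P Ω) (hp1 : ∀ w ∈ Ω, ‖P w‖ < 1) :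
    DifferentiableOn ℂ (fun w => anNorm n (P w) q) Ω := by
  have HP : HolFam (K := Unit) Ω fun w _ => P w := HolFam.of_differentiableOn hP
  have h := (HP.dblPoch hΩ HP (HolFam.of_continuous (continuous_const (y := (0 : ℂ))))
    (fun w hw _ => hp1 w hw) (by simp)).diff ()
  have hq : DifferentiableOn ℂ (fun w => qPoch (P w)) Ω := h.congr fun w hw => by
    rw [qPoch_eq, dblPoch_zero_right _ _ (hp1 w hw)]
  exact (((hq.mul_const _).pow n).div_const _).mul_const _

lemma exists_exp_mul_lt_one {ι : Type*} [Finite ι] {t : ι → ℂ} (ht : ∀ r, ‖t r‖ < 1) {p : ℂ}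
    (hp : ‖p‖ < 1) (k : ℕ) :
    ∃ β : ℝ, 0 < β ∧ (∀ r, Real.exp β * ‖t r‖ < 1) ∧ Real.exp β ^ k * ‖p‖ < 1 := by
  have h1 : ∀ᶠ β : ℝ in 𝓝[>] 0, ∀ r, Real.exp β * ‖t r‖ < 1 := eventually_all.2 fun r => by
    have : ContinuousAt (fun β : ℝ => Real.exp β * ‖t r‖) 0 := by fun_prop
    exact nhdsWithin_le_nhds (this.eventually_lt_const (by simpa using ht r))
  have h2 : ∀ᶠ β : ℝ in 𝓝[>] 0, Real.exp β ^ k * ‖p‖ < 1 := by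
    have : ContinuousAt (fun β : ℝ => Real.exp β ^ k * ‖p‖) 0 := by fun_prop
    exact nhdsWithin_le_nhds (this.eventually_lt_const (by simpa using hp))
  exact (Eventually.and (f := 𝓝[>] (0 : ℝ)) self_mem_nhdsWithin (h1.and h2)).exists

/-- The evaluation of the `A_{m+1}` integral follows from that of the `A_m` integral: the general
case is obtained from the case of small parameters by analytic continuation in `p` and the
parameters. -/
lemma anNorm_succ_mul_anIntegral (hp0 : p ≠ 0) (hq0 : q ≠ 0) (hp : ‖p‖ < 1) (hq : ‖q‖ < 1)
    (ih : ∀ p, p ≠ 0 → ‖p‖ < 1 → ∀ t u : Fin (m + 2) → ℂ, (∀ r, t r ≠ 0) → (∀ r, u r ≠ 0) →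
      (∀ r, ‖t r‖ < 1) → (∀ r, ‖u r‖ < 1) → (∏ r, t r) * ∏ r, u r = p * q →
        anNorm m p q * anIntegral p q t u = betaProduct p q t u)
    {t u : Fin (m + 3) → ℂ} (ht0 : ∀ r, t r ≠ 0) (hu0 : ∀ r, u r ≠ 0) (ht : ∀ r, ‖t r‖ < 1)
    (hu : ∀ r, ‖u r‖ < 1) (hbal : (∏ r, t r) * ∏ r, u r = p * q) :
    anNorm (m + 1) p q * anIntegral p q t u = betaProduct p q t u := by
  set k := (m + 3) + (m + 3) with hk
  obtain ⟨β, hβ, hβ1, hβp⟩ := exists_exp_mul_lt_one (t := Sum.elim t u)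
    (fun r => Sum.casesOn r ht hu) hp k
  set Ω : Set ℂ := {w | w.re < β} with hΩ
  have hopen : IsOpen Ω := isOpen_lt Complex.continuous_re continuous_const
  have hconn : IsPreconnected Ω := (convex_halfSpace_re_lt β).isPreconnected
  have hexp : DifferentiableOn ℂ Complex.exp Ω := Complex.differentiable_exp.differentiableOn
  have hlt : ∀ {x : ℂ}, Real.exp β * ‖x‖ < 1 → ∀ w ∈ Ω, ‖Complex.exp w * x‖ < 1 := by
    intro x hx w hw
    rw [norm_mul, Complex.norm_exp]
    exact (mul_le_mul_of_nonneg_right (Real.exp_le_exp.2 (le_of_lt hw)) (norm_nonneg _)).trans_lt hx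
  have h0 : ∀ {x : ℂ}, x ≠ 0 → ∀ w ∈ Ω, Complex.exp w * x ≠ 0 := fun hx w _ =>
    mul_ne_zero (Complex.exp_ne_zero w) hx
  have hd : ∀ x : ℂ, DifferentiableOn ℂ (fun w => Complex.exp w * x) Ω := fun x =>
    hexp.mul_const x
  have hP : DifferentiableOn ℂ (fun w => Complex.exp w ^ k * p) Ω := (hexp.pow k).mul_const p
  have hP0 : ∀ w ∈ Ω, Complex.exp w ^ k * p ≠ 0 := fun w _ =>
    mul_ne_zero (pow_ne_zero _ (Complex.exp_ne_zero w)) hp0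
  have hP1 : ∀ w ∈ Ω, ‖Complex.exp w ^ k * p‖ < 1 := by
    intro w hw
    rw [norm_mul, norm_pow, Complex.norm_exp]
    exact (mul_le_mul_of_nonneg_right (pow_le_pow_left₀ (Real.exp_pos _).le
      (Real.exp_le_exp.2 (le_of_lt hw)) k) (norm_nonneg _)).trans_lt hβp
  have ht1 : ∀ r, ∀ w ∈ Ω, ‖Complex.exp w * t r‖ < 1 := fun r => hlt (hβ1 (Sum.inl r))
  have hu1 : ∀ r, ∀ w ∈ Ω, ‖Complex.exp w * u r‖ < 1 := fun r => hlt (hβ1 (Sum.inr r))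
  have hL := (differentiableOn_anNorm (n := m + 1) (q := q) hopen hP hP1).mul
    ((HolFam.anKernel_torusPt hopen hP (fun r => hd (t r)) (fun r => hd (u r)) hP1 hP0 hq hq0
      (fun r => h0 (ht0 r)) (fun r => h0 (hu0 r)) ht1 hu1).differentiableOn_integral
        (μ := volume) hopen)
  have hR := differentiableOn_betaProduct hopen hP (fun r => hd (t r)) (fun r => hd (u r)) hP1 hq
    (fun r => h0 (ht0 r)) (fun r => h0 (hu0 r)) ht1 hu1
  have hsmall : ∀ w ∈ Ω, w.re < Real.log ‖q‖ → ∀ x : ℂ, ‖x‖ < 1 →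
      ‖Complex.exp w * x‖ < ‖q‖ := by
    intro w _ hw x hx
    rw [norm_mul, Complex.norm_exp]
    exact (mul_le_of_le_one_right (Real.exp_pos _).le hx.le).trans_lt
      ((Real.lt_log_iff_exp_lt (norm_pos_iff.2 hq0)).1 hw)
  have hlog : Real.log ‖q‖ < 0 := Real.log_neg (norm_pos_iff.2 hq0) hq
  have hw₀ : ((Real.log ‖q‖ - 1 : ℝ) : ℂ) ∈ Ω := by
    rw [hΩ, Set.mem_ofPred_eq, Complex.ofReal_re]
    linarith
  have hev : ∀ᶠ w : ℂ in 𝓝 ((Real.log ‖q‖ - 1 : ℝ) : ℂ), w ∈ Ω ∧ w.re < Real.log ‖q‖ :=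
    Filter.Eventually.and (hopen.mem_nhds hw₀) ((isOpen_lt Complex.continuous_re
      continuous_const).mem_nhds
      (by rw [Set.mem_ofPred_eq, Complex.ofReal_re]; linarith))
  have := (hL.analyticOnNhd hopen).eqOn_of_preconnected_of_eventuallyEq
    (hR.analyticOnNhd hopen) hconn hw₀ (hev.mono fun w hw => by
      refine anNorm_mul_anIntegral_of_lt (hP0 w hw.1) hq0 (hP1 w hw.1) hq
        (ih _ (hP0 w hw.1) (hP1 w hw.1)) (fun r => h0 (ht0 r) w hw.1) (fun r => h0 (hu0 r) w hw.1)
        (fun r => hsmall w hw.1 hw.2 _ (ht r)) (fun r => hsmall w hw.1 hw.2 _ (hu r)) ?_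
      simp only [Finset.prod_mul_distrib, Finset.prod_const, Finset.card_univ, Fintype.card_fin]
      rw [hk, pow_add]
      linear_combination Complex.exp w ^ (m + 3) * Complex.exp w ^ (m + 3) * hbal)
  have h := this (show (0 : ℂ) ∈ Ω from hβ)
  simpa [anIntegral] using h

/-- The `A_0` case of the evaluation. -/
lemma anNorm_zero_mul_anIntegral (hp0 : p ≠ 0) (hq0 : q ≠ 0) (hp : ‖p‖ < 1) (hq : ‖q‖ < 1)
    {t u : Fin 2 → ℂ} (ht0 : ∀ r, t r ≠ 0) (hu0 : ∀ r, u r ≠ 0) (ht : ∀ r, ‖t r‖ < 1)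
    (hu : ∀ r, ‖u r‖ < 1) (hbal : (∏ r, t r) * ∏ r, u r = p * q) :
    anNorm 0 p q * anIntegral p q t u = betaProduct p q t u := by
  have hz : ∀ x : Fin 0 → AddCircle (2 * π), torusPt x 0 = 1 := fun x => by
    simpa using prod_torusPt x
  have hI : anIntegral p q t u =
      ∏ r, ellGamma (t r) p q * ellGamma (u r) p q := by
    rw [anIntegral, integral_unique, Measure.real, volume_pi, Measure.pi_univ]
    simp [anKernel, hz]
  simp only [Fin.prod_univ_two] at hbal
  have hΓ : ∀ {x y : ℂ}, x ≠ 0 → x * y = p * q → ‖x‖ < 1 → ‖y‖ < 1 → y ≠ 0 →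
      ellGamma x p q * ellGamma y p q = 1 := by
    intro x y hx hxy hx1 hy1 hy
    have hn : ‖p * q‖ < ‖x‖ := by
      rw [← hxy, norm_mul]
      exact mul_lt_of_lt_one_right (norm_pos_iff.2 hx) hy1
    rw [eq_div_of_mul_eq hx ((mul_comm y x).trans hxy), ellGamma_reflect hp0 hq0 hp hq x hx,
      mul_inv_cancel₀ (ellGamma_ne_zero hp hq hx1 hn)]
  have hm : ∀ {x y : ℂ}, ‖x‖ < 1 → ‖y‖ < 1 → ‖x * y‖ < 1 := fun hx hy => by
    rw [norm_mul]
    exact mul_lt_one_of_nonneg_of_lt_one_left (norm_nonneg _) hx hy.le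
  have h1 := hΓ (mul_ne_zero (ht0 0) (hu0 0)) (y := t 1 * u 1) (by rw [← hbal]; ring)
    (hm (ht 0) (hu 0)) (hm (ht 1) (hu 1)) (mul_ne_zero (ht0 1) (hu0 1))
  have h2 := hΓ (mul_ne_zero (ht0 0) (hu0 1)) (y := t 1 * u 0) (by rw [← hbal]; ring)
    (hm (ht 0) (hu 1)) (hm (ht 1) (hu 0)) (mul_ne_zero (ht0 1) (hu0 0))
  have e0 : ∀ {f : Fin 2 → ℂ}, (∀ r, f r ≠ 0) → f 0 * f 1 / f 0 = f 1 := fun h =>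
    mul_div_cancel_left₀ _ (h 0)
  have e1 : ∀ {f : Fin 2 → ℂ}, (∀ r, f r ≠ 0) → f 0 * f 1 / f 1 = f 0 := fun h =>
    mul_div_cancel_right₀ _ (h 1)
  have hB : betaProduct p q t u =
      (ellGamma (t 0 * u 0) p q * ellGamma (t 1 * u 1) p q) *
        (ellGamma (t 0 * u 1) p q * ellGamma (t 1 * u 0) p q) *
          ((ellGamma (t 0) p q * ellGamma (u 0) p q) *
            (ellGamma (t 1) p q * ellGamma (u 1) p q)) := by
    simp only [betaProduct, Nat.reduceAdd, Fin.prod_univ_two, e0 ht0, e1 ht0, e0 hu0, e1 hu0]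
    ring
  rw [hB, h1, h2, hI, Fin.prod_univ_two]
  simp [anNorm]

/-- The evaluation of the normalized `A_n` elliptic beta integral. -/
lemma anNorm_mul_anIntegral (hq0 : q ≠ 0) (hq : ‖q‖ < 1) (n : ℕ) : ∀ p, p ≠ 0 → ‖p‖ < 1 →
    ∀ t u : Fin (n + 2) → ℂ, (∀ r, t r ≠ 0) → (∀ r, u r ≠ 0) → (∀ r, ‖t r‖ < 1) →
      (∀ r, ‖u r‖ < 1) → (∏ r, t r) * ∏ r, u r = p * q →
        anNorm n p q * anIntegral p q t u = betaProduct p q t u := by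
  induction n with
  | zero =>
    intro p hp0 hp t u ht0 hu0 ht hu hbal
    exact anNorm_zero_mul_anIntegral hp0 hq0 hp hq ht0 hu0 ht hu hbal
  | succ m ih =>
    intro p hp0 hp t u ht0 hu0 ht hu hbal
    exact anNorm_succ_mul_anIntegral hp0 hq0 hp hq ih ht0 hu0 ht hu hbal

end Continuation

/-- The Type I `A_n` elliptic beta integral conjectured by Spiridonov:
here `z_i = e^{iθ_i}` for `1 ≤ i ≤ n` and `z_0 = 1/(z_1⋯z_n)`. -/
theorem spiridonov_An_integral (n : ℕ) (p q : ℂ)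
    (hp0 : 0 < ‖p‖) (hp1 : ‖p‖ < 1)
    (hq0 : 0 < ‖q‖) (hq1 : ‖q‖ < 1)
    (t u : Fin (n + 2) → ℂ)
    (ht0 : ∀ r, t r ≠ 0) (hu0 : ∀ r, u r ≠ 0)
    (ht : ∀ r, ‖t r‖ < 1) (hu : ∀ r, ‖u r‖ < 1)
    (hbal : ∏ r, t r * u r = p * q) :
    (qPoch p * qPoch q) ^ n / (((n + 1).factorial : ℕ) : ℂ) *
      ((1 / (2 * Real.pi) : ℝ) : ℂ) ^ n *
      (∫ θ in Set.univ.pi fun _ : Fin n => Set.Icc (0 : ℝ) (2 * Real.pi),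
        (fun z : Fin (n + 1) → ℂ =>
          (∏ i, ∏ r, ellGamma (t r * z i) p q * ellGamma (u r / z i) p q) /
            ∏ i, ∏ j, if i < j then ellGamma (z i / z j) p q * ellGamma (z j / z i) p q else 1)
        (Fin.cons (1 / ∏ j : Fin n, Complex.exp (Complex.I * θ j))
          (fun j => Complex.exp (Complex.I * θ j)))) =
      (∏ r, ∏ s, ellGamma (t r * u s) p q) *
        ∏ r, ellGamma ((∏ s, u s) / u r) p q * ellGamma ((∏ s, t s) / t r) p q := by
  have hbal' : (∏ r, t r) * ∏ r, u r = p * q := by rw [← Finset.prod_mul_distrib, hbal]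
  rw [setIntegral_eq_anIntegral hp0 hq0 hp1 hq1 ht0 hu0 ht hu]
  exact anNorm_mul_anIntegral (norm_pos_iff.1 hq0) hq1 n p (norm_pos_iff.1 hp0) hp1 t u ht0 hu0 ht
    hu hbal'
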